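/- arXiv:math/0701346 — 2 statements merged into one kernel-verified Lean document; each statement's English description precedes it below -/
import Mathlib

section
/- Let (G_n) be a sequence of weighted graphs with |G_n| = n and β_max = sup_{i,j,n} β_ij(n) < ∞, converging to a graphon W, and let c > 0 be a constant with c·‖T_W‖ ≤ 1. Then the number C₁ of vertices in the largest component of the random graph G_n(c/n) satisfies C₁ = o_p(n); i.e., for every ε > 0, P(C₁ ≥ εn) → 0 as n → ∞. -/
open MeasureTheory Filter Topology

noncomputable section

namespace Percolation

/-- The symmetrized lift of a two-variable real function to `Sym2`. If `f` is symmetric,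
`sym2Val f s(a, b) = f a b`. -/
def sym2Val {α : Type*} (f : α → α → ℝ) : Sym2 α → ℝ :=
  Sym2.lift ⟨fun a b => (f a b + f b a) / 2, fun a b => by simp [add_comm]⟩

/-- The product over the edges of `F` of a symmetric function of the endpoints. -/
def edgeProd {k : ℕ} (F : SimpleGraph (Fin k)) (f : Fin k → Fin k → ℝ) : ℝ := by
  classical exact ∏ e ∈ F.edgeFinset, sym2Val f e

/-- The homomorphism density `t(F, G)` of a finite simple graph `F` in the weighted graph
on `[n]` with edge weights `β`. -/
def homDensityG {n k : ℕ} (β : Fin n → Fin n → ℝ) (F : SimpleGraph (Fin k)) : ℝ :=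
  (∑ v : Fin k → Fin n, edgeProd F fun i j => β (v i) (v j)) / (n : ℝ) ^ k

/-- The unit interval `[0,1] ⊆ ℝ`. -/
def I01 : Set ℝ := Set.Icc 0 1

/-- The homomorphism density `t(F, W)` of a finite simple graph `F` in a graphon `W`. -/
def homDensityW {k : ℕ} (W : ℝ → ℝ → ℝ) (F : SimpleGraph (Fin k)) : ℝ :=
  ∫ x : Fin k → ℝ in Set.univ.pi fun _ => I01, edgeProd F fun i j => W (x i) (x j)

/-- `G_n → W`: convergence of the homomorphism densities for every finite simple graph. -/
def ConvergesTo (β : ∀ n : ℕ, Fin n → Fin n → ℝ) (W : ℝ → ℝ → ℝ) : Prop :=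
  ∀ (k : ℕ) (F : SimpleGraph (Fin k)),
    Tendsto (fun n => homDensityG (β n) F) atTop (nhds (homDensityW W F))

/-- `W` is a graphon: a bounded symmetric measurable function with nonnegative values. -/
def IsGraphon (W : ℝ → ℝ → ℝ) : Prop :=
  Measurable (Function.uncurry W) ∧ (∀ x y, 0 ≤ W x y) ∧ (∀ x y, W x y = W y x) ∧
    ∃ M : ℝ, ∀ x y, W x y ≤ M

/-- The Bernoulli measure on `Bool` with success probability `p`. -/
def bern (p : ℝ) : Measure Bool :=
  ENNReal.ofReal p • Measure.dirac true + ENNReal.ofReal (1 - p) • Measure.dirac false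

/-- The law of the random graph in which each pair `{v, w}` is an edge independently
with probability `min (p * β v w) 1`; a point of the sample space records for each
unordered pair whether it is an edge. -/
def percMeasure {V : Type*} [Fintype V] [DecidableEq V] (β : V → V → ℝ) (p : ℝ) :
    Measure (Sym2 V → Bool) :=
  Measure.pi fun e => bern (min (p * sym2Val β e) 1)

/-- The simple graph determined by a point of the sample space. -/
def graphOf {V : Type*} (ω : Sym2 V → Bool) : SimpleGraph V :=
  SimpleGraph.fromRel fun i j => ω s(i, j)

/-- The number of vertices of the component of `v` in `G`. -/
def compSize {V : Type*} (G : SimpleGraph V) (v : V) : ℕ := {w | G.Reachable v w}.ncard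

/-- The number of vertices of the largest component of `G`. -/
def C1 {V : Type*} [Fintype V] (G : SimpleGraph V) : ℕ :=
  Finset.univ.sup fun v => compSize G v

/-- The number of vertices of the second largest component of `G` (zero if `G` is
connected): the largest value of `min (|C_v|, |C_w|)` over vertices `v`, `w` lying in
distinct components. -/
def C2 {V : Type*} (G : SimpleGraph V) : ℕ :=
  sSup {m | ∃ v w : V, ¬G.Reachable v w ∧ m = min (compSize G v) (compSize G w)}

/-- The operator `T_W` with kernel `W` applied to `f`. -/
def applyT (W : ℝ → ℝ → ℝ) (f : ℝ → ℝ) (x : ℝ) : ℝ := ∫ y in I01, W x y * f y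

/-- The `L²[0,1]` norm of a function. -/
def l2norm (f : ℝ → ℝ) : ℝ := Real.sqrt (∫ x in I01, f x ^ 2)

/-- The `L²`-operator norm `‖T_W‖` of the integral operator with kernel `W`. -/
def opNorm (W : ℝ → ℝ → ℝ) : ℝ :=
  sSup {r | ∃ f : ℝ → ℝ, Measurable f ∧
    MeasureTheory.IntegrableOn (fun x => f x ^ 2) I01 ∧
    l2norm f ≤ 1 ∧ r = l2norm (applyT W f)}

/-- The survival probability `ρ(W)` of the multitype Poisson branching process with
kernel `W`: the supremum of `∫ f` over measurable `f : [0,1] → [0,1]` satisfying the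
functional equation `f(x) = 1 - exp(-∫ W(x,y) f(y) dy)` almost everywhere. -/
def survival (W : ℝ → ℝ → ℝ) : ℝ :=
  sSup {r | ∃ f : ℝ → ℝ, Measurable f ∧ (∀ x, f x ∈ Set.Icc (0 : ℝ) 1) ∧
    (∀ᵐ x ∂volume.restrict I01, f x = 1 - Real.exp (-∫ y in I01, W x y * f y)) ∧
    r = ∫ x in I01, f x}

/-- A graphon `W` is irreducible if there is no measurable `A ⊆ [0,1]` with
`0 < μ(A) < 1` such that `W = 0` a.e. on `A × ([0,1] \ A)`. -/
def Irreducible (W : ℝ → ℝ → ℝ) : Prop :=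
  ¬∃ A : Set ℝ, MeasurableSet A ∧ A ⊆ I01 ∧ 0 < volume A ∧ volume A < 1 ∧
    ∀ᵐ p : ℝ × ℝ, p.1 ∈ A → p.2 ∈ I01 \ A → W p.1 p.2 = 0

end Percolation
namespace Percolation

def opT {V : Type*} [Fintype V] (A : V → V → ℝ) (f : V → ℝ) : V → ℝ := fun i => ∑ j, A i j * f j

section mat
variable {V : Type*} [Fintype V] (A : V → V → ℝ)

lemma opT_symm (hA : ∀ i j, A i j = A j i) (f g : V → ℝ) :
    ∑ i, opT A f i * g i = ∑ i, f i * opT A g i := by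
  simp only [opT, Finset.sum_mul, Finset.mul_sum]
  rw [Finset.sum_comm]
  refine Finset.sum_congr rfl fun i _ => Finset.sum_congr rfl fun j _ => ?_
  rw [hA j i]; ring

lemma opT_iter_symm (hA : ∀ i j, A i j = A j i) (k : ℕ) (f g : V → ℝ) :
    ∑ i, (opT A)^[k] f i * g i = ∑ i, f i * (opT A)^[k] g i := by
  induction k generalizing g with
  | zero => simp
  | succ k ih =>
    rw [Function.iterate_succ_apply', opT_symm A hA, ih, ← Function.iterate_succ_apply]

lemma opT_mono (hA0 : ∀ i j, 0 ≤ A i j) {f g : V → ℝ} (h : ∀ i, f i ≤ g i) (i : V) :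
    opT A f i ≤ opT A g i :=
  Finset.sum_le_sum fun j _ => mul_le_mul_of_nonneg_left (h j) (hA0 i j)

lemma opT_nonneg (hA0 : ∀ i j, 0 ≤ A i j) {g : V → ℝ} (h : ∀ i, 0 ≤ g i) (i : V) :
    0 ≤ opT A g i :=
  Finset.sum_nonneg fun j _ => mul_nonneg (hA0 i j) (h j)

lemma opT_smul (c : ℝ) (f : V → ℝ) : opT A (fun i => c * f i) = fun i => c * opT A f i := by
  funext i
  simp only [opT, Finset.mul_sum]
  exact Finset.sum_congr rfl fun j _ => by ring

lemma opT_iter_smul (c : ℝ) (k : ℕ) (f : V → ℝ) :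
    (opT A)^[k] (fun i => c * f i) = fun i => c * (opT A)^[k] f i := by
  induction k generalizing f with
  | zero => rfl
  | succ k ih => rw [Function.iterate_succ_apply, opT_smul, ih, ← Function.iterate_succ_apply]

lemma opT_iter_nonneg (hA0 : ∀ i j, 0 ≤ A i j) {g : V → ℝ} (h : ∀ i, 0 ≤ g i) (k : ℕ) (i : V) :
    0 ≤ (opT A)^[k] g i := by
  induction k generalizing i with
  | zero => exact h i
  | succ k ih => rw [Function.iterate_succ_apply']; exact opT_nonneg A hA0 ih i

lemma opT_iter_mono (hA0 : ∀ i j, 0 ≤ A i j) {f g : V → ℝ} (h : ∀ i, f i ≤ g i) (k : ℕ) (i : V) :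
    (opT A)^[k] f i ≤ (opT A)^[k] g i := by
  induction k generalizing i with
  | zero => exact h i
  | succ k ih => simp only [Function.iterate_succ_apply']; exact opT_mono A hA0 ih i

lemma logconvex (hA : ∀ i j, A i j = A j i) (g : V → ℝ) (m : ℕ) :
    (∑ i, (opT A)^[m+1] g i ^ 2) ^ 2 ≤
      (∑ i, (opT A)^[m] g i ^ 2) * ∑ i, (opT A)^[m+2] g i ^ 2 := by
  have h : ∑ i, (opT A)^[m+1] g i ^ 2 = ∑ i, (opT A)^[m] g i * (opT A)^[m+2] g i := by
    rw [show m + 2 = (m+1)+1 from rfl, Function.iterate_succ_apply' _ (m+1), ← opT_symm A hA,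
      ← Function.iterate_succ_apply' (opT A) m]
    exact Finset.sum_congr rfl fun i _ => by ring
  rw [h]
  exact Finset.sum_mul_sq_le_sq_mul_sq _ _ _

lemma norm_pow_bound (hA : ∀ i j, A i j = A j i) (g : V → ℝ) (m : ℕ) :
    (∑ i, opT A g i ^ 2) ^ (m+1) ≤ (∑ i, g i ^ 2) ^ m * ∑ i, (opT A)^[m+1] g i ^ 2 := by
  set u : ℕ → ℝ := fun m => ∑ i, (opT A)^[m] g i ^ 2 with hu
  have hu0 : ∀ m, 0 ≤ u m := fun m => Finset.sum_nonneg fun _ _ => sq_nonneg _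
  have h1 : ∀ m, u 1 * u m ≤ u 0 * u (m+1) := by
    intro m
    induction m with
    | zero => simp [mul_comm]
    | succ m ih =>
      rcases (hu0 (m+1)).eq_or_lt with h | h
      · rw [← h]; simpa using mul_nonneg (hu0 0) (hu0 _)
      · have := logconvex A hA g m
        change u (m+1) ^ 2 ≤ u m * u (m+2) at this
        have h2 : u (m+1) * (u 1 * u (m+1)) ≤ u (m+1) * (u 0 * u (m+2)) := by
          nlinarith [mul_le_mul_of_nonneg_left this (hu0 1),
            mul_le_mul_of_nonneg_right ih (hu0 (m+2))]
        exact le_of_mul_le_mul_left h2 h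
  change u 1 ^ (m+1) ≤ u 0 ^ m * u (m+1)
  induction m with
  | zero => simp
  | succ m ih =>
    calc u 1 ^ (m+1+1) = u 1 ^ (m+1) * u 1 := pow_succ _ _
      _ ≤ (u 0 ^ m * u (m+1)) * u 1 := mul_le_mul_of_nonneg_right ih (hu0 1)
      _ = u 0 ^ m * (u 1 * u (m+1)) := by ring
      _ ≤ u 0 ^ m * (u 0 * u (m+2)) := mul_le_mul_of_nonneg_left (h1 _) (pow_nonneg (hu0 0) _)
      _ = _ := by ring

lemma iter_bound (hA0 : ∀ i j, 0 ≤ A i j) (M : ℝ) (hM : ∀ i j, A i j ≤ M / Fintype.card V)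
    (hn : 0 < Fintype.card V)
    (g : V → ℝ) (hg : ∀ i, 0 ≤ g i) (k : ℕ) :
    ∑ i, (opT A)^[k+1] g i ^ 2 ≤
      M ^ 2 * (∑ i, g i ^ 2) * ((∑ i, (opT A)^[k] (fun _ => 1) i ^ 2) / Fintype.card V) := by
  set n : ℝ := ((Fintype.card V : ℕ) : ℝ) with hnn
  have hnp : (0:ℝ) < n := Nat.cast_pos.2 hn
  set C : ℝ := M / n * ∑ j, g j with hC
  have h1 : ∀ i, opT A g i ≤ C * 1 := by
    intro i
    rw [mul_one, hC, Finset.mul_sum]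
    exact Finset.sum_le_sum fun j _ => mul_le_mul_of_nonneg_right (hM i j) (hg j)
  have h2 : ∀ i, (opT A)^[k+1] g i ≤ C * (opT A)^[k] (fun _ => 1) i := by
    intro i
    have := opT_iter_mono A hA0 (g := fun _ => C * 1) h1 k i
    rwa [opT_iter_smul A C k (fun _ => 1)] at this
  have h3 : (∑ j, g j) ^ 2 ≤ n * ∑ j, g j ^ 2 := by
    have := @sq_sum_le_card_mul_sum_sq V ℝ _ _ _ _ Finset.univ g
    simpa [hnn] using this
  have h4 : C ^ 2 ≤ M ^ 2 * (∑ i, g i ^ 2) / n := by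
    rw [hC, mul_pow, div_pow, div_mul_eq_mul_div, div_le_div_iff₀ (by positivity) hnp]
    nlinarith [mul_le_mul_of_nonneg_left h3 (mul_nonneg (sq_nonneg M) hnp.le)]
  calc ∑ i, (opT A)^[k+1] g i ^ 2 ≤ ∑ i, C ^ 2 * (opT A)^[k] (fun _ => 1) i ^ 2 := by
        refine Finset.sum_le_sum fun i _ => ?_
        rw [← mul_pow]
        exact pow_le_pow_left₀ (opT_iter_nonneg A hA0 hg _ i) (h2 i) 2
    _ = C ^ 2 * ∑ i, (opT A)^[k] (fun _ => 1) i ^ 2 := by rw [Finset.mul_sum]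
    _ ≤ (M ^ 2 * (∑ i, g i ^ 2) / n) * ∑ i, (opT A)^[k] (fun _ => 1) i ^ 2 :=
        mul_le_mul_of_nonneg_right h4 (Finset.sum_nonneg fun _ _ => sq_nonneg _)
    _ = _ := by ring

lemma walk_even (hA : ∀ i j, A i j = A j i) (k : ℕ) :
    ∑ i, (opT A)^[k] (fun _ => 1) i ^ 2 = ∑ i, (opT A)^[k+k] (fun _ => 1) i := by
  have := opT_iter_symm A hA k (fun _ => 1) ((opT A)^[k] (fun _ => 1))
  simp only [one_mul, ← Function.iterate_add_apply] at this
  rw [← this]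
  exact Finset.sum_congr rfl fun i _ => by ring

/-- the operator norm bound from a walk count. -/
lemma op_bound (hA : ∀ i j, A i j = A j i) (hA0 : ∀ i j, 0 ≤ A i j) (M : ℝ)
    (hM : ∀ i j, A i j ≤ M / Fintype.card V)
    (hn : 0 < Fintype.card V) (k : ℕ) (μ : ℝ) (_hμ : 0 ≤ μ)
    (h : M ^ 2 * ((∑ i, (opT A)^[k+k] (fun _ => 1) i) / Fintype.card V) ≤ μ ^ (2 * (k+1)))
    (g : V → ℝ) (hg : ∀ i, 0 ≤ g i) :
    ∑ i, opT A g i ^ 2 ≤ μ ^ 2 * ∑ i, g i ^ 2 := by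
  have h1 := norm_pow_bound A hA g k
  have h2 := iter_bound A hA0 M hM hn g hg k
  rw [walk_even A hA] at h2
  have h0 : 0 ≤ ∑ i, g i ^ 2 := Finset.sum_nonneg fun _ _ => sq_nonneg _
  refine le_of_pow_le_pow_left₀ (n := k+1) (by omega) (by positivity) ?_
  refine h1.trans ?_
  calc _ ≤ (∑ i, g i ^ 2) ^ k * (M ^ 2 * (∑ i, g i ^ 2) *
            ((∑ i, (opT A)^[k+k] (fun _ => 1) i) / Fintype.card V)) := by gcongr
    _ = (∑ i, g i ^ 2) ^ (k+1) * (M ^ 2 *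
            ((∑ i, (opT A)^[k+k] (fun _ => 1) i) / Fintype.card V)) := by ring
    _ ≤ (∑ i, g i ^ 2) ^ (k+1) * μ ^ (2 * (k+1)) := by gcongr
    _ = _ := by rw [mul_pow, ← pow_mul]; ring

end mat

lemma one_sub_exp_le (M s : ℝ) (hM : 2 ≤ M) (hs0 : 0 ≤ s) (hs : s ≤ M) :
    1 - Real.exp (-s) ≤ s - s ^ 2 / M ^ 2 := by
  have hM2 : 0 < M ^ 2 := by positivity
  by_cases h : s ≤ 2
  · have h1 := Real.add_one_le_exp (-(s/2))
    have h2 : Real.exp (-s) = Real.exp (-(s/2)) ^ 2 := by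
      rw [← Real.exp_nat_mul]; congr 1; push_cast; ring
    have h3 : (1 - s/2)^2 ≤ Real.exp (-s) := by
      rw [h2]; exact pow_le_pow_left₀ (by linarith) (by linarith) 2
    have h4 : s ^ 2 / M ^ 2 ≤ s ^ 2 / 4 :=
      div_le_div_of_nonneg_left (sq_nonneg s) (by norm_num) (by nlinarith)
    nlinarith
  · have h4 : s ^ 2 / M ^ 2 ≤ 1 := by
      rw [div_le_one hM2]; exact pow_le_pow_left₀ hs0 hs 2
    have := Real.exp_pos (-s)
    linarith

/-- the contraction step -/
lemma contract {V : Type*} [Fintype V] (hn : 0 < Fintype.card V) (M : ℝ) (hM : 2 ≤ M)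
    (s : V → ℝ) (hs0 : ∀ i, 0 ≤ s i) (hs : ∀ i, s i ≤ M) (η : ℝ) (_hη : 0 < η)
    (hx : η ^ 2 ≤ (∑ i, (1 - Real.exp (-s i)) ^ 2) / Fintype.card V) :
    (1 + η / M ^ 2) * ((∑ i, (1 - Real.exp (-s i)) ^ 2) / Fintype.card V) ≤
      (∑ i, s i ^ 2) / Fintype.card V := by
  set n : ℝ := ((Fintype.card V : ℕ) : ℝ) with hnn
  have hnp : (0:ℝ) < n := Nat.cast_pos.2 hn
  set y : ℝ := (∑ i, s i ^ 2) / n with hy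
  set x : ℝ := (∑ i, (1 - Real.exp (-s i)) ^ 2) / n with hxx
  set κ : ℝ := 1 / M ^ 2 with hκ
  have hM2 : 0 < M ^ 2 := by positivity
  have hκ0 : 0 < κ := by positivity
  have hpt : ∀ i, (1 - Real.exp (-s i)) ^ 2 ≤ s i ^ 2 - κ * s i ^ 3 := by
    intro i
    have h1 := one_sub_exp_le M (s i) hM (hs0 i) (hs i)
    have h0 : 0 ≤ 1 - Real.exp (-s i) := by
      have := Real.exp_le_one_iff.2 (neg_nonpos.2 (hs0 i)); linarith
    have h2 : s i - s i ^ 2 / M ^ 2 = s i * (1 - κ * s i) := by rw [hκ]; ring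
    rw [h2] at h1
    have h3 : κ * s i ≤ 1 := by
      rw [hκ, div_mul_eq_mul_div, one_mul, div_le_one hM2]
      nlinarith [hs i]
    have h4 : 0 ≤ κ * s i := mul_nonneg hκ0.le (hs0 i)
    calc (1 - Real.exp (-s i)) ^ 2 ≤ (s i * (1 - κ * s i)) ^ 2 := pow_le_pow_left₀ h0 h1 2
      _ = s i ^ 2 * (1 - κ * s i) ^ 2 := by ring
      _ ≤ s i ^ 2 * (1 - κ * s i) := by
          apply mul_le_mul_of_nonneg_left _ (sq_nonneg _)
          nlinarith
      _ = _ := by ring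
  -- lower bound on cubes: s^3 ≥ t s^2 ·(3/2) - t^3/2, with t^2 = y
  set t := Real.sqrt y with ht
  have hy0 : 0 ≤ y := by positivity
  have ht2 : t ^ 2 = y := Real.sq_sqrt hy0
  have ht0 : 0 ≤ t := Real.sqrt_nonneg _
  have hcube : ∀ i, 3/2 * t * s i ^ 2 - t ^ 3 / 2 ≤ s i ^ 3 := by
    intro i
    nlinarith [mul_nonneg (add_nonneg (hs0 i) (half_pos (zero_lt_one (α := ℝ))).le)
      (sq_nonneg (s i - t)), mul_nonneg (hs0 i) (sq_nonneg (s i - t)),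
      mul_nonneg ht0 (sq_nonneg (s i - t))]
  have hsum : x ≤ y - κ * (t * y) := by
    have : ∑ i, (1 - Real.exp (-s i)) ^ 2 ≤
        ∑ i, (s i ^ 2 - κ * (3/2 * t * s i ^ 2 - t ^ 3 / 2)) :=
      Finset.sum_le_sum fun i _ => (hpt i).trans (by nlinarith [hcube i])
    have h5 : ∑ i, (s i ^ 2 - κ * (3/2 * t * s i ^ 2 - t ^ 3 / 2))
        = (1 - κ * (3/2*t)) * ∑ i, s i ^ 2 + n * (κ * (t^3/2)) := by
      have : ∀ i, (s i ^ 2 - κ * (3/2 * t * s i ^ 2 - t ^ 3 / 2))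
        = (1 - κ * (3/2*t)) * s i ^ 2 + κ * (t^3/2) := fun i => by ring
      simp only [this, Finset.sum_add_distrib, ← Finset.mul_sum, Finset.sum_const,
        Finset.card_univ, nsmul_eq_mul, ← hnn]
      ring
    have h6 : ∑ i, s i ^ 2 = n * y := by rw [hy]; field_simp
    rw [h5, h6] at this
    rw [hxx, div_le_iff₀ hnp]
    refine this.trans (le_of_eq ?_)
    rw [← ht2]; ring
  have hxy : x ≤ y := by nlinarith [mul_nonneg hκ0.le (mul_nonneg ht0 hy0)]
  have hηt : η ≤ t := by
    apply Real.le_sqrt_of_sq_le; linarith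
  have hx0 : 0 ≤ x := by positivity
  have : η * x ≤ t * y := mul_le_mul hηt hxy hx0 ht0
  have e : η / M ^ 2 = κ * η := by rw [hκ]; ring
  rw [e]
  nlinarith [mul_le_mul_of_nonneg_left this hκ0.le]

end Percolation
namespace Percolation

lemma edgeProd_path (k : ℕ) (f : Fin (k+1) → Fin (k+1) → ℝ) (hf : ∀ i j, f i j = f j i) :
    edgeProd (SimpleGraph.pathGraph (k+1)) f = ∏ i : Fin k, f i.castSucc i.succ := by
  classical
  unfold edgeProd
  have himg : (SimpleGraph.pathGraph (k+1)).edgeFinset =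
      Finset.univ.image (fun i : Fin k => s(i.castSucc, i.succ)) := by
    ext e
    induction e using Sym2.ind with
    | _ a b =>
    rw [SimpleGraph.mem_edgeFinset, SimpleGraph.mem_edgeSet, SimpleGraph.pathGraph_adj]
    simp only [Finset.mem_image, Finset.mem_univ, true_and, Sym2.eq_iff]
    constructor
    · rintro (h | h)
      · refine ⟨⟨a, by omega⟩, Or.inl ⟨by ext; simp, by ext; simp [h]⟩⟩
      · refine ⟨⟨b, by omega⟩, Or.inr ⟨by ext; simp, by ext; simp [h]⟩⟩
    · rintro ⟨i, (⟨rfl, rfl⟩ | ⟨rfl, rfl⟩)⟩ <;> simp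
  have hinj : Function.Injective (fun i : Fin k => s(i.castSucc, i.succ)) := by
    intro i j h
    simp only [Sym2.eq_iff, Fin.ext_iff, Fin.val_castSucc, Fin.val_succ] at h
    ext; omega
  have : ∀ (inst : Fintype (SimpleGraph.pathGraph (k+1)).edgeSet),
      ∏ e ∈ @SimpleGraph.edgeFinset _ (SimpleGraph.pathGraph (k+1)) inst, sym2Val f e
      = ∏ i : Fin k, f i.castSucc i.succ := by
    intro inst
    have e : @SimpleGraph.edgeFinset _ (SimpleGraph.pathGraph (k+1)) inst
      = Finset.univ.image (fun i : Fin k => s(i.castSucc, i.succ)) := by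
      rw [← himg]; ext; simp
    rw [e, Finset.prod_image (fun _ _ _ _ h => hinj h)]
    refine Finset.prod_congr rfl fun i _ => ?_
    simp [sym2Val, hf i.succ i.castSucc]
  exact this _

lemma walk_sum {n : ℕ} (β : Fin n → Fin n → ℝ) (k : ℕ) (i : Fin n) :
    (opT β)^[k] (fun _ => 1) i =
      ∑ v : Fin k → Fin n, ∏ j : Fin k,
        β ((Fin.cons i v : Fin (k+1) → Fin n) j.castSucc)
          ((Fin.cons i v : Fin (k+1) → Fin n) j.succ) := by
  induction k generalizing i with
  | zero => simp
  | succ k ih =>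
    rw [Function.iterate_succ_apply']
    simp only [opT]
    rw [← (Fin.consEquiv (fun _ => Fin n)).sum_comp, Fintype.sum_prod_type]
    refine Finset.sum_congr rfl fun j _ => ?_
    rw [ih, Finset.mul_sum]
    refine Finset.sum_congr rfl fun v _ => ?_
    rw [Fin.prod_univ_succ (n := k)]
    congr 1

lemma homDensityG_path {n : ℕ} (β : Fin n → Fin n → ℝ) (hβ : ∀ i j, β i j = β j i) (k : ℕ) :
    homDensityG β (SimpleGraph.pathGraph (k+1)) =
      (∑ i, (opT (fun i j => β i j / n))^[k] (fun _ => 1) i) / n := by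
  have h1 : ∀ m, (opT (fun i j => β i j / n))^[m] (fun _ => 1) =
      fun i => (opT β)^[m] (fun _ => 1) i / (n:ℝ) ^ m := by
    intro m
    induction m with
    | zero => simp
    | succ m ih =>
      funext i
      rw [Function.iterate_succ_apply', ih, Function.iterate_succ_apply']
      simp only [opT, Finset.sum_div]
      exact Finset.sum_congr rfl fun j _ => by rw [pow_succ]; field_simp
  unfold homDensityG
  rw [h1]
  simp only [← Finset.sum_div]
  rw [div_div, ← pow_succ]
  congr 1
  rw [← (Fin.consEquiv (fun _ => Fin n)).sum_comp, Fintype.sum_prod_type]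
  refine Finset.sum_congr rfl fun i _ => ?_
  rw [walk_sum]
  refine Finset.sum_congr rfl fun v _ => ?_
  rw [edgeProd_path _ _ (fun _ _ => hβ _ _)]
  rfl

abbrev muI : Measure ℝ := volume.restrict I01

instance : IsProbabilityMeasure muI := ⟨by simp [muI, I01]⟩

lemma applyT_meas {W : ℝ → ℝ → ℝ} (hW : IsGraphon W) {f : ℝ → ℝ} (hf : Measurable f) :
    Measurable (applyT W f) := by
  have : StronglyMeasurable (Function.uncurry fun x y => W x y * f y) :=
    (hW.1.mul (hf.comp measurable_snd)).stronglyMeasurable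
  exact (this.integral_prod_right (ν := muI)).measurable

lemma applyT_bdd {W : ℝ → ℝ → ℝ} {M : ℝ} (h0 : ∀ x y, 0 ≤ W x y) (hM : ∀ x y, W x y ≤ M)
    {f : ℝ → ℝ} {C : ℝ} (hf : ∀ x, |f x| ≤ C) (x : ℝ) : |applyT W f x| ≤ M * C := by
  have := norm_integral_le_of_norm_le_const (μ := muI) (f := fun y => W x y * f y) (C := M * C)
    (Eventually.of_forall fun y => by
      rw [Real.norm_eq_abs, abs_mul, abs_of_nonneg (h0 x y)]
      exact mul_le_mul (hM x y) (hf y) (abs_nonneg _) ((h0 x y).trans (hM x y)))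
  rw [probReal_univ, mul_one] at this
  exact this

lemma iter_good {W : ℝ → ℝ → ℝ} (hW : IsGraphon W) (k : ℕ) :
    Measurable ((applyT W)^[k] (fun _ => 1)) ∧ ∃ C, ∀ x, |(applyT W)^[k] (fun _ => 1) x| ≤ C := by
  induction k with
  | zero => exact ⟨measurable_const, 1, by simp⟩
  | succ k ih =>
    obtain ⟨h1, C, h2⟩ := ih
    obtain ⟨M, hM⟩ := hW.2.2.2
    rw [Function.iterate_succ_apply']
    exact ⟨applyT_meas hW h1, M * C, applyT_bdd hW.2.1 hM h2⟩

/-- the path integrand -/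
def pathF (W : ℝ → ℝ → ℝ) (k : ℕ) (v : Fin (k+1) → ℝ) : ℝ := ∏ j : Fin k, W (v j.castSucc) (v j.succ)

lemma pathF_int {W : ℝ → ℝ → ℝ} (hW : IsGraphon W) (k : ℕ) {α : Type*} [MeasurableSpace α]
    (ν : Measure α) [IsFiniteMeasure ν] (φ : α → Fin (k+1) → ℝ) (hφ : Measurable φ) :
    Integrable (fun a => pathF W k (φ a)) ν := by
  obtain ⟨M, hM⟩ := hW.2.2.2
  refine Integrable.of_bound (C := M ^ k) (Measurable.aestronglyMeasurable ?_)
    (Eventually.of_forall fun a => ?_)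
  · refine Finset.measurable_prod _ fun j _ => ?_
    exact hW.1.comp (((measurable_pi_apply _).comp hφ).prodMk ((measurable_pi_apply _).comp hφ))
  · rw [pathF, Real.norm_eq_abs, abs_of_nonneg (Finset.prod_nonneg fun _ _ => hW.2.1 _ _)]
    calc _ ≤ ∏ _j : Fin k, M := Finset.prod_le_prod (fun _ _ => hW.2.1 _ _) (fun _ _ => hM _ _)
      _ = M ^ k := by simp

lemma integral_cons (k : ℕ) (F : (Fin (k+1) → ℝ) → ℝ)
    (hF : Integrable (fun p : ℝ × (Fin k → ℝ) => F (Fin.cons p.1 p.2))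
      (muI.prod (Measure.pi fun _ => muI))) :
    ∫ v, F v ∂(Measure.pi fun _ : Fin (k+1) => muI) =
      ∫ x, ∫ v, F (Fin.cons x v) ∂(Measure.pi fun _ : Fin k => muI) ∂muI := by
  have h := (measurePreserving_piFinSuccAbove (fun _ : Fin (k+1) => muI) 0).symm
  rw [← h.integral_comp' , integral_prod]
  · simp [MeasurableEquiv.piFinSuccAbove, Fin.insertNthEquiv]
  · simpa [MeasurableEquiv.piFinSuccAbove, Fin.insertNthEquiv] using hF

lemma meas_cons (k : ℕ) : Measurable (fun p : ℝ × (Fin k → ℝ) => (Fin.cons p.1 p.2 : Fin (k+1) → ℝ)) := by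
  refine measurable_pi_lambda _ fun j => ?_
  refine Fin.cases ?_ (fun j => ?_) j
  · simpa using measurable_fst
  · simp only [Fin.cons_succ]
    exact (measurable_pi_apply j).comp measurable_snd

lemma walk_int {W : ℝ → ℝ → ℝ} (hW : IsGraphon W) (k : ℕ) (x : ℝ) :
    (applyT W)^[k] (fun _ => 1) x =
      ∫ v, pathF W k (Fin.cons x v) ∂(Measure.pi fun _ : Fin k => muI) := by
  induction k generalizing x with
  | zero => simp [pathF]
  | succ k ih =>
    rw [Function.iterate_succ_apply']
    rw [integral_cons k (fun v => pathF W (k+1) (Fin.cons x v))]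
    · simp only [applyT]
      refine integral_congr_ae (Eventually.of_forall fun y => ?_)
      simp only
      rw [ih, ← integral_const_mul]
      refine integral_congr_ae (Eventually.of_forall fun v => ?_)
      simp only [pathF]
      rw [Fin.prod_univ_succ (n := k)]
      congr 1
    · refine pathF_int hW (k+1) _ (fun p : ℝ × (Fin k → ℝ) => Fin.cons x (Fin.cons p.1 p.2)) ?_
      exact (meas_cons (k+1)).comp (measurable_const.prodMk (meas_cons k))

lemma homDensityW_path {W : ℝ → ℝ → ℝ} (hW : IsGraphon W) (k : ℕ) :
    homDensityW W (SimpleGraph.pathGraph (k+1)) = ∫ x, (applyT W)^[k] (fun _ => 1) x ∂muI := by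
  unfold homDensityW
  have h1 : (volume : Measure (Fin (k+1) → ℝ)).restrict (Set.univ.pi fun _ => I01)
      = Measure.pi fun _ => muI := by
    rw [volume_pi, Measure.restrict_pi_pi]
  rw [h1]
  have h2 : ∀ x : Fin (k+1) → ℝ, edgeProd (SimpleGraph.pathGraph (k+1)) (fun i j => W (x i) (x j))
      = pathF W k x := fun x => edgeProd_path k _ fun _ _ => hW.2.2.1 _ _
  simp only [h2]
  rw [integral_cons k _ (pathF_int hW k _ _ (meas_cons k))]
  simp only [walk_int hW]

lemma sq_int_le {f : ℝ → ℝ} (hf : Measurable f) (h2 : Integrable (fun x => f x ^ 2) muI) :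
    (∫ x, f x ∂muI) ^ 2 ≤ ∫ x, f x ^ 2 ∂muI := by
  have hL : MemLp f 2 muI := (memLp_two_iff_integrable_sq hf.aestronglyMeasurable).2 h2
  have hi : Integrable f muI := hL.integrable (by norm_num)
  have h := integral_nonneg (μ := muI) (f := fun x => (f x - ∫ y, f y ∂muI) ^ 2) fun x => sq_nonneg _
  set m := ∫ y, f y ∂muI with hm
  have e : ∫ x, (f x - m) ^ 2 ∂muI = ∫ x, f x ^ 2 ∂muI - 2 * m * m + m ^ 2 := by
    have : (fun x => (f x - m)^2) = fun x => (f x ^ 2 - 2 * m * f x) + m ^ 2 := by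
      funext x; ring
    have hi' : Integrable (fun x => f x ^ 2 - 2 * m * f x) muI := h2.sub (hi.const_mul _)
    rw [this, integral_add hi' (integrable_const _),
      integral_sub h2 (hi.const_mul _), integral_const_mul, ← hm]
    simp
  rw [e] at h
  nlinarith

lemma opNorm_bddAbove {W : ℝ → ℝ → ℝ} (hW : IsGraphon W) :
    BddAbove {r | ∃ f : ℝ → ℝ, Measurable f ∧
    MeasureTheory.IntegrableOn (fun x => f x ^ 2) I01 ∧
    l2norm f ≤ 1 ∧ r = l2norm (applyT W f)} := by
  obtain ⟨M, hM⟩ := hW.2.2.2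
  refine ⟨M, ?_⟩
  rintro r ⟨f, hf, hi, hn, rfl⟩
  have hM0 : 0 ≤ M := (hW.2.1 0 0).trans (hM 0 0)
  have hn2 : ∫ x, f x ^ 2 ∂muI ≤ 1 := by
    unfold l2norm at hn
    simpa using (Real.sqrt_le_left (by norm_num : (0:ℝ) ≤ 1)).1 hn
  have hL : MemLp f 2 muI := (memLp_two_iff_integrable_sq hf.aestronglyMeasurable).2 hi
  have hfi : Integrable f muI := hL.integrable (by norm_num)
  have hab : ∫ x, |f x| ∂muI ≤ 1 := by
    have := sq_int_le (f := fun x => |f x|) (by fun_prop) (by simp only [sq_abs]; exact hi)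
    simp only [sq_abs] at this
    have h0 : 0 ≤ ∫ x, |f x| ∂muI := integral_nonneg fun x => abs_nonneg _
    nlinarith
  have hpt : ∀ x, |applyT W f x| ≤ M := by
    intro x
    calc |applyT W f x| ≤ ∫ y, |W x y * f y| ∂muI := abs_integral_le_integral_abs
      _ ≤ ∫ y, M * |f y| ∂muI := by
        refine integral_mono_of_nonneg (Eventually.of_forall fun _ => abs_nonneg _)
          (hfi.abs.const_mul M) (Eventually.of_forall fun y => ?_)
        simp only [abs_mul, abs_of_nonneg (hW.2.1 x y)]
        exact mul_le_mul_of_nonneg_right (hM x y) (abs_nonneg _)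
      _ = M * ∫ y, |f y| ∂muI := integral_const_mul _ _
      _ ≤ M := by nlinarith
  unfold l2norm
  rw [Real.sqrt_le_left hM0]
  have : ∫ x, applyT W f x ^ 2 ∂muI ≤ ∫ _x, M ^ 2 ∂muI := by
    refine integral_mono_of_nonneg (Eventually.of_forall fun _ => sq_nonneg _)
      (integrable_const _) (Eventually.of_forall fun y => ?_)
    exact sq_le_sq' (abs_le.1 (hpt y)).1 (abs_le.1 (hpt y)).2
  simpa using this

lemma l2norm_smul (t : ℝ) (ht : 0 ≤ t) (f : ℝ → ℝ) : l2norm (fun x => t * f x) = t * l2norm f := by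
  unfold l2norm
  simp only [mul_pow, integral_const_mul]
  rw [Real.sqrt_mul (sq_nonneg t), Real.sqrt_sq ht]

lemma l2norm_applyT_le {W : ℝ → ℝ → ℝ} (hW : IsGraphon W) {f : ℝ → ℝ} (hf : Measurable f)
    (hi : Integrable (fun x => f x ^ 2) muI) :
    l2norm (applyT W f) ≤ opNorm W * l2norm f := by
  have key : ∀ η > 0, l2norm (applyT W f) ≤ opNorm W * (l2norm f + η) := by
    intro η hη
    have h0 : 0 ≤ l2norm f := Real.sqrt_nonneg _
    have hp : 0 < l2norm f + η := by linarith
    have h1 : l2norm (applyT W (fun x => (l2norm f + η)⁻¹ * f x)) ≤ opNorm W := by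
      refine le_csSup (opNorm_bddAbove hW) ⟨_, hf.const_mul _, ?_, ?_, rfl⟩
      · simp only [mul_pow]; exact hi.const_mul _
      · rw [l2norm_smul _ (by positivity), inv_mul_le_iff₀ hp]; linarith
    have h2 : applyT W (fun x => (l2norm f + η)⁻¹ * f x)
        = fun x => (l2norm f + η)⁻¹ * applyT W f x := by
      funext x
      simp only [applyT, ← integral_const_mul]
      congr 1; funext y; ring
    rw [h2, l2norm_smul _ (by positivity), inv_mul_le_iff₀ hp] at h1
    linarith
  have hlim : Tendsto (fun η : ℝ => opNorm W * (l2norm f + η)) (𝓝[>] 0)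
      (𝓝 (opNorm W * (l2norm f + 0))) := by
    apply Tendsto.mono_left _ nhdsWithin_le_nhds
    exact (continuous_const.mul (continuous_const.add continuous_id)).tendsto 0
  rw [add_zero] at hlim
  exact ge_of_tendsto hlim (eventually_nhdsWithin_of_forall fun η hη => key η hη)

lemma opNorm_nonneg (W : ℝ → ℝ → ℝ) : 0 ≤ opNorm W := by
  apply Real.sSup_nonneg
  rintro r ⟨f, -, -, -, rfl⟩
  exact Real.sqrt_nonneg _

lemma homDensityW_path_le {W : ℝ → ℝ → ℝ} (hW : IsGraphon W) (k : ℕ) :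
    homDensityW W (SimpleGraph.pathGraph (k+1)) ≤ opNorm W ^ k := by
  have hsq : ∀ k, Integrable (fun x => (applyT W)^[k] (fun _ => 1) x ^ 2) muI := by
    intro k
    obtain ⟨h1, C, h2⟩ := iter_good hW k
    refine Integrable.of_bound (C := C ^ 2) (h1.pow_const 2).aestronglyMeasurable
      (Eventually.of_forall fun a => ?_)
    rw [Real.norm_eq_abs, abs_pow]
    exact pow_le_pow_left₀ (abs_nonneg _) (h2 a) 2
  have hn : ∀ k, l2norm ((applyT W)^[k] (fun _ => 1)) ≤ opNorm W ^ k := by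
    intro k
    induction k with
    | zero => simp [l2norm]
    | succ k ih =>
      rw [Function.iterate_succ_apply', pow_succ']
      exact (l2norm_applyT_le hW (iter_good hW k).1 (hsq k)).trans
        (mul_le_mul_of_nonneg_left ih (opNorm_nonneg W))
  rw [homDensityW_path hW]
  exact (Real.le_sqrt_of_sq_le (sq_int_le (iter_good hW k).1 (hsq k))).trans (hn k)

end Percolation
namespace Percolation

section prob
variable {V : Type*} [Fintype V] [DecidableEq V]

lemma bern_prob {q : ℝ} (h0 : 0 ≤ q) (h1 : q ≤ 1) : IsProbabilityMeasure (bern q) := ⟨by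
  simp only [bern, Measure.add_apply, Measure.smul_apply, measure_univ, smul_eq_mul, mul_one]
  rw [← ENNReal.ofReal_add h0 (by linarith)]; simp⟩

lemma bern_false {q : ℝ} (h1 : q ≤ 1) : (bern q).real {false} = 1 - q := by
  simp [bern, Measure.real, h1]

lemma bern_true {q : ℝ} (h0 : 0 ≤ q) : (bern q).real {true} = q := by
  simp [bern, Measure.real, h0]

lemma part_sum {Ω : Type*} [MeasurableSpace Ω] [DiscreteMeasurableSpace Ω]
    (P : Measure Ω) [IsFiniteMeasure P] {ι : Type*} [Fintype ι] (J : Ω → ι) (A : Set Ω) :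
    P.real A = ∑ j, P.real (A ∩ {ω | J ω = j}) := by
  have h : A = ⋃ j ∈ (Finset.univ : Finset ι), (A ∩ {ω | J ω = j}) := by
    ext ω; simp
  conv_lhs => rw [h]
  rw [measureReal_biUnion_finset]
  · intro i _ j _ hij
    refine Set.disjoint_left.2 ?_
    rintro ω ⟨-, h1⟩ ⟨-, h2⟩
    exact hij (h1.symm.trans h2)
  · intro _ _; exact MeasurableSet.of_discrete

lemma markov_count {Ω : Type*} [MeasurableSpace Ω] [DiscreteMeasurableSpace Ω]
    (P : Measure Ω) [IsFiniteMeasure P] {ι : Type*} [Fintype ι] (E : Set Ω) (F : ι → Set Ω)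
    (a : ℝ) (h : ∀ ω ∈ E, a ≤ ({i | ω ∈ F i} : Set ι).ncard) :
    a * P.real E ≤ ∑ i, P.real (F i) := by
  classical
  have h1 : ∀ i, P.real (F i) = ∫ ω, (F i).indicator (fun _ => (1:ℝ)) ω ∂P := fun i => by
    rw [integral_indicator_const _ MeasurableSet.of_discrete]; simp
  have hint : ∀ (S : Set Ω) (c : ℝ), Integrable (S.indicator (fun _ => c)) P := fun S c =>
    (integrable_const c).indicator MeasurableSet.of_discrete
  have h2 : a * P.real E = ∫ ω, E.indicator (fun _ => a) ω ∂P := by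
    rw [integral_indicator_const _ MeasurableSet.of_discrete]; simp [mul_comm]
  rw [h2, Finset.sum_congr rfl fun i _ => h1 i, ← integral_finsetSum _ fun i _ => hint _ _]
  refine integral_mono (hint _ _) (integrable_finsetSum _ fun i _ => hint _ _) fun ω => ?_
  have hc : ∑ i, (F i).indicator (fun _ => (1:ℝ)) ω = ({i | ω ∈ F i} : Set ι).ncard := by
    rw [Set.ncard_eq_toFinset_card']
    simp [Set.indicator_apply]
  simp only [hc]
  by_cases hω : ω ∈ E
  · simpa [hω] using h ω hω
  · simp [hω]

variable (q : Sym2 V → ℝ)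

lemma indep_edges (hq0 : ∀ e, 0 ≤ q e) (hq1 : ∀ e, q e ≤ 1) (v : V) (A B : Set (Sym2 V → Bool))
    (hA : ∀ ω ω' : Sym2 V → Bool, (∀ e, v ∉ e → ω e = ω' e) → ω ∈ A → ω' ∈ A)
    (hB : ∀ ω ω' : Sym2 V → Bool, (∀ e, v ∈ e → ω e = ω' e) → ω ∈ B → ω' ∈ B) :
    (Measure.pi fun e => bern (q e)).real (A ∩ B) =
      (Measure.pi fun e => bern (q e)).real A * (Measure.pi fun e => bern (q e)).real B := by
  classical
  have : ∀ e, IsProbabilityMeasure (bern (q e)) := fun e => bern_prob (hq0 e) (hq1 e)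
  have hi : ProbabilityTheory.iIndepFun (fun (e : Sym2 V) (ω : Sym2 V → Bool) => ω e)
      (Measure.pi fun e => bern (q e)) :=
    ProbabilityTheory.iIndepFun_pi (X := fun _ b => b) (fun _ => aemeasurable_id)
  let S : Finset (Sym2 V) := Finset.univ.filter fun e => v ∉ e
  let T : Finset (Sym2 V) := Finset.univ.filter fun e => v ∈ e
  have hST : Disjoint S T := by
    rw [Finset.disjoint_left]; intro e; simp [S, T]
  have h := hi.indepFun_finset S T hST (fun e => measurable_pi_apply e)
  have hAe : A = (fun ω (i : S) => ω i) ⁻¹' ((fun (ω : Sym2 V → Bool) (i : S) => ω i) '' A) := by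
    refine Set.Subset.antisymm (Set.subset_preimage_image _ _) ?_
    rintro ω ⟨ω', h', he⟩
    refine hA ω' ω (fun e hv => ?_) h'
    exact congrFun he ⟨e, by simp [S, hv]⟩
  have hBe : B = (fun ω (i : T) => ω i) ⁻¹' ((fun (ω : Sym2 V → Bool) (i : T) => ω i) '' B) := by
    refine Set.Subset.antisymm (Set.subset_preimage_image _ _) ?_
    rintro ω ⟨ω', h', he⟩
    refine hB ω' ω (fun e hv => ?_) h'
    exact congrFun he ⟨e, by simp [T, hv]⟩
  have := h.measure_inter_preimage_eq_mul _ _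
    (MeasurableSet.of_discrete (s := (fun (ω : Sym2 V → Bool) (i : S) => ω i) '' A))
    (MeasurableSet.of_discrete (s := (fun (ω : Sym2 V → Bool) (i : T) => ω i) '' B))
  rw [← hAe, ← hBe] at this
  simp only [Measure.real, this, ENNReal.toReal_mul]

lemma prob_closed (hq0 : ∀ e, 0 ≤ q e) (hq1 : ∀ e, q e ≤ 1) (v : V) (J : Finset V) :
    (Measure.pi fun e => bern (q e)).real {ω | ∀ w ∈ J, ω s(v, w) = false} =
      ∏ w ∈ J, (1 - q s(v, w)) := by
  classical
  have : ∀ e, IsProbabilityMeasure (bern (q e)) := fun e => bern_prob (hq0 e) (hq1 e)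
  let S : Finset (Sym2 V) := J.image fun w => s(v, w)
  have h1 : {ω : Sym2 V → Bool | ∀ w ∈ J, ω s(v, w) = false}
      = Set.univ.pi fun e => if e ∈ S then {false} else Set.univ := by
    ext ω
    simp only [Set.mem_ofPred_eq, Set.mem_pi, Set.mem_univ, true_imp_iff]
    constructor
    · intro h e
      split_ifs with he
      · obtain ⟨w, hw, rfl⟩ := Finset.mem_image.1 he
        exact h w hw
      · trivial
    · intro h w hw
      have := h s(v, w)
      rw [if_pos (Finset.mem_image_of_mem _ hw)] at this
      exact this
  rw [h1, measureReal_def, Measure.pi_pi, ENNReal.toReal_prod]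
  have h2 : ∀ e, ((bern (q e)) (if e ∈ S then {false} else Set.univ)).toReal
      = if e ∈ S then 1 - q e else 1 := by
    intro e
    split_ifs
    · exact bern_false (hq1 e)
    · rw [measure_univ]; rfl
  rw [Finset.prod_congr rfl fun e _ => h2 e, Finset.prod_ite_mem, Finset.univ_inter,
    Finset.prod_image]
  intro a _ b _ h
  exact (Sym2.congr_right).1 h

lemma prob_open (hq0 : ∀ e, 0 ≤ q e) (hq1 : ∀ e, q e ≤ 1) (e : Sym2 V) :
    (Measure.pi fun e => bern (q e)).real {ω | ω e = true} = q e := by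
  have : ∀ e, IsProbabilityMeasure (bern (q e)) := fun e => bern_prob (hq0 e) (hq1 e)
  have := (measurePreserving_eval (fun e => bern (q e)) e).measureReal_preimage
    (s := {true}) (MeasurableSet.of_discrete.nullMeasurableSet)
  rw [bern_true (hq0 e)] at this
  exact this

/-- one exploration step -/
lemma step_bound (hq0 : ∀ e, 0 ≤ q e) (hq1 : ∀ e, q e ≤ 1) (v : V) (r : V → ℝ)
    (hr : ∀ w, Real.exp (-r w) ≤ 1 - q s(v, w))
    (J : (Sym2 V → Bool) → Finset V)
    (hJ : ∀ ω ω' : Sym2 V → Bool, (∀ e, v ∉ e → ω e = ω' e) → J ω = J ω') :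
    (Measure.pi fun e => bern (q e)).real {ω | ∃ w ∈ J ω, ω s(v, w) = true} ≤
      1 - Real.exp (-∑ w, r w * (Measure.pi fun e => bern (q e)).real {ω | w ∈ J ω}) := by
  classical
  have : ∀ e, IsProbabilityMeasure (bern (q e)) := fun e => bern_prob (hq0 e) (hq1 e)
  set P := Measure.pi fun e => bern (q e) with hP
  have hc : {ω : Sym2 V → Bool | ∃ w ∈ J ω, ω s(v, w) = true}
      = {ω | ∀ w ∈ J ω, ω s(v, w) = false}ᶜ := by
    ext ω; simp
  rw [hc, probReal_compl_eq_one_sub MeasurableSet.of_discrete]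
  have hN : P.real {ω | ∀ w ∈ J ω, ω s(v, w) = false} =
      ∑ j, P.real {ω | J ω = j} * ∏ w ∈ j, (1 - q s(v, w)) := by
    rw [part_sum P J]
    refine Finset.sum_congr rfl fun j _ => ?_
    rw [← prob_closed q hq0 hq1 v j, ← indep_edges q hq0 hq1 v]
    · congr 1
      ext ω
      simp only [Set.mem_inter_iff, Set.mem_ofPred_eq]
      constructor
      · rintro ⟨h1, h2⟩; subst h2; exact ⟨rfl, h1⟩
      · rintro ⟨h1, h2⟩; subst h1; exact ⟨h2, rfl⟩
    · intro ω ω' h h1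
      exact (hJ ω ω' h).symm.trans h1
    · intro ω ω' h h1 w hw
      rw [← h _ (Sym2.mem_mk_left v w)]
      exact h1 w hw
  set s := ∑ w, r w * P.real {ω | w ∈ J ω} with hs
  have h1 : ∑ j, P.real {ω | J ω = j} = 1 := by
    have := part_sum P J Set.univ
    simp only [Set.univ_inter, probReal_univ] at this
    exact this.symm
  have h2 : ∑ j, P.real {ω | J ω = j} * ∑ w ∈ j, r w = s := by
    have : ∀ w, P.real {ω | w ∈ J ω} = ∑ j, if w ∈ j then P.real {ω | J ω = j} else 0 := by
      intro w
      rw [part_sum P J]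
      refine Finset.sum_congr rfl fun j _ => ?_
      split_ifs with h
      · congr 1; ext ω
        simp only [Set.mem_inter_iff, Set.mem_ofPred_eq, and_iff_right_iff_imp]
        rintro rfl; exact h
      · rw [show ({ω | w ∈ J ω} ∩ {ω | J ω = j} : Set (Sym2 V → Bool)) = ∅ from ?_]
        · simp
        · ext ω
          simp only [Set.mem_inter_iff, Set.mem_ofPred_eq, Set.mem_empty_iff_false, iff_false]
          rintro ⟨h3, rfl⟩; exact h h3
    rw [hs]
    simp only [this, Finset.mul_sum]
    rw [Finset.sum_comm (γ := V)]
    refine Finset.sum_congr rfl fun j _ => ?_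
    rw [← Finset.sum_filter_add_sum_filter_not Finset.univ (fun w => w ∈ j)]
    simp only [Finset.filter_mem_eq_inter, Finset.univ_inter]
    rw [Finset.sum_eq_zero (s := Finset.univ.filter fun w => w ∉ j)]
    · rw [add_zero]
      refine Finset.sum_congr rfl fun w hw => ?_
      rw [if_pos hw]; ring
    · intro w hw
      rw [if_neg (Finset.mem_filter.1 hw).2, mul_zero]
  have h3 : ∀ j : Finset V, Real.exp (-s) * (1 + s - ∑ w ∈ j, r w) ≤ ∏ w ∈ j, (1 - q s(v, w)) := by
    intro j
    calc Real.exp (-s) * (1 + s - ∑ w ∈ j, r w)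
        ≤ Real.exp (-s) * Real.exp (s - ∑ w ∈ j, r w) := by
          apply mul_le_mul_of_nonneg_left _ (Real.exp_pos _).le
          have := Real.add_one_le_exp (s - ∑ w ∈ j, r w)
          linarith
      _ = Real.exp (∑ w ∈ j, (- r w)) := by
          rw [← Real.exp_add, Finset.sum_neg_distrib]; congr 1; ring
      _ = ∏ w ∈ j, Real.exp (- r w) := Real.exp_sum _ _
      _ ≤ _ := Finset.prod_le_prod (fun _ _ => (Real.exp_pos _).le) (fun w _ => hr w)
  have h4 : Real.exp (-s) ≤ P.real {ω | ∀ w ∈ J ω, ω s(v, w) = false} := by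
    rw [hN]
    calc Real.exp (-s) = ∑ j, P.real {ω | J ω = j} * (Real.exp (-s) * (1 + s - ∑ w ∈ j, r w)) := by
          have : ∀ j, P.real {ω | J ω = j} * (Real.exp (-s) * (1 + s - ∑ w ∈ j, r w))
            = Real.exp (-s) * (1 + s) * P.real {ω | J ω = j}
              - Real.exp (-s) * (P.real {ω | J ω = j} * ∑ w ∈ j, r w) := fun j => by ring
          simp only [this, Finset.sum_sub_distrib, ← Finset.mul_sum, h1, h2]
          ring
      _ ≤ _ := Finset.sum_le_sum fun j _ => mul_le_mul_of_nonneg_left (h3 j) measureReal_nonneg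
  linarith

def Rv (ω : Sym2 V → Bool) : ℕ → Finset V → V → Prop
  | 0, _, _ => True
  | K+1, U, v => ∃ w, w ∉ insert v U ∧ ω s(v, w) = true ∧ Rv ω K (insert v U) w

def Nv (ω : Sym2 V → Bool) (z : V) : ℕ → Finset V → V → Prop
  | 0, _, v => v = z
  | K+1, U, v => v = z ∨ ∃ w, w ∉ insert v U ∧ ω s(v, w) = true ∧ Nv ω z K (insert v U) w

lemma Rv_local (K : ℕ) (U : Finset V) (v : V) (hv : v ∉ U) (ω ω' : Sym2 V → Bool)
    (h : ∀ e, (∀ u ∈ U, u ∉ e) → ω e = ω' e) (hR : Rv ω K U v) : Rv ω' K U v := by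
  induction K generalizing U v with
  | zero => trivial
  | succ K ih =>
    obtain ⟨w, hw, h1, h2⟩ := hR
    refine ⟨w, hw, ?_, ih _ w hw (fun e he => h e fun u hu => he u (Finset.mem_insert_of_mem hu)) h2⟩
    rw [← h, h1]
    intro u hu hm
    rcases Sym2.mem_iff.1 hm with rfl | rfl
    · exact hv hu
    · exact hw (Finset.mem_insert_of_mem hu)

lemma Nv_local (z : V) (K : ℕ) (U : Finset V) (v : V) (hv : v ∉ U) (ω ω' : Sym2 V → Bool)
    (h : ∀ e, (∀ u ∈ U, u ∉ e) → ω e = ω' e) (hR : Nv ω z K U v) : Nv ω' z K U v := by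
  induction K generalizing U v with
  | zero => exact hR
  | succ K ih =>
    rcases hR with hR | ⟨w, hw, h1, h2⟩
    · exact Or.inl hR
    refine Or.inr ⟨w, hw, ?_,
      ih _ w hw (fun e he => h e fun u hu => he u (Finset.mem_insert_of_mem hu)) h2⟩
    rw [← h, h1]
    intro u hu hm
    rcases Sym2.mem_iff.1 hm with rfl | rfl
    · exact hv hu
    · exact hw (Finset.mem_insert_of_mem hu)

def bseq (r : V → V → ℝ) : ℕ → V → ℝ
  | 0 => fun _ => 1
  | K+1 => fun v => 1 - Real.exp (-opT r (bseq r K) v)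

lemma Rv_prob (hq0 : ∀ e, 0 ≤ q e) (hq1 : ∀ e, q e ≤ 1) (r : V → V → ℝ) (hr0 : ∀ v w, 0 ≤ r v w)
    (hr : ∀ v w, Real.exp (-r v w) ≤ 1 - q s(v, w)) (K : ℕ) (U : Finset V) (v : V) :
    (Measure.pi fun e => bern (q e)).real {ω | Rv ω K U v} ≤ bseq r K v := by
  classical
  have : ∀ e, IsProbabilityMeasure (bern (q e)) := fun e => bern_prob (hq0 e) (hq1 e)
  induction K generalizing U v with
  | zero => simp [Rv, bseq]
  | succ K ih =>
    have := step_bound q hq0 hq1 v (r v) (hr v)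
      (fun ω => Finset.univ.filter fun w => w ∉ insert v U ∧ Rv ω K (insert v U) w) (by
        have key : ∀ ω ω' : Sym2 V → Bool, (∀ e, v ∉ e → ω e = ω' e) → ∀ w, w ∉ insert v U →
            Rv ω K (insert v U) w → Rv ω' K (insert v U) w := fun ω ω' h w hw =>
          Rv_local K _ w hw ω ω' fun e he => h e (he v (Finset.mem_insert_self _ _))
        intro ω ω' h
        ext w
        simp only [Finset.mem_filter, Finset.mem_univ, true_and]
        constructor
        · rintro ⟨h1, h2⟩; exact ⟨h1, key ω ω' h w h1 h2⟩
        · rintro ⟨h1, h2⟩; exact ⟨h1, key ω' ω (fun e he => (h e he).symm) w h1 h2⟩)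
    refine (le_of_eq ?_).trans (this.trans ?_)
    · congr 1; ext ω
      simp only [Rv, Set.mem_ofPred_eq, Finset.mem_filter, Finset.mem_univ, true_and]
      constructor
      · rintro ⟨w, h1, h2, h3⟩; exact ⟨w, ⟨h1, h3⟩, h2⟩
      · rintro ⟨w, ⟨h1, h3⟩, h2⟩; exact ⟨w, h1, h2, h3⟩
    · simp only [bseq]
      apply sub_le_sub_left
      apply Real.exp_le_exp.2
      apply neg_le_neg
      refine Finset.sum_le_sum fun w _ => mul_le_mul_of_nonneg_left ?_ (hr0 v w)
      refine le_trans (measureReal_mono ?_) (ih (insert v U) w)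
      intro ω hω
      simp only [Set.mem_ofPred_eq, Finset.mem_filter] at hω
      exact hω.2.2

lemma Nv_prob (hq0 : ∀ e, 0 ≤ q e) (hq1 : ∀ e, q e ≤ 1) (D : ℝ) (hD : ∀ v, ∑ w, q s(v, w) ≤ D)
    (hD0 : 0 ≤ D) (K : ℕ) (U : Finset V) (v : V) :
    ∑ z, (Measure.pi fun e => bern (q e)).real {ω | Nv ω z K U v} ≤ ∑ k ∈ Finset.range (K+1), D ^ k := by
  classical
  have : ∀ e, IsProbabilityMeasure (bern (q e)) := fun e => bern_prob (hq0 e) (hq1 e)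
  set P := Measure.pi fun e => bern (q e) with hP
  have hconst : ∀ (p : Prop) [Decidable p], P.real {_ω | p} = if p then 1 else 0 := by
    intro p _; by_cases h : p <;> simp [h]
  induction K generalizing U v with
  | zero => simp [Nv, hconst]
  | succ K ih =>
    have h1 : ∀ z, P.real {ω | Nv ω z (K+1) U v} ≤ (if v = z then 1 else 0) +
        ∑ w, q s(v, w) * P.real {ω | Nv ω z K (insert v U) w} := by
      intro z
      have hsub : {ω | Nv ω z (K+1) U v} ⊆ {_ω | v = z} ∪ ⋃ w ∈ (Finset.univ : Finset V),
          ({ω | w ∉ insert v U ∧ Nv ω z K (insert v U) w} ∩ {ω | ω s(v, w) = true}) := by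
        rintro ω (h | ⟨w, h1, h2, h3⟩)
        · exact Or.inl h
        · refine Or.inr ?_
          simp only [Set.mem_iUnion]
          exact ⟨w, Finset.mem_univ _, ⟨h1, h3⟩, h2⟩
      refine (measureReal_mono hsub).trans ((measureReal_union_le _ _).trans ?_)
      rw [hconst]
      refine add_le_add le_rfl ((measureReal_biUnion_finset_le _ _).trans ?_)
      refine Finset.sum_le_sum fun w _ => ?_
      rw [indep_edges q hq0 hq1 v, prob_open q hq0 hq1, mul_comm]
      · refine mul_le_mul_of_nonneg_left (measureReal_mono fun ω hω => hω.2) (hq0 _)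
      · rintro ω ω' h ⟨h2, h3⟩
        exact ⟨h2, Nv_local z K _ w h2 ω ω'
          (fun e he => h e (he v (Finset.mem_insert_self _ _))) h3⟩
      · intro ω ω' h h2
        exact (h _ (Sym2.mem_mk_left v w)).symm.trans h2
    calc _ ≤ ∑ z, ((if v = z then 1 else 0) +
          ∑ w, q s(v, w) * P.real {ω | Nv ω z K (insert v U) w}) := Finset.sum_le_sum fun z _ => h1 z
      _ = 1 + ∑ w, q s(v, w) * ∑ z, P.real {ω | Nv ω z K (insert v U) w} := by
          rw [Finset.sum_add_distrib, Finset.sum_comm]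
          simp [Finset.mul_sum]
      _ ≤ 1 + ∑ w, q s(v, w) * ∑ k ∈ Finset.range (K+1), D ^ k := by
          gcongr with w _
          · exact hq0 _
          · exact ih _ _
      _ = 1 + (∑ w, q s(v, w)) * ∑ k ∈ Finset.range (K+1), D ^ k := by rw [Finset.sum_mul]
      _ ≤ 1 + D * ∑ k ∈ Finset.range (K+1), D ^ k := by
          have : 0 ≤ ∑ k ∈ Finset.range (K+1), D ^ k := Finset.sum_nonneg fun _ _ => by positivity
          gcongr
          exact hD v
      _ = _ := by rw [Finset.sum_range_succ' _ (K+1), Finset.mul_sum, add_comm]; simp [pow_succ']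

lemma graphOf_adj (ω : Sym2 V → Bool) (a b : V) (h : (graphOf ω).Adj a b) :
    a ≠ b ∧ ω s(a, b) = true := by
  rw [graphOf, SimpleGraph.fromRel_adj] at h
  refine ⟨h.1, ?_⟩
  rcases h.2 with h | h
  · exact h
  · rw [Sym2.eq_swap]; exact h

lemma path_cases (ω : Sym2 V → Bool) {v z : V} (p : (graphOf ω).Walk v z) (hp : p.IsPath)
    (K : ℕ) (U : Finset V) (hU : ∀ u ∈ U, u ∉ p.support) : Rv ω K U v ∨ Nv ω z K U v := by
  induction p generalizing K U with
  | nil =>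
    right
    cases K with
    | zero => rfl
    | succ K => exact Or.inl rfl
  | @cons a b d hadj p ih =>
    cases K with
    | zero => exact Or.inl trivial
    | succ K =>
      rw [SimpleGraph.Walk.cons_isPath_iff] at hp
      obtain ⟨h1, h2⟩ := graphOf_adj ω a b hadj
      have hU' : ∀ u ∈ insert a U, u ∉ p.support := by
        intro u hu
        rcases Finset.mem_insert.1 hu with rfl | hu
        · exact hp.2
        · intro h; exact hU u hu (by simp [h])
      have hb : b ∉ insert a U := fun h => hU' b h p.start_mem_support
      rcases ih hp.1 K (insert a U) hU' with h | h
      · exact Or.inl ⟨b, hb, h2, h⟩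
      · exact Or.inr (Or.inr ⟨b, hb, h2, h⟩)

lemma reach_cases (ω : Sym2 V → Bool) {v z : V} (h : (graphOf ω).Reachable v z) (K : ℕ) :
    Rv ω K ∅ v ∨ Nv ω z K ∅ v := by
  classical
  obtain ⟨p⟩ := h
  exact path_cases ω p.toPath.1 p.toPath.2 K ∅ (by simp)

/-- the finite bound on the probability of a large component -/
lemma C1_prob (hq0 : ∀ e, 0 ≤ q e) (hq1 : ∀ e, q e ≤ 1) (r : V → V → ℝ) (hr0 : ∀ v w, 0 ≤ r v w)
    (hr : ∀ v w, Real.exp (-r v w) ≤ 1 - q s(v, w)) (D : ℝ) (hD : ∀ v, ∑ w, q s(v, w) ≤ D)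
    (hD0 : 0 ≤ D) (K : ℕ) (a : ℝ) (ha : 0 < a) :
    (Measure.pi fun e => bern (q e)).real {ω | a ≤ (C1 (graphOf ω) : ℝ)} ≤
      (∑ v, bseq r K v) / a +
        Fintype.card V * (∑ k ∈ Finset.range (K+1), D ^ k) / a ^ 2 := by
  classical
  have : ∀ e, IsProbabilityMeasure (bern (q e)) := fun e => bern_prob (hq0 e) (hq1 e)
  set P := Measure.pi fun e => bern (q e) with hP
  have h1 : a * P.real {ω | a ≤ (C1 (graphOf ω) : ℝ)} ≤
      ∑ v, P.real {ω | a ≤ (compSize (graphOf ω) v : ℝ)} := by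
    refine markov_count P _ _ a ?_
    intro ω hω
    have hω' : a ≤ (C1 (graphOf ω) : ℝ) := hω
    have hne : (Finset.univ : Finset V).Nonempty := by
      by_contra hne
      rw [Finset.not_nonempty_iff_eq_empty] at hne
      have : C1 (graphOf ω) = 0 := by unfold C1; rw [hne]; simp
      rw [this] at hω'
      simp at hω'; linarith
    obtain ⟨v, -, hv⟩ := Finset.exists_mem_eq_sup Finset.univ hne (fun v => compSize (graphOf ω) v)
    have hv' : C1 (graphOf ω) = compSize (graphOf ω) v := hv
    rw [hv'] at hω'
    refine hω'.trans ?_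
    norm_cast
    refine Set.ncard_le_ncard ?_ (Set.toFinite _)
    intro w hw
    have hvw : (graphOf ω).Reachable v w := hw
    have : compSize (graphOf ω) w = compSize (graphOf ω) v := by
      unfold compSize
      congr 1; ext x
      exact ⟨fun h => hvw.trans h, fun h => hvw.symm.trans h⟩
    simp only [Set.mem_ofPred_eq, this]
    exact hω'
  set d := ∑ k ∈ Finset.range (K+1), D ^ k with hd
  have h2 : ∀ v, P.real {ω | a ≤ (compSize (graphOf ω) v : ℝ)} ≤ bseq r K v + d / a := by
    intro v
    have hsub : {ω | a ≤ (compSize (graphOf ω) v : ℝ)} ⊆ {ω | Rv ω K ∅ v} ∪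
        {ω | a ≤ (({z | Nv ω z K ∅ v} : Set V).ncard : ℝ)} := by
      intro ω hω
      by_cases hR : Rv ω K ∅ v
      · exact Or.inl hR
      · refine Or.inr (le_trans (show a ≤ (compSize (graphOf ω) v : ℝ) from hω) ?_)
        norm_cast
        refine Set.ncard_le_ncard ?_ (Set.toFinite _)
        intro w hw
        exact (reach_cases ω hw K).resolve_left hR
    refine (measureReal_mono hsub).trans ((measureReal_union_le _ _).trans ?_)
    refine add_le_add (Rv_prob q hq0 hq1 r hr0 hr K ∅ v) ?_
    rw [le_div_iff₀ ha, mul_comm]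
    refine (markov_count P _ (fun z => {ω | Nv ω z K ∅ v}) a ?_).trans
      (Nv_prob q hq0 hq1 D hD hD0 K ∅ v)
    intro ω hω
    exact hω
  have h3 : a * P.real {ω | a ≤ (C1 (graphOf ω) : ℝ)} ≤ ∑ v, bseq r K v + Fintype.card V * (d / a) := by
    refine h1.trans ((Finset.sum_le_sum fun v _ => h2 v).trans (le_of_eq ?_))
    rw [Finset.sum_add_distrib]; simp
  rw [mul_comm, ← le_div_iff₀ ha] at h3
  refine h3.trans (le_of_eq ?_)
  field_simp

end prob
end Percolation
namespace Percolation

section fin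
variable {V : Type*} [Fintype V] [DecidableEq V]

lemma bseq_mem (r : V → V → ℝ) (hr0 : ∀ v w, 0 ≤ r v w) (K : ℕ) (v : V) :
    0 ≤ bseq r K v ∧ bseq r K v ≤ 1 := by
  induction K generalizing v with
  | zero => simp [bseq]
  | succ K ih =>
    simp only [bseq]
    have h := opT_nonneg r hr0 (fun i => (ih i).1) v
    have h1 := Real.exp_le_one_iff.2 (neg_nonpos.2 h)
    have h2 := Real.exp_pos (-opT r (bseq r K) v)
    constructor <;> linarith

lemma bseq_bound (hn : 0 < Fintype.card V) (r : V → V → ℝ) (hr0 : ∀ v w, 0 ≤ r v w)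
    (M : ℝ) (hM : 2 ≤ M) (hrM : ∀ v, ∑ w, r v w ≤ M) (η : ℝ) (hη : 0 < η) (L ρ : ℝ)
    (hL : ∀ g : V → ℝ, (∀ i, 0 ≤ g i) → ∑ i, opT r g i ^ 2 ≤ L * ∑ i, g i ^ 2)
    (hρ : L ≤ ρ * (1 + η / M ^ 2)) (hρ0 : 0 ≤ ρ) (hρ1 : ρ ≤ 1) (K : ℕ) :
    (∑ v, bseq r K v ^ 2) / Fintype.card V ≤ max (η ^ 2) (ρ ^ K) := by
  have hnp : (0:ℝ) < Fintype.card V := Nat.cast_pos.2 hn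
  induction K with
  | zero => simp [bseq, hnp.ne']
  | succ K ih =>
    by_cases hx : (∑ v, bseq r (K+1) v ^ 2) / Fintype.card V ≤ η ^ 2
    · exact hx.trans (le_max_left _ _)
    push Not at hx
    have hb := bseq_mem r hr0 K
    have h1 := contract hn M hM (opT r (bseq r K)) (opT_nonneg r hr0 fun i => (hb i).1) (by
      intro v
      refine le_trans (Finset.sum_le_sum fun w _ => ?_) (hrM v)
      exact mul_le_of_le_one_right (hr0 v w) (hb w).2) η hη hx.le
    have h2 := hL (bseq r K) fun i => (hb i).1
    have hpos : 0 < 1 + η / M ^ 2 := by positivity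
    set x := (∑ v, bseq r K v ^ 2) / Fintype.card V with hxx
    have hx0 : 0 ≤ x := by positivity
    have h3 : (1 + η / M ^ 2) * ((∑ v, bseq r (K+1) v ^ 2) / Fintype.card V)
        ≤ (1 + η / M ^ 2) * (ρ * x) := by
      refine h1.trans ?_
      calc _ ≤ (L * ∑ i, bseq r K i ^ 2) / Fintype.card V := by gcongr
        _ = L * x := by rw [hxx]; ring
        _ ≤ ρ * (1 + η / M ^ 2) * x := by gcongr
        _ = _ := by ring
    have h4 := le_of_mul_le_mul_left h3 hpos
    refine h4.trans ?_
    rcases le_max_iff.1 ih with h | h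
    · refine le_max_of_le_left ?_
      nlinarith
    · refine le_max_of_le_right ?_
      rw [pow_succ']
      exact mul_le_mul_of_nonneg_left h hρ0

lemma bseq_avg (hn : 0 < Fintype.card V) (b : V → ℝ) (η : ℝ) (hη : 0 < η)
    (h : (∑ v, b v ^ 2) / Fintype.card V ≤ η ^ 2) : ∑ v, b v ≤ η * Fintype.card V := by
  have hnp : (0:ℝ) < Fintype.card V := Nat.cast_pos.2 hn
  have h3 : (∑ j, b j) ^ 2 ≤ Fintype.card V * ∑ j, b j ^ 2 := by
    have := @sq_sum_le_card_mul_sum_sq V ℝ _ _ _ _ Finset.univ b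
    simpa using this
  rw [div_le_iff₀ hnp] at h
  refine abs_le_of_sq_le_sq' (a := ∑ v, b v) ?_ (by positivity) |>.2
  nlinarith

end fin

lemma exp_le_aux (δ y : ℝ) (hδ : 0 < δ) (hy0 : 0 ≤ y) (hy : y * (1 + δ) ≤ δ) :
    Real.exp (-((1 + δ) * y)) ≤ 1 - y := by
  have hpos : 0 < 1 + (1 + δ) * y := by positivity
  have h1 := Real.add_one_le_exp ((1 + δ) * y)
  rw [Real.exp_neg]
  calc (Real.exp ((1 + δ) * y))⁻¹ ≤ (1 + (1 + δ) * y)⁻¹ := inv_anti₀ hpos (by linarith)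
    _ ≤ 1 - y := by
      rw [inv_le_iff_one_le_mul₀ hpos]
      nlinarith [mul_le_mul_of_nonneg_left hy hy0]

/-- eventual operator norm bound -/
lemma eventually_op (β : ∀ n : ℕ, Fin n → Fin n → ℝ) (βmax : ℝ)
    (hsym : ∀ n i j, β n i j = β n j i)
    (hnonneg : ∀ n i j, 0 ≤ β n i j)
    (hbound : ∀ n i j, β n i j ≤ βmax)
    (W : ℝ → ℝ → ℝ) (hW : IsGraphon W) (hconv : ConvergesTo β W)
    (μ : ℝ) (hμ : opNorm W < μ) :
    ∀ᶠ n : ℕ in atTop, ∀ g : Fin n → ℝ, (∀ i, 0 ≤ g i) →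
      ∑ i, opT (fun i j => β n i j / n) g i ^ 2 ≤ μ ^ 2 * ∑ i, g i ^ 2 := by
  have hl0 := opNorm_nonneg W
  have hμ0 : 0 < μ := hl0.trans_lt hμ
  have hlim : Tendsto (fun k : ℕ => βmax ^ 2 * ((opNorm W / μ) ^ 2) ^ k) atTop (𝓝 (βmax ^ 2 * 0)) := by
    refine (tendsto_pow_atTop_nhds_zero_of_lt_one (by positivity) ?_).const_mul _
    have : opNorm W / μ < 1 := (div_lt_one hμ0).2 hμ
    have h0 : 0 ≤ opNorm W / μ := by positivity
    nlinarith
  rw [mul_zero] at hlim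
  obtain ⟨k, hk⟩ := (hlim.eventually (gt_mem_nhds (show 0 < μ ^ 2 by positivity))).exists
  have hk' : βmax ^ 2 * opNorm W ^ (k+k) < μ ^ (2 * (k+1)) := by
    have hp : 0 < μ ^ (2 * k) := by positivity
    have := mul_lt_mul_of_pos_right hk hp
    rw [← pow_mul, div_pow] at this
    calc βmax ^ 2 * opNorm W ^ (k+k) = βmax ^ 2 * (opNorm W ^ (2 * k) / μ ^ (2 * k)) * μ ^ (2 * k) := by
          rw [← two_mul]; field_simp
      _ < _ := this
      _ = _ := by ring
  have ht := (hconv (k+k+1) (SimpleGraph.pathGraph (k+k+1))).const_mul (βmax ^ 2)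
  have hlt : βmax ^ 2 * homDensityW W (SimpleGraph.pathGraph (k+k+1)) < μ ^ (2 * (k+1)) :=
    lt_of_le_of_lt (mul_le_mul_of_nonneg_left (homDensityW_path_le hW (k+k)) (sq_nonneg _)) hk'
  filter_upwards [ht.eventually (gt_mem_nhds hlt), eventually_ge_atTop 1] with n hn hn1 g hg
  have hnp : (0:ℝ) < n := by exact_mod_cast hn1
  rw [homDensityG_path _ (hsym n)] at hn
  refine op_bound _ (fun i j => by rw [hsym n i j]) (fun i j => div_nonneg (hnonneg n i j) hnp.le)
    βmax (fun i j => ?_) (by rw [Fintype.card_fin]; omega) k μ hμ0.le (by simpa using hn.le) g hg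
  simp only [Fintype.card_fin]
  exact div_le_div_of_nonneg_right (hbound n i j) hnp.le

lemma main_real (β : ∀ n : ℕ, Fin n → Fin n → ℝ) (βmax : ℝ)
    (hsym : ∀ n i j, β n i j = β n j i)
    (hnonneg : ∀ n i j, 0 ≤ β n i j)
    (hbound : ∀ n i j, β n i j ≤ βmax)
    (W : ℝ → ℝ → ℝ) (hW : IsGraphon W) (hconv : ConvergesTo β W)
    (c : ℝ) (hc : 0 < c) (hsub : c * opNorm W ≤ 1) (ε : ℝ) (hε : 0 < ε) (θ : ℝ) (hθ : 0 < θ) :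
    ∀ᶠ n : ℕ in atTop,
      (percMeasure (β n) (c / n)).real {ω | ε * n ≤ (C1 (graphOf ω) : ℝ)} ≤ θ := by
  have hβ0 : 0 ≤ βmax := (hnonneg 1 0 0).trans (hbound 1 0 0)
  set η := ε * θ / 2 with hη
  have hη0 : 0 < η := by positivity
  set M := max 2 (2 * (c * βmax)) with hMdef
  have hM : 2 ≤ M := le_max_left _ _
  have hg : 1 < 1 + η / M ^ 2 := by
    have : 0 < η / M ^ 2 := by positivity
    linarith
  -- choose δ
  obtain ⟨δ, ⟨hδlt, hδ1⟩, hδ0⟩ : ∃ δ : ℝ, ((1 + δ) ^ 4 < 1 + η / M ^ 2 ∧ δ < 1) ∧ 0 < δ := by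
    have hcont : Tendsto (fun δ : ℝ => (1 + δ) ^ 4) (𝓝[>] 0) (𝓝 ((1 + 0) ^ 4)) :=
      Tendsto.mono_left ((by fun_prop : Continuous fun δ : ℝ => (1 + δ) ^ 4).tendsto 0)
        nhdsWithin_le_nhds
    have h1 := hcont.eventually (gt_mem_nhds (show ((1:ℝ) + 0) ^ 4 < 1 + η / M ^ 2 by simpa using hg))
    have h2 : ∀ᶠ δ : ℝ in 𝓝[>] 0, δ < 1 :=
      nhdsWithin_le_nhds (gt_mem_nhds (show (0:ℝ) < 1 by norm_num))
    exact ((h1.and h2).and (eventually_mem_nhdsWithin (a := (0:ℝ)) (s := Set.Ioi 0))).exists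
  set ρ := (1 + δ) ^ 4 / (1 + η / M ^ 2) with hρ
  have hρ0 : 0 ≤ ρ := by positivity
  have hρ1 : ρ < 1 := (div_lt_one (by linarith)).2 hδlt
  obtain ⟨K, hK⟩ := exists_pow_lt_of_lt_one (show 0 < η ^ 2 by positivity) hρ1
  set D := c * βmax with hD
  have hD0 : 0 ≤ D := by positivity
  set d := ∑ k ∈ Finset.range (K+1), D ^ k with hd
  have hμ : opNorm W < (1 + δ) / c := by
    rw [lt_div_iff₀ hc]; linarith
  have hop := eventually_op β βmax hsym hnonneg hbound W hW hconv _ hμ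
  have hn0 : Tendsto (fun n : ℕ => D * (1 + δ) / (n:ℝ)) atTop (𝓝 0) :=
    tendsto_const_div_atTop_nhds_zero_nat _
  have hn2 : Tendsto (fun n : ℕ => d / ε ^ 2 / (n:ℝ)) atTop (𝓝 0) :=
    tendsto_const_div_atTop_nhds_zero_nat _
  filter_upwards [hop, hn0.eventually (gt_mem_nhds hδ0),
    hn2.eventually (gt_mem_nhds (show 0 < θ / 2 by positivity)), eventually_ge_atTop 1]
    with n hop hn0 hn2 hn1
  have hnp : (0:ℝ) < n := by exact_mod_cast hn1
  have hval : ∀ v w, sym2Val (β n) s(v, w) = β n v w := by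
    intro v w
    simp [sym2Val, hsym n w v]
  set q : Sym2 (Fin n) → ℝ := fun e => min (c / n * sym2Val (β n) e) 1 with hq
  have hq0 : ∀ e, 0 ≤ q e := by
    intro e
    induction e using Sym2.ind with
    | _ v w =>
      simp only [hq, hval]
      exact le_min (mul_nonneg (by positivity) (hnonneg n v w)) zero_le_one
  have hq1 : ∀ e, q e ≤ 1 := fun e => min_le_right _ _
  have hqle : ∀ v w, q s(v, w) ≤ c / n * β n v w := by
    intro v w
    rw [← hval]; exact min_le_left _ _
  have hyD : ∀ v w, c / n * β n v w ≤ D / n := by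
    intro v w
    rw [hD, div_mul_eq_mul_div]
    exact div_le_div_of_nonneg_right (mul_le_mul_of_nonneg_left (hbound n v w) hc.le) hnp.le
  have hy0 : ∀ v w, 0 ≤ c / n * β n v w := fun v w => mul_nonneg (by positivity) (hnonneg n v w)
  set r : Fin n → Fin n → ℝ := fun v w => (1 + δ) * (c / n * β n v w) with hr
  have hr0 : ∀ v w, 0 ≤ r v w := fun v w => mul_nonneg (by linarith) (hy0 v w)
  have hsumD : ∀ v, ∑ w, c / n * β n v w ≤ D := by
    intro v
    calc _ ≤ ∑ _w : Fin n, D / n := Finset.sum_le_sum fun w _ => hyD v w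
      _ = D := by simp; field_simp
  have hcard : 0 < Fintype.card (Fin n) := by rw [Fintype.card_fin]; omega
  have hb := bseq_bound hcard r hr0 M hM (by
      intro v
      simp only [hr, ← Finset.mul_sum (a := 1 + δ)]
      calc (1 + δ) * ∑ w, c / n * β n v w ≤ 2 * D := by
            apply mul_le_mul (by linarith) (hsumD v) (Finset.sum_nonneg fun w _ => hy0 v w)
              (by norm_num)
        _ ≤ M := le_max_right _ _) η hη0 ((1 + δ) ^ 4) ρ (by
      intro g hg
      have e : opT r g = fun i => ((1 + δ) * c) * opT (fun i j => β n i j / n) g i := by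
        funext i
        simp only [opT, hr, Finset.mul_sum]
        exact Finset.sum_congr rfl fun j _ => by ring
      have h := hop g hg
      rw [e]
      simp only [mul_pow _ _ 2, ← Finset.mul_sum]
      calc _ ≤ (1 + δ) ^ 2 * c ^ 2 * (((1 + δ) / c) ^ 2 * ∑ i, g i ^ 2) := by gcongr
        _ = _ := by field_simp) (by rw [hρ]; field_simp; rfl) hρ0 hρ1.le K
  have hb2 := bseq_avg hcard _ η hη0 (hb.trans (max_le le_rfl hK.le))
  have hfin := C1_prob q hq0 hq1 r hr0 (fun v w =>
      (exp_le_aux δ (c / n * β n v w) hδ0 (hy0 v w) (by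
        have := mul_le_mul_of_nonneg_right (hyD v w) (show 0 ≤ 1 + δ by linarith)
        have e : D / n * (1 + δ) = D * (1 + δ) / n := by ring
        linarith)).trans (by linarith [hqle v w]))
    D (fun v => (Finset.sum_le_sum fun w _ => hqle v w).trans (hsumD v)) hD0 K (ε * n) (by positivity)
  refine hfin.trans ?_
  simp only [Fintype.card_fin] at hb2 ⊢
  have e1 : (∑ v, bseq r K v) / (ε * n) ≤ θ / 2 := by
    rw [div_le_iff₀ (by positivity)]
    refine hb2.trans (le_of_eq ?_)
    rw [hη]; ring
  have e2 : n * d / (ε * n) ^ 2 = d / ε ^ 2 / (n:ℝ) := by field_simp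
  rw [e2]
  linarith

end Percolation

open Percolation MeasureTheory Filter Topology in
/-- If `(G_n)` is a sequence of weighted graphs with `|G_n| = n` and
uniformly bounded weights converging to a graphon `W`, and `c > 0` satisfies
`c ‖T_W‖ ≤ 1`, then the largest component of `G_n(c/n)` has `o_p(n)` vertices. -/
theorem subcritical_largest_component_op_n
    (β : ∀ n : ℕ, Fin n → Fin n → ℝ) (βmax : ℝ)
    (hsym : ∀ n i j, β n i j = β n j i)
    (hnonneg : ∀ n i j, 0 ≤ β n i j)
    (hdiag : ∀ n i, β n i i = 0)
    (hbound : ∀ n i j, β n i j ≤ βmax)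
    (W : ℝ → ℝ → ℝ) (hW : IsGraphon W) (hconv : ConvergesTo β W)
    (c : ℝ) (hc : 0 < c) (hsub : c * opNorm W ≤ 1) :
    ∀ ε > 0, Tendsto
      (fun n : ℕ => percMeasure (β n) (c / n) {ω | ε * n ≤ (C1 (graphOf ω) : ℝ)})
      atTop (nhds 0) := by
  intro ε hε
  rw [ENNReal.tendsto_nhds_zero]
  intro θ hθ
  by_cases htop : θ = ⊤
  · exact Eventually.of_forall fun n => by rw [htop]; exact le_top
  have hθ' : 0 < θ.toReal := ENNReal.toReal_pos hθ.ne' htop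
  filter_upwards [main_real β βmax hsym hnonneg hbound W hW hconv c hc hsub ε hε _ hθ'] with n hn
  refine (ENNReal.toReal_le_toReal ?_ htop).1 hn
  have : ∀ e, IsProbabilityMeasure (bern (min (c / n * sym2Val (β n) e) 1)) := by
    intro e
    refine bern_prob (le_min (mul_nonneg (by positivity) ?_) zero_le_one) (min_le_right _ _)
    induction e using Sym2.ind with
    | _ v w =>
      simp only [sym2Val, Sym2.lift_mk]
      linarith [hnonneg n v w, hnonneg n w v]
  unfold percMeasure
  exact measure_ne_top _ _
end
end

section
/- Let (G_n) be a sequence of weighted graphs with |G_n| = n and β_max = sup_{i,j,n} β_ij(n) < ∞, converging to a graphon W, and let c > 0 be a constant with c·‖T_W‖ > 1. Then for every constant α < (c‖T_W‖ − 1)/(c·β_max), the number C₁ of vertices in the largest component of G_n(c/n) satisfies P(C₁ ≥ αn) → 1 as n → ∞; in particular C₁ = Θ(n) with high probability. -/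
open MeasureTheory Filter Topology

noncomputable section

namespace Percolation
namespace Aux

set_option linter.unusedSectionVars false
set_option linter.unusedVariables false
set_option linter.style.longLine false

section prob
variable {ι : Type*} [Fintype ι] [DecidableEq ι]

def wt (p : ι → ℝ) (ω : ι → Bool) : ℝ := ∏ e, if ω e then p e else 1 - p e

def Ex (p : ι → ℝ) (F : (ι → Bool) → ℝ) : ℝ := ∑ ω, wt p ω * F ω

/-- probability -/
def Pr (p : ι → ℝ) (S : (ι → Bool) → Prop) : ℝ := by
  classical exact Ex p fun ω => if S ω then 1 else 0

lemma wt_nonneg {p : ι → ℝ} (h0 : ∀ e, 0 ≤ p e) (h1 : ∀ e, p e ≤ 1) (ω) : 0 ≤ wt p ω := by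
  unfold wt
  apply Finset.prod_nonneg
  intro e _
  split_ifs
  · exact h0 e
  · linarith [h1 e]

lemma sum_prod_bool (g : ι → Bool → ℝ) :
    ∑ ω : ι → Bool, ∏ e, g e (ω e) = ∏ e, (g e true + g e false) := by
  have := Finset.prod_univ_sum (fun _ : ι => (Finset.univ : Finset Bool)) g
  simp only [Fintype.piFinset_univ, Fintype.sum_bool] at this
  exact this.symm

lemma sum_wt (p : ι → ℝ) : ∑ ω, wt p ω = 1 := by
  have := sum_prod_bool (fun e b => if b then p e else 1 - p e)
  simpa [wt] using this

lemma Ex_add (p : ι → ℝ) (F G) : Ex p (fun ω => F ω + G ω) = Ex p F + Ex p G := by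
  simp [Ex, mul_add, Finset.sum_add_distrib]

lemma Ex_sub (p : ι → ℝ) (F G) : Ex p (fun ω => F ω - G ω) = Ex p F - Ex p G := by
  simp [Ex, mul_sub, Finset.sum_sub_distrib]

lemma Ex_mul (p : ι → ℝ) (a : ℝ) (F) : Ex p (fun ω => a * F ω) = a * Ex p F := by
  simp only [Ex, Finset.mul_sum]
  exact Finset.sum_congr rfl fun _ _ => by ring

lemma Ex_const (p : ι → ℝ) (a : ℝ) : Ex p (fun _ => a) = a := by
  simp [Ex, ← Finset.sum_mul, sum_wt]

lemma Ex_sum {κ : Type*} (s : Finset κ) (p : ι → ℝ) (F : κ → (ι → Bool) → ℝ) :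
    Ex p (fun ω => ∑ k ∈ s, F k ω) = ∑ k ∈ s, Ex p (F k) := by
  simp only [Ex, Finset.mul_sum]
  exact Finset.sum_comm

lemma Ex_mono {p : ι → ℝ} (h0 : ∀ e, 0 ≤ p e) (h1 : ∀ e, p e ≤ 1) {F G : (ι → Bool) → ℝ}
    (h : ∀ ω, F ω ≤ G ω) : Ex p F ≤ Ex p G :=
  Finset.sum_le_sum fun ω _ => mul_le_mul_of_nonneg_left (h ω) (wt_nonneg h0 h1 ω)

lemma Ex_nonneg {p : ι → ℝ} (h0 : ∀ e, 0 ≤ p e) (h1 : ∀ e, p e ≤ 1) {F : (ι → Bool) → ℝ}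
    (h : ∀ ω, 0 ≤ F ω) : 0 ≤ Ex p F :=
  Finset.sum_nonneg fun ω _ => mul_nonneg (wt_nonneg h0 h1 ω) (h ω)

def avg (p : ι → ℝ) (e : ι) (F : (ι → Bool) → ℝ) (ω : ι → Bool) : ℝ :=
  p e * F (Function.update ω e true) + (1 - p e) * F (Function.update ω e false)

lemma wt_update (p : ι → ℝ) (e : ι) (ω : ι → Bool) (b : Bool) :
    wt p (Function.update ω e b) =
      (if b then p e else 1 - p e) * ∏ x ∈ Finset.univ.erase e, if ω x then p x else 1 - p x := by
  unfold wt
  rw [← Finset.mul_prod_erase _ _ (Finset.mem_univ e)]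
  congr 1
  · simp
  · apply Finset.prod_congr rfl
    intro x hx
    rw [Function.update_of_ne (Finset.ne_of_mem_erase hx)]

lemma sum_flip (e : ι) (G : (ι → Bool) → ℝ) :
    2 * ∑ ω, G ω = ∑ ω, (G (Function.update ω e true) + G (Function.update ω e false)) := by
  have hinv : Function.Involutive (fun ω : ι → Bool => Function.update ω e (!ω e)) := by
    intro ω; simp
  have h := Equiv.sum_comp hinv.toPerm G
  have : ∑ ω, G ω + ∑ ω, G (Function.update ω e (!ω e)) = 2 * ∑ ω, G ω := by
    rw [two_mul]; congr 1
  rw [← this, ← Finset.sum_add_distrib]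
  apply Finset.sum_congr rfl
  intro ω _
  have hs : Function.update ω e (ω e) = ω := by simp
  cases hb : ω e
  · rw [hb] at hs; simp only [Bool.not_false]; rw [hs]; ring
  · rw [hb] at hs; simp only [Bool.not_true]; rw [hs]

lemma Ex_avg (p : ι → ℝ) (e : ι) (F) : Ex p (avg p e F) = Ex p F := by
  have : 2 * Ex p (avg p e F) = 2 * Ex p F := by
    unfold Ex
    rw [sum_flip e, sum_flip e]
    apply Finset.sum_congr rfl
    intro ω _
    simp only [wt_update, avg, Function.update_idem]
    simp
    ring
  linarith

/-- Efron–Stein type bound. -/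
lemma variance_bound {p : ι → ℝ} (h0 : ∀ e, 0 ≤ p e) (h1 : ∀ e, p e ≤ 1) {D : ℝ} (hD : 0 ≤ D)
    (F : (ι → Bool) → ℝ)
    (hF : ∀ ω e, |F (Function.update ω e true) - F (Function.update ω e false)| ≤ D) :
    Ex p (fun ω => (F ω - Ex p F) ^ 2) ≤ D ^ 2 * ∑ e, p e := by
  have key : ∀ s : Finset ι, ∃ H : (ι → Bool) → ℝ,
      (∀ ω e, |H (Function.update ω e true) - H (Function.update ω e false)| ≤ D) ∧
      (∀ ω, ∀ e ∈ s, H (Function.update ω e true) = H (Function.update ω e false)) ∧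
      Ex p H = Ex p F ∧
      Ex p (fun ω => F ω ^ 2) - Ex p (fun ω => H ω ^ 2) ≤ D ^ 2 * ∑ e ∈ s, p e := by
    intro s
    induction s using Finset.induction_on with
    | empty => exact ⟨F, hF, by simp, rfl, by simp⟩
    | insert a s ha ih =>
      obtain ⟨H, h1', h2, h3, h4⟩ := ih
      refine ⟨avg p a H, ?_, ?_, ?_, ?_⟩
      · intro ω e
        by_cases hea : e = a
        · subst hea; simp [avg, hD]
        · unfold avg
          rw [Function.update_comm hea, Function.update_comm hea, Function.update_comm hea,
            Function.update_comm hea]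
          have a1 := h1' (Function.update ω a true) e
          have a2 := h1' (Function.update ω a false) e
          rw [abs_le] at a1 a2 ⊢
          have := h0 a
          have := h1 a
          constructor <;> nlinarith
      · intro ω e he
        by_cases hea : e = a
        · subst hea; simp [avg]
        · have he' : e ∈ s := Finset.mem_of_mem_insert_of_ne he hea
          unfold avg
          rw [Function.update_comm hea, Function.update_comm hea, Function.update_comm hea,
            Function.update_comm hea, h2 _ e he', h2 _ e he']
      · rw [Ex_avg, h3]
      · rw [Finset.sum_insert ha]
        have : Ex p (fun ω => H ω ^ 2) - Ex p (fun ω => (avg p a H ω) ^ 2) ≤ D ^ 2 * p a := by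
          rw [← Ex_avg p a (fun ω => H ω ^ 2), ← Ex_sub, ← Ex_const p (D ^ 2 * p a)]
          apply Ex_mono h0 h1
          intro ω
          have a1 := h1' ω a
          unfold avg
          set x := H (Function.update ω a true)
          set y := H (Function.update ω a false)
          have hsq : (x - y) ^ 2 ≤ D ^ 2 := sq_le_sq' (by linarith [abs_le.1 a1]) (abs_le.1 a1).2
          have e1 : p a * x ^ 2 + (1 - p a) * y ^ 2 - (p a * x + (1 - p a) * y) ^ 2
              = p a * (1 - p a) * (x - y) ^ 2 := by ring
          rw [e1]
          have := h0 a
          have := h1 a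
          have h5 : p a * (1 - p a) ≤ p a := by nlinarith
          have h6 : p a * (1 - p a) * (x - y) ^ 2 ≤ p a * (x - y) ^ 2 :=
            mul_le_mul_of_nonneg_right h5 (sq_nonneg _)
          nlinarith
        linarith
  obtain ⟨H, -, h2, h3, h4⟩ := key Finset.univ
  have hc : ∀ ω, H ω = H (fun _ => false) := by
    have : ∀ s : Finset ι, ∀ ω : ι → Bool, (∀ e, e ∉ s → ω e = false) →
        H ω = H (fun _ => false) := by
      intro s
      induction s using Finset.induction_on with
      | empty =>
        intro ω h; congr 1; funext e; exact h e (by simp)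
      | insert a s ha ih =>
        intro ω h
        have e1 : H ω = H (Function.update ω a false) := by
          have hs : Function.update ω a (ω a) = ω := by simp
          cases hb : ω a
          · rw [← hb, hs]
          · rw [← h2 ω a (Finset.mem_univ _), ← hb, hs]
        rw [e1]
        apply ih
        intro e he
        by_cases hea : e = a
        · subst hea; simp
        · rw [Function.update_of_ne hea]; exact h e (by simp [hea, he])
    intro ω; exact this Finset.univ ω (by simp)
  set m := H (fun _ => false)
  have hm : Ex p H = m := by
    rw [show H = fun _ => m from funext hc, Ex_const]
  have hm2 : Ex p (fun ω => H ω ^ 2) = m ^ 2 := by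
    rw [show (fun ω => H ω ^ 2) = fun _ => m ^ 2 from funext fun ω => by rw [hc ω], Ex_const]
  have hE : Ex p F = m := by rw [← h3, hm]
  have : Ex p (fun ω => (F ω - Ex p F) ^ 2) = Ex p (fun ω => F ω ^ 2) - m ^ 2 := by
    have : (fun ω => (F ω - Ex p F) ^ 2) = fun ω => (F ω ^ 2 - (2 * m) * F ω) + m ^ 2 := by
      funext ω; rw [hE]; ring
    rw [this, Ex_add, Ex_sub, Ex_mul, Ex_const, hE]; ring
  rw [this, ← hm2]; exact h4

lemma Pr_eq (p : ι → ℝ) (S : (ι → Bool) → Prop) [DecidablePred S] :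
    Pr p S = Ex p fun ω => if S ω then 1 else 0 := by
  unfold Pr; congr!

lemma Pr_mono {p : ι → ℝ} (h0 : ∀ e, 0 ≤ p e) (h1 : ∀ e, p e ≤ 1) {S T : (ι → Bool) → Prop}
    (h : ∀ ω, S ω → T ω) : Pr p S ≤ Pr p T := by
  classical
  rw [Pr_eq, Pr_eq]
  apply Ex_mono h0 h1
  intro ω
  by_cases hs : S ω
  · simp [hs, h ω hs]
  · simp only [hs, if_false]; split_ifs <;> norm_num

lemma Pr_nonneg {p : ι → ℝ} (h0 : ∀ e, 0 ≤ p e) (h1 : ∀ e, p e ≤ 1) (S : (ι → Bool) → Prop) :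
    0 ≤ Pr p S := by
  classical
  rw [Pr_eq]
  exact Ex_nonneg h0 h1 fun ω => by split_ifs <;> norm_num

lemma Pr_le_one {p : ι → ℝ} (h0 : ∀ e, 0 ≤ p e) (h1 : ∀ e, p e ≤ 1) (S : (ι → Bool) → Prop) :
    Pr p S ≤ 1 := by
  classical
  rw [Pr_eq]
  refine le_trans (Ex_mono h0 h1 (G := fun _ => 1) fun ω => by split_ifs <;> norm_num) ?_
  rw [Ex_const]

lemma Pr_compl (p : ι → ℝ) (S : (ι → Bool) → Prop) : Pr p (fun ω => ¬ S ω) = 1 - Pr p S := by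
  classical
  rw [Pr_eq, Pr_eq, ← Ex_const p 1, ← Ex_sub]
  congr 1; funext ω; rw [Ex_const]; split_ifs <;> simp_all

/-- Chebyshev. -/
lemma chebyshev {p : ι → ℝ} (h0 : ∀ e, 0 ≤ p e) (h1 : ∀ e, p e ≤ 1) (F : (ι → Bool) → ℝ)
    {t v : ℝ} (ht : 0 < t) (hv : Ex p (fun ω => (F ω - Ex p F) ^ 2) ≤ v) :
    Pr p (fun ω => t ≤ F ω - Ex p F) ≤ v / t ^ 2 := by
  classical
  rw [le_div_iff₀ (by positivity), mul_comm, Pr_eq, ← Ex_mul]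
  refine le_trans (Ex_mono h0 h1 ?_) hv
  intro ω
  split_ifs with h
  · rw [mul_one]; exact pow_le_pow_left₀ ht.le h 2
  · rw [mul_zero]; positivity

/-- Decorrelation: `E[1_S F] ≤ P(S) E F + s` if the variance of `F` is at most `s²`. -/
lemma decorr {p : ι → ℝ} (h0 : ∀ e, 0 ≤ p e) (h1 : ∀ e, p e ≤ 1) (F : (ι → Bool) → ℝ)
    (S : (ι → Bool) → Prop) [DecidablePred S]
    {s : ℝ} (hs : 0 < s) (hv : Ex p (fun ω => (F ω - Ex p F) ^ 2) ≤ s ^ 2) :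
    Ex p (fun ω => (if S ω then 1 else 0) * F ω) ≤ Pr p S * Ex p F + s := by
  have : ∀ ω, (if S ω then 1 else 0) * F ω ≤
      Ex p F * (if S ω then 1 else 0) + ((1 / (2 * s)) * (F ω - Ex p F) ^ 2 + s / 2) := by
    intro ω
    have key : F ω - Ex p F ≤ (1 / (2 * s)) * (F ω - Ex p F) ^ 2 + s / 2 := by
      have : 0 ≤ (1 / (2 * s)) * (F ω - Ex p F - s) ^ 2 := by positivity
      have e : (1 / (2 * s)) * (F ω - Ex p F - s) ^ 2 =
        (1 / (2 * s)) * (F ω - Ex p F) ^ 2 + s / 2 - (F ω - Ex p F) := by field_simp; ring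
      linarith
    split_ifs
    · linarith
    · have : 0 ≤ (1 / (2 * s)) * (F ω - Ex p F) ^ 2 + s / 2 := by positivity
      linarith
  refine le_trans (Ex_mono h0 h1 this) ?_
  rw [Ex_add, Ex_mul, Ex_add, Ex_mul, Ex_const, Pr_eq]
  have : 1 / (2 * s) * Ex p (fun ω => (F ω - Ex p F) ^ 2) ≤ 1 / (2 * s) * s ^ 2 :=
    mul_le_mul_of_nonneg_left hv (by positivity)
  have e : 1 / (2 * s) * s ^ 2 = s / 2 := by field_simp
  nlinarith

lemma flip_lemma {p : ι → ℝ} (h0 : ∀ e, 0 ≤ p e) (h1 : ∀ e, p e ≤ 1) (e : ι)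
    (S : (ι → Bool) → Prop) :
    p e * Pr p (fun ω => S ω ∧ ω e = false) ≤
      Pr p (fun ω => ω e = true ∧ S (Function.update ω e false)) := by
  classical
  rw [Pr_eq, Pr_eq, ← Ex_avg p e, ← Ex_mul, ← Ex_avg p e (fun ω => ite _ _ _)]
  apply Ex_mono h0 h1
  intro ω
  have := h0 e
  have := h1 e
  by_cases hS : S (Function.update ω e false)
  · simp [avg, hS]; nlinarith
  · simp [avg, hS]

lemma Pr_none {p : ι → ℝ} (h0 : ∀ e, 0 ≤ p e) (h1 : ∀ e, p e ≤ 1) (T : Finset ι) :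
    Pr p (fun ω => ∀ e ∈ T, ω e = false) ≤ Real.exp (-∑ e ∈ T, p e) := by
  classical
  have : Pr p (fun ω => ∀ e ∈ T, ω e = false) = ∏ e ∈ T, (1 - p e) := by
    rw [Pr_eq]
    unfold Ex wt
    have h := sum_prod_bool (fun e b => (if b then p e else 1 - p e) *
      (if e ∈ T → b = false then 1 else 0))
    have h2 : ∏ e ∈ T, (1 - p e) = ∏ e, if e ∈ T then (1 - p e) else 1 := by
      rw [Finset.prod_ite_mem]; simp
    rw [h2]
    convert h using 1
    · apply Finset.sum_congr rfl
      intro ω _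
      rw [Finset.prod_mul_distrib]
      congr 1
      rw [Finset.prod_ite_zero]; simp
    · apply Finset.prod_congr rfl
      intro e _
      by_cases he : e ∈ T <;> simp [he]
  rw [this, ← Finset.sum_neg_distrib, Real.exp_sum]
  apply Finset.prod_le_prod
  · intro e _; linarith [h1 e]
  · intro e _; linarith [Real.add_one_le_exp (-p e)]

lemma coupling (p p1 p2 : ι → ℝ) (h : ∀ e, 1 - p e = (1 - p1 e) * (1 - p2 e))
    (F : (ι → Bool) → ℝ) :
    Ex p F = Ex p1 (fun a => Ex p2 (fun b => F (fun e => a e || b e))) := by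
  classical
  have h1 : ∀ ω : ι → Bool, wt p ω =
      ∑ a, ∑ b, wt p1 a * wt p2 b * (if (fun e => a e || b e) = ω then 1 else 0) := by
    intro ω
    have e1 : ∀ a b : ι → Bool, wt p1 a * wt p2 b * (if (fun e => a e || b e) = ω then 1 else 0)
        = ∏ e, ((if a e then p1 e else 1 - p1 e) * (if b e then p2 e else 1 - p2 e) *
          (if (a e || b e) = ω e then 1 else 0)) := by
      intro a b
      rw [Finset.prod_mul_distrib, Finset.prod_mul_distrib, Finset.prod_ite_zero]
      simp [wt, funext_iff]
    simp_rw [e1]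
    have e2 : ∀ a : ι → Bool, ∑ b : ι → Bool,
      ∏ e, ((if a e then p1 e else 1 - p1 e) * (if b e then p2 e else 1 - p2 e) *
          (if (a e || b e) = ω e then 1 else 0)) =
      ∏ e, (fun e x => ((if x then p1 e else 1 - p1 e) * p2 e *
          (if (x || true) = ω e then 1 else 0)) + ((if x then p1 e else 1 - p1 e) * (1 - p2 e) *
          (if (x || false) = ω e then 1 else 0))) e (a e) := by
      intro a
      have := sum_prod_bool (fun e y => ((if a e then p1 e else 1 - p1 e) *
        (if y then p2 e else 1 - p2 e) * (if (a e || y) = ω e then (1:ℝ) else 0)))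
      simpa using this
    rw [Finset.sum_congr rfl (fun a _ => e2 a)]
    refine Eq.trans ?_ (sum_prod_bool (fun e x => ((if x then p1 e else 1 - p1 e) * p2 e *
          (if (x || true) = ω e then 1 else 0)) + ((if x then p1 e else 1 - p1 e) * (1 - p2 e) *
          (if (x || false) = ω e then 1 else 0)))).symm
    unfold wt
    apply Finset.prod_congr rfl
    intro e _
    have := h e
    cases ω e <;> simp <;> linarith
  unfold Ex
  simp_rw [h1, Finset.sum_mul, Finset.mul_sum]
  rw [Finset.sum_comm]
  apply Finset.sum_congr rfl
  intro a _
  rw [Finset.sum_comm]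
  apply Finset.sum_congr rfl
  intro b _
  simp only [mul_ite, mul_one, mul_zero, ite_mul, zero_mul]
  rw [Finset.sum_ite_eq]
  simp [mul_assoc]

end prob
end Aux
end Percolation

namespace Percolation
namespace Aux
set_option linter.unusedSectionVars false
set_option linter.unusedVariables false

section graph
variable {V : Type*} [Fintype V] [DecidableEq V]

lemma adj_iff (ω : Sym2 V → Bool) (i j : V) :
    (graphOf ω).Adj i j ↔ i ≠ j ∧ ω s(i, j) = true := by
  unfold graphOf
  rw [SimpleGraph.fromRel_adj, Sym2.eq_swap (a := j) (b := i), or_self]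

/-- `i` reaches `j` in `ω`. -/
def Rch (ω : Sym2 V → Bool) (i j : V) : Prop := (graphOf ω).Reachable i j

def X (K : ℕ) (ω : Sym2 V → Bool) (i : V) : Prop := K ≤ compSize (graphOf ω) i

lemma Rch.refl (ω : Sym2 V → Bool) (i : V) : Rch ω i i := SimpleGraph.Reachable.refl i
lemma Rch.symm {ω : Sym2 V → Bool} {i j : V} (h : Rch ω i j) : Rch ω j i :=
  SimpleGraph.Reachable.symm h
lemma Rch.trans {ω : Sym2 V → Bool} {i j k : V} (h : Rch ω i j) (h' : Rch ω j k) : Rch ω i k :=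
  SimpleGraph.Reachable.trans h h'

lemma Rch.step {ω : Sym2 V → Bool} {i j k : V} (h : Rch ω i j) (h' : ω s(j, k) = true) :
    Rch ω i k := by
  by_cases hjk : j = k
  · subst hjk; exact h
  · exact h.trans (SimpleGraph.Adj.reachable ((adj_iff ω j k).2 ⟨hjk, h'⟩))

lemma Rch.ind {ω : Sym2 V → Bool} {i : V} {P : V → Prop} (h0 : P i)
    (hs : ∀ u w, Rch ω i u → P u → u ≠ w → ω s(u, w) = true → P w) {j : V} (h : Rch ω i j) :
    P j := by
  have h' := (SimpleGraph.reachable_iff_reflTransGen _ _).1 h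
  induction h' with
  | refl => exact h0
  | tail a b ih =>
    have a' := (SimpleGraph.reachable_iff_reflTransGen _ _).2 a
    have b' := (adj_iff ω _ _).1 b
    exact hs _ _ a' (ih a') b'.1 b'.2

lemma Rch.mono {ω ω' : Sym2 V → Bool} (hle : ∀ e, ω e = true → ω' e = true) {i j : V}
    (h : Rch ω i j) : Rch ω' i j :=
  Rch.ind (Rch.refl _ _) (fun u w _ h2 _ h4 => h2.step (hle _ h4)) h

lemma compSize_eq (ω : Sym2 V → Bool) (i : V) :
    compSize (graphOf ω) i = {w | Rch ω i w}.ncard := rfl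

lemma X_of_subset {K : ℕ} {ω ω' : Sym2 V → Bool} {i j : V} (h : X K ω i)
    (hs : ∀ w, Rch ω i w → Rch ω' j w) : X K ω' j := by
  unfold X at *
  rw [compSize_eq] at *
  exact h.trans (Set.ncard_le_ncard hs (Set.toFinite _))

lemma X_mono {K : ℕ} {ω ω' : Sym2 V → Bool} (hle : ∀ e, ω e = true → ω' e = true) {i : V}
    (h : X K ω i) : X K ω' i :=
  X_of_subset h fun _ hw => hw.mono hle

lemma X_rch {K : ℕ} {ω : Sym2 V → Bool} {i j : V} (hr : Rch ω i j)
    (h : X K ω i) : X K ω j :=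
  X_of_subset h fun _ hw => hr.symm.trans hw

lemma X_one (ω : Sym2 V → Bool) (i : V) : X 1 ω i := by
  unfold X
  rw [compSize_eq, Nat.one_le_iff_ne_zero]
  exact Set.ncard_ne_zero_of_mem (a := i) (Rch.refl _ _)

/-- Enlarging by one vertex. -/
lemma X_succ {K : ℕ} {ω ω' : Sym2 V → Bool} {i j : V} (h : X K ω j) (hn : ¬ Rch ω j i)
    (hs : ∀ w, Rch ω j w → Rch ω' i w) : X (K + 1) ω' i := by
  unfold X at *
  rw [compSize_eq] at *
  have h1 : (insert i {w | Rch ω j w}).ncard = {w | Rch ω j w}.ncard + 1 :=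
    Set.ncard_insert_of_notMem hn (Set.toFinite _)
  have h2 : (insert i {w | Rch ω j w}).ncard ≤ {w | Rch ω' i w}.ncard := by
    apply Set.ncard_le_ncard _ (Set.toFinite _)
    intro w hw
    rcases hw with rfl | hw
    · exact Rch.refl _ _
    · exact hs w hw
  omega

/-- pivotality of the edge `ij`. -/
def Piv (K L : ℕ) (ω : Sym2 V → Bool) (i j : V) : Prop :=
  ω s(i, j) = true ∧ (¬ X L (Function.update ω s(i, j) false) i ∧
    X K (Function.update ω s(i, j) false) j ∧ ¬ Rch (Function.update ω s(i, j) false) i j)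

lemma update_false_le (ω : Sym2 V → Bool) (e e' : Sym2 V)
    (h : Function.update ω e false e' = true) : ω e' = true := by
  by_cases he : e' = e
  · subst he; simp at h
  · rwa [Function.update_of_ne he] at h

lemma X_le {K L : ℕ} (hL : L ≤ K) {ω : Sym2 V → Bool} {i : V} (h : X K ω i) : X L ω i :=
  le_trans hL h

lemma Piv.X {K L : ℕ} (hL : L ≤ K + 1) {ω : Sym2 V → Bool} {i j : V} (h : Piv K L ω i j) :
    X L ω i := by
  obtain ⟨h1, h2, h3, h4⟩ := h
  refine X_le hL (X_succ h3 (fun h => h4 h.symm) ?_)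
  intro w hw
  exact ((Rch.refl ω i).step h1).trans (hw.mono (update_false_le ω _))

lemma Piv.unique {K L : ℕ} (hL : L ≤ K + 1) {ω : Sym2 V → Bool} {i j j' : V}
    (h : Piv K L ω i j) (h' : Piv K L ω i j') : j = j' := by
  by_contra hne
  obtain ⟨h1, h2, h3, h4⟩ := h
  obtain ⟨h1', h2', h3', h4'⟩ := h'
  apply h2
  have hn : ¬ Rch (Function.update ω s(i, j') false) j' i := fun h => h4' h.symm
  refine X_le hL (X_succ h3' hn ?_)
  intro w hw
  have e1 : Rch (Function.update ω s(i, j) false) i j' := by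
    apply (Rch.refl _ i).step
    rw [Function.update_of_ne]
    · exact h1'
    · intro h
      rw [Sym2.eq_iff] at h
      rcases h with ⟨_, h⟩ | ⟨h, h'⟩
      · exact hne h.symm
      · exact hne (h ▸ h'.symm)
  refine e1.trans (Rch.ind (P := fun w => Rch (Function.update ω s(i, j) false) j' w)
    (Rch.refl _ _) ?_ hw)
  intro u w hu hu' huw he
  apply hu'.step
  have hui : u ≠ i := fun h => hn (h ▸ hu)
  have hwi : w ≠ i := fun h => hn (h ▸ hu.step he)
  rw [Function.update_of_ne]
  · exact update_false_le ω _ _ he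
  · intro h
    rw [Sym2.eq_iff] at h
    rcases h with ⟨h, _⟩ | ⟨_, h⟩
    · exact hui h
    · exact hwi h

open Classical in
def Xi (K : ℕ) (ω : Sym2 V → Bool) (i : V) : ℝ := if X K ω i then 1 else 0

lemma Xi_nonneg (K : ℕ) (ω : Sym2 V → Bool) (i : V) : 0 ≤ Xi K ω i := by
  unfold Xi; split_ifs <;> norm_num
lemma Xi_le_one (K : ℕ) (ω : Sym2 V → Bool) (i : V) : Xi K ω i ≤ 1 := by
  unfold Xi; split_ifs <;> norm_num

/-- flipping an edge changes few vertices -/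
lemma Xi_diff (K : ℕ) (ω : Sym2 V → Bool) (e : Sym2 V) :
    ∑ k, |Xi K (Function.update ω e true) k - Xi K (Function.update ω e false) k| ≤ 2 * K := by
  classical
  induction e using Sym2.ind with
  | _ i j =>
  set ω1 := Function.update ω s(i, j) true with hω1
  set ω0 := Function.update ω s(i, j) false with hω0
  have hle : ∀ e, ω0 e = true → ω1 e = true := by
    intro e he
    by_cases h : e = s(i, j)
    · subst h; simp [hω1]
    · rw [hω1, Function.update_of_ne h]; rwa [hω0, Function.update_of_ne h] at he
  have hterm : ∀ k, |Xi K ω1 k - Xi K ω0 k| = if (X K ω1 k ∧ ¬ X K ω0 k) then 1 else 0 := by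
    intro k
    unfold Xi
    by_cases h0 : X K ω0 k
    · simp [h0, X_mono hle h0]
    · by_cases h1 : X K ω1 k <;> simp [h0, h1]
  simp_rw [hterm]
  rw [Finset.sum_boole]
  set S : V → Finset V := fun a => Finset.univ.filter fun k => Rch ω0 a k ∧ ¬ X K ω0 a
  have hS : ∀ a, (S a).card ≤ K := by
    intro a
    by_cases ha : X K ω0 a
    · simp [S, ha]
    · have : (S a).card = compSize (graphOf ω0) a := by
        rw [compSize_eq, ← Set.ncard_coe_finset]
        congr 1; ext k; simp [S, ha]
      rw [this]
      unfold X at ha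
      omega
  have hsub : (Finset.univ.filter fun k => X K ω1 k ∧ ¬ X K ω0 k) ⊆ S i ∪ S j := by
    intro k hk
    simp only [Finset.mem_filter, Finset.mem_univ, true_and] at hk
    obtain ⟨h1, h0⟩ := hk
    rw [Finset.mem_union]
    by_contra hcon
    push Not at hcon
    obtain ⟨hi, hj⟩ := hcon
    have hi' : ¬ Rch ω0 k i := by
      intro h
      apply hi
      simp only [S, Finset.mem_filter, Finset.mem_univ, true_and]
      exact ⟨h.symm, fun hx => h0 (X_rch h.symm hx)⟩
    have hj' : ¬ Rch ω0 k j := by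
      intro h
      apply hj
      simp only [S, Finset.mem_filter, Finset.mem_univ, true_and]
      exact ⟨h.symm, fun hx => h0 (X_rch h.symm hx)⟩
    apply h0
    refine X_of_subset h1 ?_
    intro w hw
    refine Rch.ind (P := fun w => Rch ω0 k w) (Rch.refl _ _) ?_ hw
    intro u w _ hu _ he
    apply hu.step
    have hne : s(u, w) ≠ s(i, j) := by
      intro h
      rw [Sym2.eq_iff] at h
      rcases h with ⟨h, _⟩ | ⟨h, _⟩
      · exact hi' (h ▸ hu)
      · exact hj' (h ▸ hu)
    rw [hω0, Function.update_of_ne hne]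
    rwa [hω1, Function.update_of_ne hne] at he
  have := (Finset.card_le_card hsub).trans (Finset.card_union_le _ _)
  have h3 : (Finset.univ.filter fun k => X K ω1 k ∧ ¬ X K ω0 k).card ≤ 2 * K := by
    have := hS i; have := hS j; omega
  exact_mod_cast h3

/-- The main exact inequality. -/
lemma piv_ineq {p : Sym2 V → ℝ} (h0 : ∀ e, 0 ≤ p e) (h1 : ∀ e, p e ≤ 1) {K L : ℕ}
    (hL : L ≤ K + 1) (i : V) :
    ∑ j, p s(i, j) * Pr p (fun ω => ¬ X L ω i ∧ X K ω j ∧ ¬ Rch ω i j) ≤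
      Pr p (fun ω => X L ω i) := by
  classical
  have h : ∀ j, p s(i, j) * Pr p (fun ω => ¬ X L ω i ∧ X K ω j ∧ ¬ Rch ω i j) ≤
      Pr p (fun ω => Piv K L ω i j) := by
    intro j
    refine le_trans (mul_le_mul_of_nonneg_left (Pr_mono h0 h1 ?_) (h0 _))
      (flip_lemma h0 h1 s(i, j) (fun ω => ¬ X L ω i ∧ X K ω j ∧ ¬ Rch ω i j))
    intro ω hω
    refine ⟨hω, ?_⟩
    by_contra hne
    exact hω.2.2 ((Rch.refl _ i).step (by simpa using hne))
  refine (Finset.sum_le_sum fun j _ => h j).trans ?_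
  simp_rw [Pr_eq]
  rw [← Ex_sum]
  apply Ex_mono h0 h1
  intro ω
  rw [Finset.sum_boole]
  by_cases hX : X L ω i
  · rw [if_pos hX]
    have : (Finset.univ.filter fun j => Piv K L ω i j).card ≤ 1 := by
      rw [Finset.card_le_one]
      intro a ha b hb
      simp only [Finset.mem_filter, Finset.mem_univ, true_and] at ha hb
      exact ha.unique hL hb
    exact_mod_cast this
  · rw [if_neg hX]
    have : (Finset.univ.filter fun j => Piv K L ω i j) = ∅ := by
      ext j
      simp only [Finset.mem_filter, Finset.mem_univ, true_and, Finset.notMem_empty, iff_false]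
      exact fun h => hX (h.X hL)
    rw [this]; simp

end graph
end Aux
end Percolation

namespace Percolation
namespace Aux
set_option linter.unusedSectionVars false
set_option linter.unusedVariables false

section quant

lemma sum_sym2_le {V : Type*} [Fintype V] [DecidableEq V] {p : Sym2 V → ℝ} (h0 : ∀ e, 0 ≤ p e) :
    ∑ e, p e ≤ ∑ i, ∑ j, p s(i, j) := by
  classical
  rw [← Fintype.sum_prod_type' (f := fun i j => p s(i, j))]
  rw [← Finset.sum_fiberwise (s := (Finset.univ : Finset (V × V)))
    (g := fun x => s(x.1, x.2)) (f := fun x => p s(x.1, x.2))]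
  apply Finset.sum_le_sum
  intro e _
  induction e using Sym2.ind with
  | _ i j =>
  exact Finset.single_le_sum (f := fun x : V × V => p s(x.1, x.2)) (a := (i, j))
    (fun x _ => h0 _) (by simp)

/-- standing assumptions on edge probabilities -/
structure Ok {n : ℕ} (p : Sym2 (Fin n) → ℝ) (b : ℝ) : Prop where
  h0 : ∀ e, 0 ≤ p e
  h1 : ∀ e, p e ≤ 1
  hb : ∀ i j, p s(i, j) ≤ b / n

lemma Ok.row {n : ℕ} (hn : 0 < n) {p : Sym2 (Fin n) → ℝ} {b : ℝ} (h : Ok p b) (i : Fin n) :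
    ∑ j, p s(i, j) ≤ b := by
  refine (Finset.sum_le_sum fun j _ => h.hb i j).trans ?_
  have : (n : ℝ) ≠ 0 := by positivity
  simp; field_simp; exact le_refl _

lemma Ok.tot {n : ℕ} (hn : 0 < n) {p : Sym2 (Fin n) → ℝ} {b : ℝ} (h : Ok p b) :
    ∑ e, p e ≤ b * n := by
  refine (sum_sym2_le h.h0).trans ((Finset.sum_le_sum fun i _ => h.row hn i).trans ?_)
  simp [mul_comm]

lemma survival_bound {b M μ ε : ℝ} (hb : 0 < b) (hM : 0 < M) (hμ : 0 < μ) (hε : 0 < ε)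
    (hεM : ε * M ≤ 1) (hεμ : 1 ≤ μ * (1 - ε * M)) (K : ℕ) :
    ∀ η : ℝ, 0 < η → ∃ N : ℕ, ∀ n : ℕ, N ≤ n → ∀ (p : Sym2 (Fin n) → ℝ) (v : Fin n → ℝ),
      Ok p b → (∀ i, 0 ≤ v i) → (∀ i, v i ≤ M) → (∀ i, μ * v i ≤ ∑ j, p s(i, j) * v j) →
      ∀ i, ε * v i - η ≤ Pr p (fun ω => X (K + 1) ω i) := by
  classical
  induction K with
  | zero =>
    intro η hη
    refine ⟨0, fun n _ p v hp hv0 hvM hv i => ?_⟩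
    have : Pr p (fun ω => X (0 + 1) ω i) = 1 := by
      rw [Pr_eq]
      have : (fun ω => if X (0 + 1) ω i then (1:ℝ) else 0) = fun _ => 1 := by
        funext ω; rw [if_pos (X_one ω i)]
      rw [this, Ex_const]
    rw [this]
    have := mul_le_mul_of_nonneg_left (hvM i) hε.le
    linarith
  | succ K ih =>
    intro η hη
    obtain ⟨N1, hN1⟩ := ih (η / (3 * (b + 1))) (by positivity)
    set K' : ℕ := K + 1 with hK'
    set s : ℝ := η / 3 with hs
    have hs0 : 0 < s := by positivity
    obtain ⟨N2, hN2⟩ := exists_nat_ge (4 * (K':ℝ) ^ 2 * b ^ 3 / s ^ 2)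
    obtain ⟨N3, hN3⟩ := exists_nat_ge (3 * b * (K' + 1) / η)
    refine ⟨N1 + N2 + N3 + 1, fun n hn p v hp hv0 hvM hv i => ?_⟩
    have hn0 : 0 < n := by omega
    have hnR : (0:ℝ) < n := by exact_mod_cast hn0
    have hnN2 : (N2:ℝ) ≤ n := by exact_mod_cast (by omega : N2 ≤ n)
    have hnN3 : (N3:ℝ) ≤ n := by exact_mod_cast (by omega : N3 ≤ n)
    have ih' := hN1 n (by omega) p v hp hv0 hvM hv
    set F : (Sym2 (Fin n) → Bool) → ℝ := fun ω => ∑ j, p s(i, j) * Xi K' ω j with hF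
    set a : ℝ := Ex p F with ha
    set y : ℝ := Pr p (fun ω => X (K' + 1) ω i) with hy
    have haeq : a = ∑ j, p s(i, j) * Pr p (fun ω => X K' ω j) := by
      rw [ha, hF, Ex_sum]
      apply Finset.sum_congr rfl
      intro j _
      rw [Ex_mul, Pr_eq]; rfl
    -- variance
    have hvar : Ex p (fun ω => (F ω - Ex p F) ^ 2) ≤ s ^ 2 := by
      have hD : 0 ≤ b / n * (2 * K') := by positivity
      refine (variance_bound hp.h0 hp.h1 hD F ?_).trans ?_
      · intro ω e
        rw [hF]
        simp only
        rw [← Finset.sum_sub_distrib]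
        refine (Finset.abs_sum_le_sum_abs _ _).trans ?_
        refine le_trans ?_ (mul_le_mul_of_nonneg_left (Xi_diff K' ω e) (by positivity))
        rw [Finset.mul_sum]
        apply Finset.sum_le_sum
        intro j _
        rw [← mul_sub, abs_mul, abs_of_nonneg (hp.h0 _)]
        exact mul_le_mul_of_nonneg_right (hp.hb i j) (abs_nonneg _)
      · refine (mul_le_mul_of_nonneg_left (hp.tot hn0) (by positivity)).trans ?_
        have e : (b / n * (2 * K')) ^ 2 * (b * n) = 4 * (K':ℝ) ^ 2 * b ^ 3 / n := by
          field_simp; ring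
        rw [e, div_le_iff₀ hnR]
        have := hN2.trans hnN2
        rw [div_le_iff₀ (by positivity)] at this
        linarith
    -- main inequality
    have hmain : a ≤ y + (y * a + s) + b / n * (K' + 1) := by
      have hpt : ∀ ω, F ω ≤ (∑ j, p s(i, j) *
          (if (¬ X (K' + 1) ω i ∧ X K' ω j ∧ ¬ Rch ω i j) then 1 else 0)) +
          (if X (K' + 1) ω i then 1 else 0) * F ω + b / n * (K' + 1) := by
        intro ω
        by_cases hX : X (K' + 1) ω i
        · simp [hX]; positivity
        · have hc : ∑ j, (if Rch ω i j then (1:ℝ) else 0) ≤ K' + 1 := by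
            rw [Finset.sum_boole]
            have : (Finset.univ.filter fun j => Rch ω i j).card = compSize (graphOf ω) i := by
              rw [compSize_eq, ← Set.ncard_coe_finset]
              congr 1; ext k; simp
            rw [this]
            unfold X at hX
            have : compSize (graphOf ω) i ≤ K' + 1 := by omega
            exact_mod_cast this
          have h2 : F ω ≤ ∑ j, (p s(i, j) *
            (if (¬ X (K' + 1) ω i ∧ X K' ω j ∧ ¬ Rch ω i j) then 1 else 0) +
              b / n * (if Rch ω i j then (1:ℝ) else 0)) := by
            rw [hF]
            apply Finset.sum_le_sum
            intro j _
            have hpj := hp.h0 s(i, j)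
            have hpb := hp.hb i j
            have := Xi_le_one K' ω j
            by_cases hR : Rch ω i j
            · simp only [hX, hR]; simp; nlinarith
            · simp only [hX, hR, Xi]; simp
          rw [Finset.sum_add_distrib, ← Finset.mul_sum] at h2
          have := mul_le_mul_of_nonneg_left hc (show 0 ≤ b / n by positivity)
          simp only [hX, if_false, zero_mul, add_zero] at h2 ⊢
          linarith
      have h3 := Ex_mono hp.h0 hp.h1 hpt
      rw [Ex_add, Ex_add, Ex_const] at h3
      have h4 := decorr hp.h0 hp.h1 F (fun ω => X (K' + 1) ω i) hs0 hvar
      have h5 := piv_ineq hp.h0 hp.h1 (le_refl (K' + 1)) i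
      have h6 : Ex p (fun ω => ∑ k, p s(i, k) *
          (if (¬ X (K' + 1) ω i ∧ X K' ω k ∧ ¬ Rch ω i k) then 1 else 0)) ≤ y := by
        rw [Ex_sum]
        refine le_trans (le_of_eq ?_) h5
        apply Finset.sum_congr rfl
        intro j _
        rw [Ex_mul, Pr_eq]
      linarith
    have halow : μ * (ε * v i) - b * (η / (3 * (b + 1))) ≤ a := by
      rw [haeq]
      have h1 : ∑ j, p s(i, j) * (ε * v j - η / (3 * (b + 1))) ≤
          ∑ j, p s(i, j) * Pr p (fun ω => X K' ω j) :=
        Finset.sum_le_sum fun j _ => mul_le_mul_of_nonneg_left (ih' j) (hp.h0 _)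
      have h2 : ∑ j, p s(i, j) * (ε * v j - η / (3 * (b + 1))) =
          ε * ∑ j, p s(i, j) * v j - (∑ j, p s(i, j)) * (η / (3 * (b + 1))) := by
        rw [Finset.mul_sum, Finset.sum_mul, ← Finset.sum_sub_distrib]
        exact Finset.sum_congr rfl fun _ _ => by ring
      have h3 := mul_le_mul_of_nonneg_left (hv i) hε.le
      have h4 := mul_le_mul_of_nonneg_right (hp.row hn0 i)
        (show 0 ≤ η / (3 * (b + 1)) by positivity)
      linarith
    have herr1 : b * (η / (3 * (b + 1))) ≤ η / 3 := by
      rw [mul_div_assoc', div_le_div_iff₀ (by positivity) (by positivity)]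
      nlinarith
    have herr2 : b / n * (K' + 1) ≤ η / 3 := by
      have := hN3.trans hnN3
      rw [div_le_iff₀ hη] at this
      rw [div_mul_eq_mul_div, div_le_div_iff₀ hnR (by norm_num)]
      nlinarith
    by_contra hcon
    push Not at hcon
    have hy0 : 0 ≤ y := Pr_nonneg hp.h0 hp.h1 _
    have hy' : y < ε * v i - η := hcon
    have hεv : ε * v i ≤ ε * M := mul_le_mul_of_nonneg_left (hvM i) hε.le
    have ha0 : 0 ≤ a := by
      rw [haeq]
      exact Finset.sum_nonneg fun j _ => mul_nonneg (hp.h0 _) (Pr_nonneg hp.h0 hp.h1 _)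
    set w := ε * v i with hw
    have hw0 : 0 ≤ w := mul_nonneg hε.le (hv0 i)
    set z := b * (η / (3 * (b + 1))) with hz
    have hz0 : 0 ≤ z := by positivity
    -- a (1 - w) ≤ a (1-y) ≤ y + s + ..
    have g1 : a * (1 - w) ≤ y + s + η / 3 := by nlinarith
    have g2 : (μ * w - z) * (1 - w) ≤ a * (1 - w) :=
      mul_le_mul_of_nonneg_right halow (by linarith)
    have g3 : w ≤ μ * w * (1 - w) := by
      have : 1 ≤ μ * (1 - w) := hεμ.trans (mul_le_mul_of_nonneg_left (by linarith) hμ.le)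
      nlinarith
    have g4 : z * (1 - w) ≤ z := by nlinarith
    have g5 : (μ * w - z) * (1 - w) = μ * w * (1 - w) - z * (1 - w) := by ring
    linarith

end quant
end Aux
end Percolation

namespace Percolation
namespace Aux
set_option linter.unusedSectionVars false
set_option linter.unusedVariables false

section sprinkle
variable {V : Type*} [Fintype V] [DecidableEq V]

open Classical in
/-- vertices in large components -/
def XS (K : ℕ) (a : Sym2 V → Bool) : Finset V := Finset.univ.filter fun i => X K a i

open Classical in
/-- unions of large components -/
def Un (K : ℕ) (a : Sym2 V → Bool) : Finset (Finset V) :=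
  Finset.univ.filter fun S => S ⊆ XS K a ∧ ∀ i j, Rch a i j → i ∈ S → j ∈ S

def Good (K : ℕ) (p : Sym2 V → ℝ) (t : ℝ) (a b : Sym2 V → Bool) : Prop :=
  ∀ S ∈ Un K a, (∀ i ∈ S, ∀ j ∈ XS K a \ S, b s(i, j) = false) →
    ∑ i ∈ S, ∑ j ∈ XS K a \ S, p s(i, j) < t

lemma card_Un (K : ℕ) (hK : 0 < K) (a : Sym2 V → Bool) :
    (Un K a).card ≤ 2 ^ (Fintype.card V / K) := by
  classical
  let q : V → (graphOf a).ConnectedComponent := (graphOf a).connectedComponentMk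
  have hq : ∀ i j, q i = q j ↔ Rch a i j := fun i j => SimpleGraph.ConnectedComponent.eq
  set Big : Finset (graphOf a).ConnectedComponent := (XS K a).image q with hBig
  have h1 : Big.card * K ≤ Fintype.card V := by
    have h := Finset.card_eq_sum_card_fiberwise (s := XS K a) (t := Big) (f := q)
      (fun x hx => by simpa [hBig] using ⟨x, by simpa using hx, rfl⟩)
    have h2 : ∑ c ∈ Big, K ≤ ∑ c ∈ Big, ((XS K a).filter fun x => q x = c).card := by
      apply Finset.sum_le_sum
      intro c hc
      rw [hBig, Finset.mem_image] at hc
      obtain ⟨i, hi, rfl⟩ := hc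
      have hi' : X K a i := by simpa [XS] using hi
      have : ((XS K a).filter fun x => q x = q i).card = compSize (graphOf a) i := by
        rw [compSize_eq, ← Set.ncard_coe_finset]
        congr 1; ext k
        simp only [Finset.coe_filter, Set.mem_ofPred_eq, XS, Finset.mem_filter, Finset.mem_univ,
          true_and, hq]
        exact ⟨fun h => h.2.symm, fun h => ⟨X_rch h hi', h.symm⟩⟩
      rw [this]; exact hi'
    rw [Finset.sum_const, smul_eq_mul, ← h] at h2
    exact h2.trans (Finset.card_le_univ _)
  have h2 : (Un K a).card ≤ Big.powerset.card := by
    apply Finset.card_le_card_of_injOn (fun S => S.image q)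
    · intro S hS
      simp only [Un, Finset.coe_filter, Set.mem_ofPred_eq, Finset.mem_univ, true_and] at hS
      simp only [Finset.coe_powerset, Set.mem_preimage, Set.mem_powerset_iff, Finset.coe_subset]
      exact Finset.image_subset_image hS.1
    · have key : ∀ S T : Finset V, S ∈ Un K a → T ∈ Un K a → S.image q = T.image q → S ⊆ T := by
        intro S T hS hT h x hx
        have hx' : q x ∈ T.image q := h ▸ Finset.mem_image_of_mem q hx
        rw [Finset.mem_image] at hx'
        obtain ⟨y, hy, hyx⟩ := hx'
        simp only [Un, Finset.mem_filter, Finset.mem_univ, true_and] at hT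
        exact hT.2 y x ((hq _ _).1 hyx) hy
      intro S hS T hT h
      exact Finset.Subset.antisymm (key S T hS hT h) (key T S hT hS h.symm)
  rw [Finset.card_powerset] at h2
  exact h2.trans (Nat.pow_le_pow_right (by norm_num) ((Nat.le_div_iff_mul_le hK).2 h1))

lemma good_prob {p1 p2 : Sym2 V → ℝ} (h0 : ∀ e, 0 ≤ p2 e) (h1 : ∀ e, p2 e ≤ 1)
    {τ t : ℝ} (hτ : 0 ≤ τ) (h12 : ∀ e, τ * p1 e ≤ p2 e) (K : ℕ) (hK : 0 < K)
    (a : Sym2 V → Bool) :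
    Pr p2 (fun b => ¬ Good K p1 t a b) ≤ 2 ^ (Fintype.card V / K) * Real.exp (-(τ * t)) := by
  classical
  set U := (Un K a).filter fun S => t ≤ ∑ i ∈ S, ∑ j ∈ XS K a \ S, p1 s(i, j) with hU
  have step1 : Pr p2 (fun b => ¬ Good K p1 t a b) ≤
      ∑ S ∈ U, Pr p2 (fun b => ∀ e ∈ (S ×ˢ (XS K a \ S)).image (fun x => s(x.1, x.2)),
        b e = false) := by
    simp_rw [Pr_eq]
    rw [← Ex_sum]
    apply Ex_mono h0 h1
    intro b
    by_cases hg : Good K p1 t a b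
    · simp only [hg, not_true_eq_false, if_false]
      exact Finset.sum_nonneg fun S _ => by split_ifs <;> norm_num
    · rw [if_pos hg]
      unfold Good at hg
      push Not at hg
      obtain ⟨S, hS, hS1, hS2⟩ := hg
      refine le_trans ?_ (Finset.single_le_sum (a := S)
        (fun S _ => by split_ifs <;> norm_num) (Finset.mem_filter.2 ⟨hS, hS2⟩))
      rw [if_pos]
      intro e he
      rw [Finset.mem_image] at he
      obtain ⟨⟨i, j⟩, hij, rfl⟩ := he
      rw [Finset.mem_product] at hij
      exact hS1 i hij.1 j hij.2
  refine step1.trans ?_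
  have step2 : ∀ S ∈ U, Pr p2 (fun b => ∀ e ∈ (S ×ˢ (XS K a \ S)).image (fun x => s(x.1, x.2)),
        b e = false) ≤ Real.exp (-(τ * t)) := by
    intro S hS
    refine (Pr_none h0 h1 _).trans ?_
    rw [Real.exp_le_exp, neg_le_neg_iff, Finset.sum_image, Finset.sum_product]
    · have hS' := (Finset.mem_filter.1 hS).2
      refine (mul_le_mul_of_nonneg_left hS' hτ).trans ?_
      rw [Finset.mul_sum]
      refine Finset.sum_le_sum fun i _ => ?_
      rw [Finset.mul_sum]
      exact Finset.sum_le_sum fun j _ => h12 _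
    · rintro ⟨i, j⟩ hx ⟨i', j'⟩ hy h
      simp only [Finset.coe_product, Set.mem_prod, Finset.mem_coe, Finset.mem_sdiff] at hx hy
      rw [Sym2.eq_iff] at h
      rcases h with ⟨h, h'⟩ | ⟨h, h'⟩
      · simp only at h h'; rw [h, h']
      · simp only at h h'
        exact absurd (h ▸ hx.1) hy.2.2
  refine (Finset.sum_le_sum step2).trans ?_
  rw [Finset.sum_const, nsmul_eq_mul]
  apply mul_le_mul_of_nonneg_right _ (Real.exp_pos _).le
  have : U.card ≤ 2 ^ (Fintype.card V / K) :=
    (Finset.card_le_card (Finset.filter_subset _ _)).trans (card_Un K hK a)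
  exact_mod_cast this

lemma half_prob {ι : Type*} [Fintype ι] [DecidableEq ι] {a b : ι} (hab : a ≠ b) :
    Ex (fun _ : ι => (1/2 : ℝ)) (fun s => if (s a = true ∧ s b = false) then 1 else 0) = 1 / 4 := by
  rw [← Ex_avg _ a]
  rw [← Ex_avg _ b]
  rw [← Ex_const (fun _ : ι => (1/2 : ℝ)) (1/4)]
  congr 1
  funext s
  simp [avg, hab, Function.update_of_ne hab, Function.update_of_ne hab.symm]
  norm_num

open Classical in
lemma cross_bound {p : Sym2 V → ℝ} {t : ℝ} {K : ℕ} {a b : Sym2 V → Bool}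
    (hg : Good K p t a b) :
    ∑ i ∈ XS K a, ∑ j ∈ XS K a,
      (if Rch (fun e => a e || b e) i j then 0 else p s(i, j)) ≤ 4 * t := by
  set ω : Sym2 V → Bool := fun e => a e || b e with hω
  let q : V → (graphOf ω).ConnectedComponent := (graphOf ω).connectedComponentMk
  have hq : ∀ i j, q i = q j ↔ Rch ω i j := fun i j => SimpleGraph.ConnectedComponent.eq
  let P : (graphOf ω).ConnectedComponent → ℝ := fun _ => 1/2
  have h1 : Ex P (fun s => ∑ i ∈ XS K a, ∑ j ∈ XS K a,
      p s(i, j) * (if (s (q i) = true ∧ s (q j) = false) then 1 else 0)) ≤ t := by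
    rw [← Ex_const P t]
    apply Ex_mono (fun _ => by norm_num [P]) (fun _ => by norm_num [P])
    intro s
    set S := (XS K a).filter fun i => s (q i) = true with hS
    have hSU : S ∈ Un K a := by
      simp only [Un, Finset.mem_filter, Finset.mem_univ, true_and]
      refine ⟨Finset.filter_subset _ _, ?_⟩
      intro i j hij hi
      rw [hS, Finset.mem_filter] at hi ⊢
      refine ⟨?_, ?_⟩
      · have := hi.1
        simp only [XS, Finset.mem_filter, Finset.mem_univ, true_and] at this ⊢
        exact X_rch hij this
      · rw [← hi.2]; congr 1
        exact ((hq _ _).2 (hij.mono (by intro e he; simp [hω, he]))).symm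
    have := hg S hSU (by
      intro i hi j hj
      by_contra hne
      have hr : Rch ω i j := (Rch.refl ω i).step (by simp [hω, hne])
      rw [Finset.mem_sdiff] at hj
      apply hj.2
      rw [hS, Finset.mem_filter] at hi ⊢
      exact ⟨hj.1, by rw [← (hq _ _).2 hr]; exact hi.2⟩)
    refine le_trans (le_of_eq ?_) this.le
    have hsd : XS K a \ S = (XS K a).filter fun i => s (q i) = false := by
      rw [hS]; ext i; simp only [Finset.mem_sdiff, Finset.mem_filter]
      cases h : s (q i) <;> simp
    rw [hsd, hS, Finset.sum_filter]
    apply Finset.sum_congr rfl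
    intro i _
    by_cases h : s (q i) = true
    · simp only [h, true_and, if_true]
      rw [Finset.sum_filter]
      exact Finset.sum_congr rfl fun j _ => by split_ifs <;> simp
    · simp [h]
  rw [Ex_sum] at h1
  simp_rw [Ex_sum] at h1
  have h2 : ∑ i ∈ XS K a, ∑ j ∈ XS K a, (if Rch ω i j then 0 else p s(i, j)) =
      4 * ∑ i ∈ XS K a, ∑ j ∈ XS K a, Ex P (fun s =>
        p s(i, j) * (if (s (q i) = true ∧ s (q j) = false) then 1 else 0)) := by
    rw [Finset.mul_sum]
    refine Finset.sum_congr rfl fun i _ => ?_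
    rw [Finset.mul_sum]
    refine Finset.sum_congr rfl fun j _ => ?_
    by_cases h : Rch ω i j
    · have h' := (hq i j).2 h
      rw [if_pos h]
      have : (fun s : (graphOf ω).ConnectedComponent → Bool =>
        p s(i, j) * (if (s (q i) = true ∧ s (q j) = false) then (1:ℝ) else 0)) = fun _ => 0 := by
        funext s; rw [h']; simp
      rw [this, Ex_const]; simp
    · rw [if_neg h, Ex_mul, half_prob (fun h' => h ((hq i j).1 h'))]; ring
  rw [h2]
  linarith

end sprinkle
end Aux
end Percolation

namespace Percolation
namespace Aux
set_option linter.unusedSectionVars false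
set_option linter.unusedVariables false

section main

def Zf {n : ℕ} (K : ℕ) (p : Sym2 (Fin n) → ℝ) (v : Fin n → ℝ) (ω : Sym2 (Fin n) → Bool) : ℝ :=
  ∑ i, ∑ j, v i * p s(i, j) * ((1 - Xi K ω i) * Xi K ω j)

def Vf {n : ℕ} (K : ℕ) (v : Fin n → ℝ) (ω : Sym2 (Fin n) → Bool) : ℝ := ∑ i, v i * Xi K ω i

lemma EZ_le {n : ℕ} {p : Sym2 (Fin n) → ℝ} {b : ℝ} (hp : Ok p b) {v : Fin n → ℝ}
    (hv0 : ∀ i, 0 ≤ v i) (K : ℕ) : Ex p (Zf K p v) ≤ Ex p (Vf K v) := by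
  classical
  unfold Zf Vf
  rw [Ex_sum, Ex_sum]
  apply Finset.sum_le_sum
  intro i _
  rw [Ex_mul, Ex_sum]
  have h := mul_le_mul_of_nonneg_left (piv_ineq hp.h0 hp.h1 (Nat.le_succ K) i) (hv0 i)
  refine le_trans (le_of_eq ?_) (h.trans (le_of_eq ?_))
  · rw [Finset.mul_sum]
    refine Finset.sum_congr rfl fun j _ => ?_
    rw [Ex_mul, Pr_eq, mul_assoc]
    congr 3
    funext ω
    unfold Xi
    by_cases hi : X K ω i
    · simp [hi]
    · by_cases hj : X K ω j
      · have : ¬ Rch ω i j := fun h => hi (X_rch h.symm hj)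
        simp [hi, hj, this]
      · simp [hi, hj]
  · rw [Pr_eq]; rfl

lemma diff_bound {n : ℕ} (hn : 0 < n) {p : Sym2 (Fin n) → ℝ} {b : ℝ} (hp : Ok p b)
    {v : Fin n → ℝ} {M θ : ℝ} (hθ : 0 ≤ θ) (hM : 0 ≤ M)
    (hv0 : ∀ i, 0 ≤ v i) (hvM : ∀ i, v i ≤ M) (K : ℕ) (ω e) :
    |(Zf K p v (Function.update ω e true) - (1 + θ) * Vf K v (Function.update ω e true)) -
      (Zf K p v (Function.update ω e false) - (1 + θ) * Vf K v (Function.update ω e false))| ≤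
      (2 * b + 1 + θ) * M * (2 * K) := by
  set ω1 := Function.update ω e true
  set ω0 := Function.update ω e false
  set d : Fin n → ℝ := fun k => |Xi K ω1 k - Xi K ω0 k| with hd
  have hdn : ∀ k, 0 ≤ d k := fun k => abs_nonneg _
  have hds : ∑ k, d k ≤ 2 * K := Xi_diff K ω e
  have hb : 0 ≤ b := le_trans (Finset.sum_nonneg fun j _ => hp.h0 _) (hp.row hn ⟨0, hn⟩)
  have hV : |Vf K v ω1 - Vf K v ω0| ≤ M * (2 * K) := by
    unfold Vf
    rw [← Finset.sum_sub_distrib]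
    refine (Finset.abs_sum_le_sum_abs _ _).trans ?_
    refine le_trans ?_ (mul_le_mul_of_nonneg_left hds hM)
    rw [Finset.mul_sum]
    apply Finset.sum_le_sum
    intro j _
    rw [← mul_sub, abs_mul, abs_of_nonneg (hv0 j)]
    exact mul_le_mul_of_nonneg_right (hvM j) (abs_nonneg _)
  have hZ : |Zf K p v ω1 - Zf K p v ω0| ≤ 2 * b * M * (2 * K) := by
    have h1 : |Zf K p v ω1 - Zf K p v ω0| ≤ ∑ i, ∑ j, M * p s(i, j) * (d i + d j) := by
      unfold Zf
      rw [← Finset.sum_sub_distrib]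
      refine (Finset.abs_sum_le_sum_abs _ _).trans (Finset.sum_le_sum fun i _ => ?_)
      rw [← Finset.sum_sub_distrib]
      refine (Finset.abs_sum_le_sum_abs _ _).trans (Finset.sum_le_sum fun j _ => ?_)
      rw [← mul_sub, abs_mul, abs_of_nonneg (mul_nonneg (hv0 i) (hp.h0 _))]
      apply mul_le_mul (mul_le_mul_of_nonneg_right (hvM i) (hp.h0 _)) _ (abs_nonneg _)
        (mul_nonneg hM (hp.h0 _))
      have e1 : (1 - Xi K ω1 i) * Xi K ω1 j - (1 - Xi K ω0 i) * Xi K ω0 j =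
        (1 - Xi K ω1 i) * (Xi K ω1 j - Xi K ω0 j) - Xi K ω0 j * (Xi K ω1 i - Xi K ω0 i) := by
        ring
      rw [e1]
      refine (abs_sub _ _).trans ?_
      rw [abs_mul, abs_mul]
      have a1 : |1 - Xi K ω1 i| ≤ 1 := by
        rw [abs_le]; constructor <;> linarith [Xi_nonneg K ω1 i, Xi_le_one K ω1 i]
      have a2 : |Xi K ω0 j| ≤ 1 := by
        rw [abs_le]; constructor <;> linarith [Xi_nonneg K ω0 j, Xi_le_one K ω0 j]
      have b1 := mul_le_mul_of_nonneg_right a1 (hdn j)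
      have b2 := mul_le_mul_of_nonneg_right a2 (hdn i)
      simp only [hd] at b1 b2 ⊢
      linarith
    refine h1.trans ?_
    have h2 : ∑ i, ∑ j, M * p s(i, j) * (d i + d j) =
        2 * (M * ∑ i, d i * ∑ j, p s(i, j)) := by
      have e1 : ∑ i, ∑ j, M * p s(i, j) * (d i + d j) =
        ∑ i, ∑ j, M * p s(i, j) * d i + ∑ i, ∑ j, M * p s(i, j) * d j := by
        rw [← Finset.sum_add_distrib]
        refine Finset.sum_congr rfl fun i _ => ?_
        rw [← Finset.sum_add_distrib]
        exact Finset.sum_congr rfl fun j _ => by ring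
      have e2 : ∑ i, ∑ j, M * p s(i, j) * d j = ∑ i, ∑ j, M * p s(i, j) * d i := by
        rw [Finset.sum_comm]
        refine Finset.sum_congr rfl fun i _ => Finset.sum_congr rfl fun j _ => ?_
        rw [Sym2.eq_swap]
      rw [e1, e2, two_mul, Finset.mul_sum]
      have : ∀ i, ∑ j, M * p s(i, j) * d i = M * (d i * ∑ j, p s(i, j)) := by
        intro i
        rw [Finset.mul_sum, Finset.mul_sum]
        exact Finset.sum_congr rfl fun j _ => by ring
      simp_rw [this]
    rw [h2]
    have h3 : ∑ i, d i * ∑ j, p s(i, j) ≤ (2 * K) * b := by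
      refine le_trans (Finset.sum_le_sum fun i _ =>
        mul_le_mul_of_nonneg_left (hp.row hn i) (hdn i)) ?_
      rw [← Finset.sum_mul]
      exact mul_le_mul_of_nonneg_right hds hb
    have := mul_le_mul_of_nonneg_left h3 hM
    linarith
  have e : (Zf K p v ω1 - (1 + θ) * Vf K v ω1) - (Zf K p v ω0 - (1 + θ) * Vf K v ω0) =
    (Zf K p v ω1 - Zf K p v ω0) - (1 + θ) * (Vf K v ω1 - Vf K v ω0) := by ring
  rw [e]
  refine (abs_sub _ _).trans ?_
  rw [abs_mul, abs_of_nonneg (by linarith : 0 ≤ 1 + θ)]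
  have := mul_le_mul_of_nonneg_left hV (by linarith : 0 ≤ 1 + θ)
  linarith

lemma det_bound {n : ℕ} (hn : 0 < n) {p : Sym2 (Fin n) → ℝ} {b : ℝ} (hb : 0 < b) (hp : Ok p b)
    {v : Fin n → ℝ} {M θ μ α t : ℝ} (hM : 0 ≤ M)
    (hv0 : ∀ i, 0 ≤ v i) (hvM : ∀ i, v i ≤ M) (hv : ∀ i, μ * v i ≤ ∑ j, p s(i, j) * v j)
    (hα : b * α + 1 + θ ≤ μ) (K : ℕ) (a c : Sym2 (Fin n) → Bool) (hg : Good K p t a c)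
    (hC : (C1 (graphOf fun e => a e || c e) : ℝ) < α * n) :
    - (4 * M * t) ≤ Zf K p v a - (1 + θ) * Vf K v a := by
  classical
  have hnR : (0:ℝ) < n := by exact_mod_cast hn
  set ω : Sym2 (Fin n) → Bool := fun e => a e || c e with hω
  have h1 : Zf K p v a = ∑ j, Xi K a j * (∑ i, p s(j, i) * v i) -
      ∑ i, ∑ j, v i * p s(i, j) * (Xi K a i * Xi K a j) := by
    have e1 : ∑ j, Xi K a j * (∑ i, p s(j, i) * v i) =
        ∑ i, ∑ j, v i * p s(i, j) * Xi K a j := by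
      rw [Finset.sum_comm]
      refine Finset.sum_congr rfl fun i _ => ?_
      rw [Finset.mul_sum]
      refine Finset.sum_congr rfl fun j _ => ?_
      rw [Sym2.eq_swap]; ring
    rw [e1, ← Finset.sum_sub_distrib]
    unfold Zf
    refine Finset.sum_congr rfl fun i _ => ?_
    rw [← Finset.sum_sub_distrib]
    exact Finset.sum_congr rfl fun j _ => by ring
  have h2 : μ * Vf K v a ≤ ∑ j, Xi K a j * (∑ i, p s(j, i) * v i) := by
    unfold Vf
    rw [Finset.mul_sum]
    refine Finset.sum_le_sum fun j _ => ?_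
    have := mul_le_mul_of_nonneg_left (hv j) (Xi_nonneg K a j)
    linarith
  have h3 : ∑ i, ∑ j, v i * p s(i, j) * (Xi K a i * Xi K a j) ≤
      ∑ i, ∑ j, ((v i * Xi K a i * (b / n)) * (if Rch ω i j then 1 else 0) +
        M * (Xi K a i * (Xi K a j * (if Rch ω i j then 0 else p s(i, j))))) := by
    refine Finset.sum_le_sum fun i _ => Finset.sum_le_sum fun j _ => ?_
    have x0 := Xi_nonneg K a i
    have y0 := Xi_nonneg K a j
    have y1 := Xi_le_one K a j
    by_cases hR : Rch ω i j
    · simp only [hR, if_true, mul_zero, add_zero, mul_one]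
      have q1 := mul_le_mul_of_nonneg_left (hp.hb i j) (mul_nonneg (hv0 i) x0)
      have q2 := mul_le_mul_of_nonneg_left y1
        (mul_nonneg (mul_nonneg (hv0 i) x0) (hp.h0 s(i, j)))
      linarith
    · simp only [hR, if_false, mul_zero, zero_add]
      have := mul_le_mul_of_nonneg_right (hvM i)
        (mul_nonneg (mul_nonneg x0 y0) (hp.h0 s(i, j)))
      linarith
  have h4 : ∑ i, ∑ j, ((v i * Xi K a i * (b / n)) * (if Rch ω i j then 1 else 0)) ≤
      b * α * Vf K v a := by
    unfold Vf
    rw [Finset.mul_sum]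
    refine Finset.sum_le_sum fun i _ => ?_
    rw [← Finset.mul_sum, Finset.sum_boole]
    have e1 : (Finset.univ.filter fun j => Rch ω i j).card = compSize (graphOf ω) i := by
      rw [compSize_eq, ← Set.ncard_coe_finset]
      congr 1; ext k; simp
    rw [e1]
    have e2 : compSize (graphOf ω) i ≤ C1 (graphOf ω) :=
      Finset.le_sup (f := fun v => compSize (graphOf ω) v) (Finset.mem_univ i)
    have e3 : (compSize (graphOf ω) i : ℝ) ≤ α * n :=
      le_trans (by exact_mod_cast e2) hC.le
    have e4 := mul_le_mul_of_nonneg_left e3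
      (mul_nonneg (mul_nonneg (hv0 i) (Xi_nonneg K a i)) (by positivity : 0 ≤ b / n))
    refine e4.trans (le_of_eq ?_)
    field_simp
  have h5 : ∑ i, ∑ j, M * (Xi K a i * (Xi K a j * (if Rch ω i j then 0 else p s(i, j)))) ≤
      M * (4 * t) := by
    refine le_trans (le_of_eq ?_) (mul_le_mul_of_nonneg_left (cross_bound hg) hM)
    rw [Finset.mul_sum]
    unfold XS
    rw [Finset.sum_filter]
    refine Finset.sum_congr rfl fun i _ => ?_
    unfold Xi
    by_cases hi : X K a i
    · simp only [hi, if_true, Finset.sum_filter, Finset.mul_sum]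
      refine Finset.sum_congr rfl fun j _ => ?_
      by_cases hj : X K a j <;> simp [hi, hj, hω]
    · simp [hi]
  simp_rw [Finset.sum_add_distrib] at h3
  have hV0 : 0 ≤ Vf K v a := Finset.sum_nonneg fun i _ => mul_nonneg (hv0 i) (Xi_nonneg K a i)
  have h6 := mul_le_mul_of_nonneg_right hα hV0
  rw [h1]
  linarith

set_option maxHeartbeats 1000000 in
/-- The finite main statement. -/
lemma finite_main {b M μ θ τ α : ℝ} (hb : 0 < b) (hM : 0 < M) (hμ : 1 < μ) (hθ : 0 < θ)
    (hτ : 0 < τ) (hα : b * α + 1 + θ ≤ μ) (η : ℝ) (hη : 0 < η) :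
    ∃ N : ℕ, ∀ n : ℕ, N ≤ n → ∀ (p p1 p2 : Sym2 (Fin n) → ℝ) (v : Fin n → ℝ),
      Ok p1 b → (∀ e, 0 ≤ p2 e) → (∀ e, p2 e ≤ 1) → (∀ e, τ * p1 e ≤ p2 e) →
      (∀ e, 1 - p e = (1 - p1 e) * (1 - p2 e)) →
      (∀ i, 0 ≤ v i) → (∀ i, v i ≤ M) → (∀ i, μ * v i ≤ ∑ j, p1 s(i, j) * v j) →
      (∑ i, v i ^ 2 = n) →
      Pr p (fun ω => (C1 (graphOf ω) : ℝ) < α * n) ≤ η := by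
  classical
  set ε : ℝ := (1 - 1 / μ) / M with hε
  have hμ0 : 0 < μ := by linarith
  have hεM : ε * M = 1 - 1 / μ := by rw [hε]; field_simp
  have hμ1 : 1 / μ < 1 := by rw [div_lt_one hμ0]; exact hμ
  have hε0 : 0 < ε := div_pos (by linarith) hM
  have hinv : 0 < 1 / μ := by positivity
  have c1 : ε * M ≤ 1 := by rw [hεM]; linarith
  have c2 : 1 ≤ μ * (1 - ε * M) := by
    rw [hεM]; have : μ * (1 - (1 - 1 / μ)) = 1 := by field_simp; ring
    rw [this]
  set κ : ℝ := ε / 2 with hκ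
  have hκ0 : 0 < κ := by positivity
  set δ : ℝ := θ * κ / (8 * M) with hδ
  have hδ0 : 0 < δ := by positivity
  obtain ⟨K0, hK0⟩ := exists_nat_ge (2 * Real.log 2 / (τ * δ))
  set K : ℕ := K0 + 1 with hK
  obtain ⟨N1, hN1⟩ := survival_bound hb hM hμ0 hε0 c1 c2 K0 (ε / (2 * M)) (by positivity)
  set D : ℝ := (2 * b + 1 + θ) * M * (2 * K) with hD
  have hD0 : 0 ≤ D := by positivity
  obtain ⟨N2, hN2⟩ := exists_nat_ge (2 * (D ^ 2 * b) / ((θ * κ / 2) ^ 2 * η))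
  have htend : Tendsto (fun n : ℕ => Real.exp (-(τ * δ / 2 * n))) atTop (nhds 0) := by
    apply Real.tendsto_exp_neg_atTop_nhds_zero.comp
    exact Tendsto.const_mul_atTop (by positivity) tendsto_natCast_atTop_atTop
  obtain ⟨N3, hN3⟩ := eventually_atTop.1 (htend.eventually (gt_mem_nhds (half_pos hη)))
  refine ⟨N1 + N2 + N3 + 1, fun n hn p p1 p2 v hp h20 h21 h12 hpp hv0 hvM hv hvn => ?_⟩
  have hn0 : 0 < n := by omega
  have hnR : (0:ℝ) < n := by exact_mod_cast hn0
  have hsurv := hN1 n (by omega) p1 v hp hv0 hvM hv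
  set F : (Sym2 (Fin n) → Bool) → ℝ := fun a => Zf K p1 v a - (1 + θ) * Vf K v a with hF
  -- expectation of Vf
  have hEV : κ * n ≤ Ex p1 (Vf K v) := by
    have e1 : Ex p1 (Vf K v) = ∑ i, v i * Pr p1 (fun ω => X K ω i) := by
      unfold Vf
      rw [Ex_sum]
      refine Finset.sum_congr rfl fun i _ => ?_
      rw [Ex_mul, Pr_eq]; rfl
    rw [e1]
    have e2 : ∑ i, v i * (ε * v i - ε / (2 * M)) ≤ ∑ i, v i * Pr p1 (fun ω => X K ω i) :=
      Finset.sum_le_sum fun i _ => mul_le_mul_of_nonneg_left (hsurv i) (hv0 i)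
    have e3 : ∑ i, v i * (ε * v i - ε / (2 * M)) = ε * n - ε / (2 * M) * ∑ i, v i := by
      rw [← hvn, Finset.mul_sum, Finset.mul_sum, ← Finset.sum_sub_distrib]
      exact Finset.sum_congr rfl fun i _ => by ring
    have e4 : ∑ i, v i ≤ n * M := by
      refine (Finset.sum_le_sum fun i _ => hvM i).trans ?_
      simp
    have e5 := mul_le_mul_of_nonneg_left e4 (by positivity : 0 ≤ ε / (2 * M))
    have e6 : ε / (2 * M) * (n * M) = κ * n := by rw [hκ]; field_simp
    have e7 : ε * n = κ * n + κ * n := by rw [hκ]; ring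
    linarith
  have hEF : Ex p1 F ≤ -(θ * κ * n) := by
    rw [hF, Ex_sub, Ex_mul]
    have := EZ_le hp hv0 K
    have h2 := mul_le_mul_of_nonneg_left hEV hθ.le
    linarith
  have hvar : Ex p1 (fun ω => (F ω - Ex p1 F) ^ 2) ≤ D ^ 2 * (b * n) := by
    refine (variance_bound hp.h0 hp.h1 hD0 F ?_).trans
      (mul_le_mul_of_nonneg_left (hp.tot hn0) (by positivity))
    intro ω e
    exact diff_bound hn0 hp hθ.le hM.le hv0 hvM K ω e
  have hcheb := chebyshev hp.h0 hp.h1 F (t := θ * κ / 2 * n) (by positivity) hvar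
  have hcheb2 : D ^ 2 * (b * n) / (θ * κ / 2 * n) ^ 2 ≤ η / 2 := by
    have h1 : 2 * (D ^ 2 * b) / ((θ * κ / 2) ^ 2 * η) ≤ n :=
      hN2.trans (by exact_mod_cast (by omega : N2 ≤ n))
    rw [div_le_iff₀ (by positivity)] at h1
    rw [div_le_iff₀ (by positivity)]
    have h2 := mul_le_mul_of_nonneg_right h1 hnR.le
    have e1 : n * ((θ * κ / 2) ^ 2 * η) * n = 2 * (η / 2 * (θ * κ / 2 * n) ^ 2) := by ring
    have e2 : 2 * (D ^ 2 * b) * n = 2 * (D ^ 2 * (b * n)) := by ring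
    rw [e1, e2] at h2
    linarith
  have hgood : ∀ a, Pr p2 (fun c => ¬ Good K p1 (δ * n) a c) ≤ η / 2 := by
    intro a
    refine (good_prob h20 h21 hτ.le h12 K (Nat.succ_pos _) a).trans ?_
    refine le_trans ?_ (hN3 n (by omega)).le
    have g1 : (2:ℝ) ^ (Fintype.card (Fin n) / K) ≤ Real.exp (τ * δ / 2 * n) := by
      rw [Fintype.card_fin]
      have : (2:ℝ) ^ (n / K) = Real.exp (Real.log 2 * (n / K : ℕ)) := by
        rw [← Real.rpow_natCast, Real.rpow_def_of_pos (by norm_num)]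
      rw [this, Real.exp_le_exp]
      have h1 : ((n / K : ℕ) : ℝ) ≤ n / K := Nat.cast_div_le
      have hlog : 0 < Real.log 2 := Real.log_pos (by norm_num)
      refine (mul_le_mul_of_nonneg_left h1 hlog.le).trans ?_
      have hKR : (0:ℝ) < K := by positivity
      have h2 : 2 * Real.log 2 / (τ * δ) ≤ K := hK0.trans (by rw [hK]; push_cast; linarith)
      rw [div_le_iff₀ (by positivity)] at h2
      rw [mul_div_assoc', div_le_iff₀ hKR]
      have h3 := mul_le_mul_of_nonneg_right h2 hnR.le
      have e1 : (K : ℝ) * (τ * δ) * n = 2 * (τ * δ / 2 * n * K) := by ring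
      rw [e1] at h3
      linarith
    refine (mul_le_mul_of_nonneg_right g1 (Real.exp_pos _).le).trans ?_
    rw [← Real.exp_add, Real.exp_le_exp]
    apply le_of_eq; ring
  have hfin : Pr p (fun ω => (C1 (graphOf ω) : ℝ) < α * n) ≤
      Pr p1 (fun a => θ * κ / 2 * n ≤ F a - Ex p1 F) + η / 2 := by
    rw [Pr_eq, coupling p p1 p2 hpp, Pr_eq, ← Ex_const p1 (η / 2), ← Ex_add]
    apply Ex_mono hp.h0 hp.h1
    intro a
    by_cases ha : θ * κ / 2 * n ≤ F a - Ex p1 F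
    · rw [if_pos ha]
      have := Pr_le_one h20 h21 (fun c => (C1 (graphOf fun e => a e || c e) : ℝ) < α * n)
      rw [Pr_eq] at this
      linarith
    · rw [if_neg ha, zero_add]
      refine le_trans ?_ (hgood a)
      have := Pr_mono h20 h21 (S := fun c => (C1 (graphOf fun e => a e || c e) : ℝ) < α * n)
        (T := fun c => ¬ Good K p1 (δ * n) a c) ?_
      · rwa [Pr_eq] at this
      · intro c hC hg
        apply ha
        have hd := det_bound hn0 hb hp hM.le hv0 hvM hv hα K a c hg hC
        have e1 : 4 * M * (δ * n) = θ * κ / 2 * n := by rw [hδ]; field_simp; ring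
        have : F a = Zf K p1 v a - (1 + θ) * Vf K v a := rfl
        rw [e1, ← this] at hd
        linarith
  linarith

end main
end Aux
end Percolation

namespace Percolation
namespace Aux
set_option linter.unusedSectionVars false
set_option linter.unusedVariables false

section spectral

def opA {n : ℕ} (A : Fin n → Fin n → ℝ) (g : Fin n → ℝ) : Fin n → ℝ := fun i => ∑ j, A i j * g j

lemma opA_self {n : ℕ} {A : Fin n → Fin n → ℝ} (hs : ∀ i j, A i j = A j i) (f g : Fin n → ℝ) :
    ∑ i, f i * opA A g i = ∑ i, opA A f i * g i := by
  unfold opA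
  simp_rw [Finset.mul_sum, Finset.sum_mul]
  rw [Finset.sum_comm]
  refine Finset.sum_congr rfl fun i _ => Finset.sum_congr rfl fun j _ => ?_
  rw [hs j i]; ring

lemma exists_eig {n : ℕ} {A : Fin n → Fin n → ℝ} (hs : ∀ i j, A i j = A j i) {m : ℕ} {r : ℝ}
    (hr : 0 ≤ r) (h : r ^ m * n < ∑ i, (opA A)^[m] (fun _ => 1) i) :
    ∃ (lam : ℝ) (w : Fin n → ℝ), r ≤ |lam| ∧ ∑ i, w i ^ 2 = 1 ∧ ∀ i, opA A w i = lam * w i := by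
  have hA : (Matrix.of A).IsHermitian := by
    ext i j; simp [Matrix.conjTranspose, hs j i]
  set E := hA.eigenvectorBasis with hE
  have heig : ∀ k i, opA A (E k) i = hA.eigenvalues k * E k i := by
    intro k i
    have := congrFun (hA.mulVec_eigenvectorBasis k) i
    simpa [Matrix.mulVec, dotProduct, opA] using this
  have hnorm : ∀ k, ∑ i, E k i ^ 2 = 1 := by
    intro k
    have h1 := E.orthonormal.1 k
    have h2 := EuclideanSpace.real_norm_sq_eq (E k)
    rw [h1] at h2
    linarith
  by_contra hcon
  push Not at hcon
  have hl : ∀ k, |hA.eigenvalues k| ≤ r := by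
    intro k
    by_contra hk
    obtain ⟨i, hi⟩ := hcon (hA.eigenvalues k) (E k) (not_le.1 hk).le (hnorm k)
    exact hi (heig k i)
  have hit : ∀ k (j : ℕ), ∑ i, E k i * (opA A)^[j] (fun _ => 1) i =
      hA.eigenvalues k ^ j * ∑ i, E k i := by
    intro k j
    induction j with
    | zero => simp
    | succ j ih =>
      rw [Function.iterate_succ_apply', opA_self hs]
      simp_rw [heig, mul_assoc]
      rw [← Finset.mul_sum, ih]; ring
  have hpars : ∀ x y : Fin n → ℝ, ∑ k, (∑ i, E k i * x i) * (∑ i, E k i * y i) = ∑ i, x i * y i := by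
    intro x y
    have := E.sum_inner_mul_inner (WithLp.toLp 2 x) (WithLp.toLp 2 y)
    simp only [PiLp.inner_apply, RCLike.inner_apply, conj_trivial] at this
    rw [← (by simpa [mul_comm] using this :
      ∑ k, (∑ i, E k i * x i) * (∑ i, y i * E k i) = ∑ i, x i * y i)]
    simp [mul_comm]
  have h1 := hpars (fun _ => 1) ((opA A)^[m] fun _ => 1)
  have h2 := hpars (fun _ => 1) (fun _ => 1)
  simp only [mul_one, one_mul, hit] at h1 h2
  rw [← h1] at h
  have h3 : ∑ k, (∑ i, E k i) * (hA.eigenvalues k ^ m * ∑ i, E k i) ≤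
      ∑ k, r ^ m * ((∑ i, E k i) * ∑ i, E k i) := by
    refine Finset.sum_le_sum fun k _ => ?_
    have e1 : hA.eigenvalues k ^ m ≤ r ^ m :=
      (le_abs_self _).trans (by rw [abs_pow]; exact pow_le_pow_left₀ (abs_nonneg _) (hl k) m)
    have e2 := mul_le_mul_of_nonneg_right e1 (mul_self_nonneg (∑ i, E k i))
    linarith
  rw [← Finset.mul_sum, h2] at h3
  simp at h3
  linarith

lemma exists_vec {n : ℕ} {A : Fin n → Fin n → ℝ} (hs : ∀ i j, A i j = A j i)
    (h0 : ∀ i j, 0 ≤ A i j) {B : ℝ} (hB : ∀ i j, A i j ≤ B) {m : ℕ} {l : ℝ} (hl : 0 < l)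
    (h : l ^ m < (∑ i, (opA A)^[m] (fun _ => 1) i) / (n : ℝ) ^ (m + 1)) :
    0 < B ∧ ∃ v : Fin n → ℝ, (∀ i, 0 ≤ v i) ∧ (∀ i, v i ≤ B / l) ∧ (∑ i, v i ^ 2 = n) ∧
      ∀ i, l * n * v i ≤ ∑ j, A i j * v j := by
  rcases Nat.eq_zero_or_pos n with rfl | hn
  · simp at h
    exact absurd h (not_lt.2 (by positivity))
  have hnR : (0:ℝ) < n := by exact_mod_cast hn
  rw [lt_div_iff₀ (by positivity)] at h
  obtain ⟨lam, w, h1, h2, h3⟩ := exists_eig (m := m) (r := l * n) hs (by positivity)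
    (by rw [mul_pow]; rw [pow_succ] at h; linarith)
  set s := Real.sqrt n with hsq
  have hs0 : 0 < s := Real.sqrt_pos.2 hnR
  have hss : s ^ 2 = n := Real.sq_sqrt hnR.le
  have hkey : ∀ i, l * n * |w i| ≤ ∑ j, A i j * |w j| := by
    intro i
    calc l * n * |w i| ≤ |lam| * |w i| := mul_le_mul_of_nonneg_right h1 (abs_nonneg _)
      _ = |∑ j, A i j * w j| := by rw [← abs_mul, ← h3 i]; rfl
      _ ≤ ∑ j, |A i j * w j| := Finset.abs_sum_le_sum_abs _ _
      _ = _ := Finset.sum_congr rfl fun j _ => by rw [abs_mul, abs_of_nonneg (h0 i j)]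
  have hsumw : ∑ j, |w j| ≤ s := by
    apply Real.le_sqrt_of_sq_le
    have := sq_sum_le_card_mul_sum_sq (s := Finset.univ) (f := fun j => |w j|)
    simpa [sq_abs, h2] using this
  have hB0 : 0 ≤ B := (h0 ⟨0, hn⟩ ⟨0, hn⟩).trans (hB _ _)
  have hsup : ∀ i, l * n * |w i| ≤ B * s := by
    intro i
    refine (hkey i).trans ((Finset.sum_le_sum fun j _ =>
      mul_le_mul_of_nonneg_right (hB i j) (abs_nonneg _)).trans ?_)
    rw [← Finset.mul_sum]
    exact mul_le_mul_of_nonneg_left hsumw hB0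
  refine ⟨?_, fun i => s * |w i|, fun i => by positivity, fun i => ?_, ?_, fun i => ?_⟩
  · rcases hB0.eq_or_lt with hB0 | hB0
    · exfalso
      have : ∀ i, w i = 0 := by
        intro i
        have := hsup i
        rw [← hB0, zero_mul] at this
        by_contra hw
        have h4 : 0 < l * n * |w i| := by positivity
        linarith
      simp [this] at h2
    · exact hB0
  · rw [le_div_iff₀ hl]
    have := mul_le_mul_of_nonneg_left (hsup i) hs0.le
    have e : s * (B * s) = B * n := by rw [← hss]; ring
    rw [e] at this
    have e2 : s * (l * n * |w i|) = (s * |w i| * l) * n := by ring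
    rw [e2] at this
    exact le_of_mul_le_mul_right this hnR
  · simp_rw [mul_pow, sq_abs]
    rw [← Finset.mul_sum, h2, hss, mul_one]
  · have := mul_le_mul_of_nonneg_left (hkey i) hs0.le
    rw [Finset.mul_sum] at this
    calc _ = s * (l * n * |w i|) := by ring
      _ ≤ _ := this
      _ = _ := Finset.sum_congr rfl fun j _ => by ring

end spectral
end Aux
end Percolation

namespace Percolation
namespace Aux
set_option linter.unusedSectionVars false
set_option linter.unusedVariables false

section analysis

/-- uniform measure -/
abbrev nu : Measure ℝ := volume.restrict I01

instance : IsProbabilityMeasure nu := ⟨by simp [nu, I01]⟩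

lemma memLp_bdd {f : ℝ → ℝ} (hf : Measurable f) {C : ℝ} (hC : ∀ x, |f x| ≤ C) : MemLp f 2 nu :=
  MemLp.of_bound hf.aestronglyMeasurable C (Eventually.of_forall hC)

lemma applyT_meas {W : ℝ → ℝ → ℝ} (hW : Measurable (Function.uncurry W)) {f : ℝ → ℝ}
    (hf : Measurable f) : Measurable (applyT W f) := by
  have : Measurable (Function.uncurry fun x y => W x y * f y) :=
    hW.mul (hf.comp measurable_snd)
  exact (this.stronglyMeasurable.integral_prod_right (ν := nu)).measurable

lemma int_W {W : ℝ → ℝ → ℝ} (hW : Measurable (Function.uncurry W)) {M : ℝ}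
    (h0 : ∀ x y, 0 ≤ W x y) (hM : ∀ x y, W x y ≤ M) {f : ℝ → ℝ} (hf : MemLp f 2 nu) (x : ℝ) :
    Integrable (fun y => W x y * f y) nu := by
  refine (hf.integrable (by norm_num)).bdd_mul (c := M)
    (hW.of_uncurry_left).aestronglyMeasurable (Eventually.of_forall fun y => ?_)
  rw [Real.norm_of_nonneg (h0 x y)]; exact hM x y

lemma applyT_bdd {W : ℝ → ℝ → ℝ} (hW : Measurable (Function.uncurry W)) {M : ℝ}
    (h0 : ∀ x y, 0 ≤ W x y) (hM : ∀ x y, W x y ≤ M) {f : ℝ → ℝ} (hf : MemLp f 2 nu) (x : ℝ) :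
    |applyT W f x| ≤ M * ∫ y, |f y| ∂nu := by
  unfold applyT
  refine (abs_integral_le_integral_abs).trans ?_
  rw [← integral_const_mul]
  refine integral_mono (int_W hW h0 hM hf x).abs ((hf.integrable (by norm_num)).abs.const_mul M) ?_
  intro y
  simp only [abs_mul, abs_of_nonneg (h0 x y)]
  exact mul_le_mul_of_nonneg_right (hM x y) (abs_nonneg _)

lemma applyT_memLp {W : ℝ → ℝ → ℝ} (hW : Measurable (Function.uncurry W)) {M : ℝ}
    (h0 : ∀ x y, 0 ≤ W x y) (hM : ∀ x y, W x y ≤ M) {f : ℝ → ℝ} (hfm : Measurable f)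
    (hf : MemLp f 2 nu) : MemLp (applyT W f) 2 nu :=
  memLp_bdd (applyT_meas hW hfm) (applyT_bdd hW h0 hM hf)

lemma applyT_mono {W : ℝ → ℝ → ℝ} (hW : Measurable (Function.uncurry W)) {M : ℝ}
    (h0 : ∀ x y, 0 ≤ W x y) (hM : ∀ x y, W x y ≤ M) {f g : ℝ → ℝ} (hf : MemLp f 2 nu)
    (hg : MemLp g 2 nu) (hfg : ∀ x, f x ≤ g x) (x : ℝ) : applyT W f x ≤ applyT W g x :=
  integral_mono (int_W hW h0 hM hf x) (int_W hW h0 hM hg x)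
    fun y => mul_le_mul_of_nonneg_left (hfg y) (h0 x y)

lemma applyT_symm {W : ℝ → ℝ → ℝ} (hW : Measurable (Function.uncurry W)) {M : ℝ}
    (h0 : ∀ x y, 0 ≤ W x y) (hs : ∀ x y, W x y = W y x) (hM : ∀ x y, W x y ≤ M) {f g : ℝ → ℝ}
    (hf : MemLp f 2 nu) (hg : MemLp g 2 nu) :
    ∫ x, f x * applyT W g x ∂nu = ∫ x, applyT W f x * g x ∂nu := by
  have hint : Integrable (Function.uncurry fun x y => W x y * (f x * g y)) (nu.prod nu) := by
    have h1 := (hf.integrable (by norm_num)).mul_prod (hg.integrable (by norm_num : (1:ENNReal) ≤ 2))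
    refine h1.bdd_mul (c := M) hW.aestronglyMeasurable (Eventually.of_forall fun y => ?_)
    rw [Real.norm_of_nonneg (h0 _ _)]; exact hM _ _
  have e1 : ∀ x, f x * applyT W g x = ∫ y, W x y * (f x * g y) ∂nu := by
    intro x; unfold applyT; rw [← integral_const_mul]; congr 1; ext y; ring
  have e2 : ∀ y, applyT W f y * g y = ∫ x, W x y * (f x * g y) ∂nu := by
    intro y; unfold applyT; rw [← integral_mul_const]; congr 1; ext x; rw [hs x y]; ring
  simp_rw [e1, e2]
  exact integral_integral_swap hint

lemma iter_meas {W : ℝ → ℝ → ℝ} (hW : Measurable (Function.uncurry W)) {M : ℝ}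
    (h0 : ∀ x y, 0 ≤ W x y) (hM : ∀ x y, W x y ≤ M) {f : ℝ → ℝ} (hfm : Measurable f)
    (hf : MemLp f 2 nu) (k : ℕ) :
    Measurable ((applyT W)^[k] f) ∧ MemLp ((applyT W)^[k] f) 2 nu := by
  induction k with
  | zero => exact ⟨hfm, hf⟩
  | succ k ih =>
    rw [Function.iterate_succ_apply']
    exact ⟨applyT_meas hW ih.1, applyT_memLp hW h0 hM ih.1 ih.2⟩

lemma iter_symm {W : ℝ → ℝ → ℝ} (hW : Measurable (Function.uncurry W)) {M : ℝ}
    (h0 : ∀ x y, 0 ≤ W x y) (hs : ∀ x y, W x y = W y x) (hM : ∀ x y, W x y ≤ M) {f g : ℝ → ℝ}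
    (hfm : Measurable f) (hgm : Measurable g)
    (hf : MemLp f 2 nu) (hg : MemLp g 2 nu) (a b : ℕ) :
    ∫ x, (applyT W)^[a] f x * (applyT W)^[b] g x ∂nu = ∫ x, f x * (applyT W)^[a + b] g x ∂nu := by
  induction a generalizing f with
  | zero => simp
  | succ a ih =>
    rw [Function.iterate_succ_apply, ih (applyT_meas hW hfm) (applyT_memLp hW h0 hM hfm hf),
      ← applyT_symm hW h0 hs hM hf (iter_meas hW h0 hM hgm hg _).2, ← Function.iterate_succ_apply' (applyT W),
      show a + 1 + b = (a + b).succ by omega]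

lemma iter_le {W : ℝ → ℝ → ℝ} (hW : Measurable (Function.uncurry W)) {M : ℝ}
    (h0 : ∀ x y, 0 ≤ W x y) (hM : ∀ x y, W x y ≤ M) {f g : ℝ → ℝ}
    (hfm : Measurable f) (hgm : Measurable g)
    (hf : MemLp f 2 nu) (hg : MemLp g 2 nu) (hfg : ∀ x, f x ≤ g x) (k : ℕ) (x : ℝ) :
    (applyT W)^[k] f x ≤ (applyT W)^[k] g x := by
  induction k generalizing x with
  | zero => exact hfg x
  | succ k ih =>
    rw [Function.iterate_succ_apply', Function.iterate_succ_apply']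
    exact applyT_mono hW h0 hM (iter_meas hW h0 hM hfm hf k).2 (iter_meas hW h0 hM hgm hg k).2 ih x

lemma applyT_zero (W : ℝ → ℝ → ℝ) : applyT W (fun _ => 0) = fun _ => 0 := by
  ext x; simp [applyT]

lemma iter_smul (W : ℝ → ℝ → ℝ) (c : ℝ) (f : ℝ → ℝ) (k : ℕ) :
    (applyT W)^[k] (fun x => c * f x) = fun x => c * (applyT W)^[k] f x := by
  induction k with
  | zero => rfl
  | succ k ih =>
    rw [Function.iterate_succ_apply', Function.iterate_succ_apply', ih]
    ext x
    unfold applyT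
    rw [← integral_const_mul]
    congr 1; ext y; ring

lemma path_lower {W : ℝ → ℝ → ℝ} (hG : IsGraphon W) {r : ℝ} (hr : 0 < r) (hrW : r < opNorm W) :
    ∃ C : ℝ, 0 < C ∧ ∀ k : ℕ,
      r ^ (2 * (k + 1)) ≤ C * ∫ x, (applyT W)^[k + k] (fun _ => 1) x ∂nu := by
  obtain ⟨hW, h0, hs, M', hM'⟩ := hG
  obtain ⟨M, hM1, hM⟩ : ∃ M : ℝ, 1 ≤ M ∧ ∀ x y, W x y ≤ M :=
    ⟨max M' 1, le_max_right _ _, fun x y => (hM' x y).trans (le_max_left _ _)⟩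
  have hne : {r | ∃ f : ℝ → ℝ, Measurable f ∧
    MeasureTheory.IntegrableOn (fun x => f x ^ 2) I01 ∧
    l2norm f ≤ 1 ∧ r = l2norm (applyT W f)}.Nonempty :=
    ⟨_, fun _ => 0, measurable_const, by simp, by simp [l2norm], rfl⟩
  obtain ⟨_, ⟨f, hfm, hfi, hf1, rfl⟩, hlt⟩ := exists_lt_of_lt_csSup hne hrW
  have hfL : MemLp f 2 nu := (memLp_two_iff_integrable_sq hfm.aestronglyMeasurable).2 hfi
  set h : ℝ → ℝ := fun x => |f x| with hh
  have hhm : Measurable h := by measurability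
  have hhL : MemLp h 2 nu := hfL.abs
  set u : ℕ → ℝ := fun k => ∫ x, ((applyT W)^[k] h x) ^ 2 ∂nu with hu
  have hit := iter_meas hW h0 hM hhm hhL
  have hu0 : u 0 ≤ 1 := by
    have : u 0 = ∫ x, f x ^ 2 ∂nu := by simp [hu, hh]
    rw [this]
    have := Real.sqrt_le_iff.1 hf1
    simpa using this.2
  have hu1 : r ^ 2 < u 1 := by
    have h1 : r ^ 2 < ∫ x, (applyT W f x) ^ 2 ∂nu := (Real.lt_sqrt hr.le).1 hlt
    refine h1.trans_le (integral_mono (applyT_memLp hW h0 hM hfm hfL).integrable_sq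
      (hit 1).2.integrable_sq fun x => ?_)
    simp only [Function.iterate_one]
    rw [← sq_abs]
    refine pow_le_pow_left₀ (abs_nonneg _) ?_ 2
    rw [abs_le]
    constructor
    · have := applyT_mono hW h0 hM hfL.neg hhL (fun x => neg_le_abs (f x)) x
      have e : applyT W (-f) x = - applyT W f x := by
        unfold applyT; rw [← integral_neg]; congr 1; ext y; simp
      rw [e] at this; linarith
    · exact applyT_mono hW h0 hM hfL hhL (fun x => le_abs_self (f x)) x
  have hrec : ∀ k, 2 * r ^ 2 * u (k + 1) - r ^ 4 * u k ≤ u (k + 2) := by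
    intro k
    have hp : 0 ≤ ∫ x, (r ^ 2 * (applyT W)^[k] h x - (applyT W)^[k + 2] h x) ^ 2 ∂nu :=
      integral_nonneg fun x => sq_nonneg _
    have e : ∀ x, (r ^ 2 * (applyT W)^[k] h x - (applyT W)^[k + 2] h x) ^ 2 =
        r ^ 4 * ((applyT W)^[k] h x) ^ 2 -
        2 * r ^ 2 * ((applyT W)^[k] h x * (applyT W)^[k + 2] h x) +
        ((applyT W)^[k + 2] h x) ^ 2 := fun x => by ring
    simp_rw [e] at hp
    have i1 := (hit k).2.integrable_sq.const_mul (r ^ 4)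
    have i2 : Integrable (fun x => 2 * r ^ 2 * ((applyT W)^[k] h x * (applyT W)^[k + 2] h x)) nu :=
      ((hit k).2.integrable_mul (hit (k + 2)).2).const_mul (2 * r ^ 2)
    have i3 := (hit (k + 2)).2.integrable_sq
    have i4 : Integrable (fun x => r ^ 4 * ((applyT W)^[k] h x) ^ 2 -
        2 * r ^ 2 * ((applyT W)^[k] h x * (applyT W)^[k + 2] h x)) nu := i1.sub i2
    rw [integral_add i4 i3, integral_sub i1 i2, integral_const_mul,
      integral_const_mul] at hp
    have e2 : ∫ x, (applyT W)^[k] h x * (applyT W)^[k + 2] h x ∂nu = u (k + 1) := by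
      simp only [hu, pow_two]
      rw [iter_symm hW h0 hs hM hhm hhm hhL hhL, iter_symm hW h0 hs hM hhm hhm hhL hhL,
        show k + (k + 2) = k + 1 + (k + 1) by omega]
    rw [e2] at hp
    simp only [hu] at hp ⊢
    linarith
  have hmon : ∀ k, r ^ 2 * u k ≤ u (k + 1) := by
    intro k
    induction k with
    | zero =>
      have := mul_le_mul_of_nonneg_left hu0 (sq_nonneg r)
      simp only [zero_add]; linarith
    | succ k ih =>
      have h1 := hrec k
      have h2 := mul_le_mul_of_nonneg_left ih (sq_nonneg r)
      have e : r ^ 2 * (r ^ 2 * u k) = r ^ 4 * u k := by ring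
      rw [e] at h2
      show _ ≤ u (k + 2)
      linarith
  have hlow : ∀ k, r ^ (2 * (k + 1)) ≤ u (k + 1) := by
    intro k
    induction k with
    | zero => simpa using hu1.le
    | succ k ih =>
      have h2 := mul_le_mul_of_nonneg_left ih (sq_nonneg r)
      have e : r ^ 2 * r ^ (2 * (k + 1)) = r ^ (2 * (k + 1 + 1)) := by ring
      rw [e] at h2
      exact h2.trans (hmon (k + 1))
  refine ⟨M ^ 2, by positivity, fun k => (hlow k).trans ?_⟩
  have h1m : Measurable (fun _ : ℝ => (1:ℝ)) := measurable_const
  have h1L : MemLp (fun _ : ℝ => (1:ℝ)) 2 nu := memLp_const 1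
  have hg : ∀ x, applyT W h x ≤ M * 1 := by
    intro x
    refine (le_abs_self _).trans ((applyT_bdd hW h0 hM hhL x).trans ?_)
    refine mul_le_mul_of_nonneg_left ?_ (by linarith)
    have : ∫ y, |h y| ∂nu ≤ ∫ y, ((h y) ^ 2 + 1) / 2 ∂nu := by
      refine integral_mono (hhL.integrable (by norm_num)).abs
        ((hhL.integrable_sq.add (integrable_const 1)).div_const 2) fun y => ?_
      simp only [hh, abs_abs]
      nlinarith [sq_nonneg (|f y| - 1)]
    refine this.trans ?_
    rw [integral_div, integral_add hhL.integrable_sq (integrable_const 1)]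
    have h3 : ∫ y, h y ^ 2 ∂nu ≤ 1 := hu0
    simp only [integral_const, probReal_univ, smul_eq_mul, mul_one]
    linarith
  have hgL := applyT_memLp hW h0 hM hhm hhL
  have hgm := applyT_meas hW hhm
  have hbd : ∀ x, ((applyT W)^[k + 1] h x) ^ 2 ≤ M ^ 2 * ((applyT W)^[k] (fun _ => 1) x *
      (applyT W)^[k] (fun _ => 1) x) := by
    intro x
    rw [Function.iterate_succ_apply]
    have a1 := iter_le hW h0 hM hgm (h1m.const_mul M) hgL (h1L.const_mul M) hg k x
    rw [iter_smul] at a1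
    have a0 : 0 ≤ (applyT W)^[k] (applyT W h) x := by
      have := iter_le hW h0 hM (measurable_const (a := (0:ℝ))) hgm (memLp_const 0) hgL
        (fun y => integral_nonneg fun z => mul_nonneg (h0 y z) (abs_nonneg _)) k x
      refine le_trans (le_of_eq ?_) this
      have hz : (applyT W)^[k] (fun _ => 0) = fun _ => 0 :=
        Function.iterate_fixed (applyT_zero W) k
      rw [hz]
    calc _ ≤ (M * (applyT W)^[k] (fun _ => 1) x) ^ 2 := pow_le_pow_left₀ a0 a1 2
      _ = _ := by ring
  have hI1 := iter_meas hW h0 hM h1m h1L k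
  calc u (k + 1) ≤ ∫ x, M ^ 2 * ((applyT W)^[k] (fun _ => 1) x *
      (applyT W)^[k] (fun _ => 1) x) ∂nu :=
        integral_mono (hit (k + 1)).2.integrable_sq ((hI1.2.integrable_mul hI1.2).const_mul _) hbd
    _ = _ := by
      rw [integral_const_mul, iter_symm hW h0 hs hM h1m h1m h1L h1L]
      simp

lemma path_big {W : ℝ → ℝ → ℝ} (hG : IsGraphon W) {l : ℝ} (hl : 0 < l) (hlW : l < opNorm W) :
    ∃ m : ℕ, l ^ m < ∫ x, (applyT W)^[m] (fun _ => 1) x ∂nu := by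
  obtain ⟨r, hlr, hrW⟩ := exists_between hlW
  have hr : 0 < r := hl.trans hlr
  obtain ⟨C, hC, h⟩ := path_lower hG hr hrW
  have hq : 1 < (r / l) ^ 2 := one_lt_pow₀ ((one_lt_div hl).2 hlr) two_ne_zero
  obtain ⟨k, hk⟩ := pow_unbounded_of_one_lt (C / r ^ 2) hq
  refine ⟨k + k, ?_⟩
  have h1 := h k
  rw [div_lt_iff₀ (by positivity)] at hk
  have h2 : C * l ^ (k + k) < r ^ (2 * (k + 1)) := by
    have := mul_lt_mul_of_pos_right hk (by positivity : 0 < l ^ (k + k))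
    refine this.trans_le (le_of_eq ?_)
    rw [← pow_mul, div_pow, ← two_mul]
    field_simp
    ring
  exact lt_of_mul_lt_mul_left (h2.trans_le h1) hC.le

end analysis
end Aux
end Percolation

namespace Percolation
namespace Aux
set_option linter.unusedSectionVars false
set_option linter.unusedVariables false

section paths

/-- the path with `m` edges -/
def pathG (m : ℕ) : SimpleGraph (Fin (m + 1)) :=
  SimpleGraph.fromEdgeSet (Set.range fun i : Fin m => s(i.castSucc, i.succ))

lemma edgeProd_path (m : ℕ) (f : Fin (m + 1) → Fin (m + 1) → ℝ) (hf : ∀ i j, f i j = f j i) :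
    edgeProd (pathG m) f = ∏ i : Fin m, f i.castSucc i.succ := by
  classical
  unfold edgeProd
  have hset : (pathG m).edgeSet = Set.range fun i : Fin m => s(i.castSucc, i.succ) := by
    unfold pathG
    rw [SimpleGraph.edgeSet_fromEdgeSet]
    ext e
    simp only [Set.mem_sdiff, Set.mem_range]
    constructor
    · rintro ⟨h, _⟩; exact h
    · rintro ⟨i, rfl⟩
      exact ⟨⟨i, rfl⟩, by simp [Fin.ext_iff]⟩
  have hinj : Function.Injective fun i : Fin m => s(i.castSucc, i.succ) := by
    intro i j hij
    simp only [Sym2.eq_iff, Fin.ext_iff, Fin.val_castSucc, Fin.val_succ] at hij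
    ext; omega
  have hfin : (pathG m).edgeFinset = Finset.univ.image fun i : Fin m => s(i.castSucc, i.succ) := by
    ext e
    rw [SimpleGraph.mem_edgeFinset, hset]; simp
  have : ∀ (inst : Fintype (pathG m).edgeSet), ∏ e ∈ @SimpleGraph.edgeFinset _ (pathG m) inst,
      sym2Val f e = ∏ i : Fin m, f i.castSucc i.succ := by
    intro inst
    have : @SimpleGraph.edgeFinset _ (pathG m) inst =
      Finset.univ.image fun i : Fin m => s(i.castSucc, i.succ) := by
      rw [← hfin]; congr!
    rw [this, Finset.prod_image (fun a _ b _ h => hinj h)]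
    refine Finset.prod_congr rfl fun i _ => ?_
    simp [sym2Val, hf i.succ i.castSucc]
  exact this _

lemma sum_path {n : ℕ} (A : Fin n → Fin n → ℝ) (hs : ∀ i j, A i j = A j i) (m : ℕ)
    (g : Fin n → ℝ) :
    ∑ v : Fin (m + 1) → Fin n, g (v 0) * ∏ i : Fin m, A (v i.castSucc) (v i.succ) =
      ∑ i, (opA A)^[m] g i := by
  induction m generalizing g with
  | zero =>
    simp only [Finset.univ_eq_empty, Finset.prod_empty, mul_one, Function.iterate_zero, id]
    exact Fintype.sum_equiv (Equiv.funUnique (Fin 1) (Fin n)) _ _ fun v => rfl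
  | succ m ih =>
    rw [Function.iterate_succ_apply, ← ih (opA A g)]
    rw [← Fintype.sum_equiv (Fin.consEquiv fun _ : Fin (m + 2) => Fin n)
      (fun q : Fin n × (Fin (m + 1) → Fin n) => g q.1 * (A q.1 (q.2 0) *
        ∏ i : Fin m, A (q.2 i.castSucc) (q.2 i.succ))) _ ?_]
    · rw [Fintype.sum_prod_type, Finset.sum_comm]
      refine Finset.sum_congr rfl fun v _ => ?_
      simp only [opA]
      rw [Finset.sum_mul]
      refine Finset.sum_congr rfl fun x _ => ?_
      rw [hs (v 0) x]; ring
    · rintro ⟨x, v⟩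
      rw [Fin.prod_univ_succ]
      simp [Fin.consEquiv, Fin.cons_succ]

lemma homG_path {n : ℕ} (A : Fin n → Fin n → ℝ) (hs : ∀ i j, A i j = A j i) (m : ℕ) :
    homDensityG A (pathG m) = (∑ i, (opA A)^[m] (fun _ => 1) i) / (n : ℝ) ^ (m + 1) := by
  unfold homDensityG
  rw [← sum_path A hs]
  congr 1
  refine Finset.sum_congr rfl fun v _ => ?_
  rw [edgeProd_path m _ fun i j => hs _ _, one_mul]

lemma int_path {W : ℝ → ℝ → ℝ} (hW : Measurable (Function.uncurry W)) {M : ℝ}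
    (h0 : ∀ x y, 0 ≤ W x y) (hs : ∀ x y, W x y = W y x) (hM : ∀ x y, W x y ≤ M)
    (m : ℕ) (g : ℝ → ℝ) (hgm : Measurable g) (C : ℝ) (hC : ∀ x, |g x| ≤ C) :
    ∫ x : Fin (m + 1) → ℝ, g (x 0) * ∏ i : Fin m, W (x i.castSucc) (x i.succ)
      ∂(Measure.pi fun _ => nu) = ∫ x, (applyT W)^[m] g x ∂nu := by
  induction m generalizing g C with
  | zero =>
    simp only [Finset.univ_eq_empty, Finset.prod_empty, mul_one, Function.iterate_zero, id]
    have := measurePreserving_eval (fun _ : Fin 1 => nu) 0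
    have h2 := integral_map (μ := Measure.pi fun _ : Fin 1 => nu) this.measurable.aemeasurable
      hgm.aestronglyMeasurable
    rw [this.map_eq] at h2
    exact h2.symm
  | succ m ih =>
    have hTm := applyT_meas hW hgm
    have hTb := applyT_bdd hW h0 hM (memLp_bdd hgm hC)
    rw [Function.iterate_succ_apply, ← ih (applyT W g) hTm _ hTb]
    have mp := measurePreserving_piFinSuccAbove (fun _ : Fin (m + 2) => nu) 0
    have hPm : Measurable fun u : Fin (m + 1) → ℝ => ∏ i : Fin m, W (u i.castSucc) (u i.succ) := by
      refine Finset.measurable_prod _ fun i _ => ?_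
      have h : Measurable fun u : Fin (m + 1) → ℝ => (u i.castSucc, u i.succ) :=
        (measurable_pi_apply i.castSucc).prodMk (measurable_pi_apply i.succ)
      exact hW.comp h
    set Φ : ℝ × (Fin (m + 1) → ℝ) → ℝ := fun q => g q.1 * (W q.1 (q.2 0) *
        ∏ i : Fin m, W (q.2 i.castSucc) (q.2 i.succ)) with hΦ
    have hΦm : Measurable Φ := by
      refine (hgm.comp measurable_fst).mul (Measurable.mul ?_ (hPm.comp measurable_snd))
      exact hW.comp (measurable_fst.prodMk ((measurable_pi_apply 0).comp measurable_snd))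
    have hΦb : ∀ q, ‖Φ q‖ ≤ C * (M * M ^ m) := by
      intro q
      have hM0 : 0 ≤ M := (h0 0 0).trans (hM 0 0)
      have hp0 : 0 ≤ ∏ i : Fin m, W (q.2 i.castSucc) (q.2 i.succ) :=
        Finset.prod_nonneg fun i _ => h0 _ _
      have hpM : ∏ i : Fin m, W (q.2 i.castSucc) (q.2 i.succ) ≤ M ^ m := by
        refine (Finset.prod_le_prod (fun i _ => h0 _ _) fun i _ => hM _ _).trans ?_
        simp
      rw [Real.norm_eq_abs, hΦ]
      simp only [abs_mul]
      rw [abs_of_nonneg (h0 _ _), abs_of_nonneg hp0]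
      exact mul_le_mul (hC _) (mul_le_mul (hM _ _) hpM hp0 hM0)
        (mul_nonneg (h0 _ _) hp0) ((abs_nonneg _).trans (hC 0))
    have hΦi : Integrable Φ (nu.prod (Measure.pi fun _ : Fin (m + 1) => nu)) :=
      Integrable.of_bound hΦm.aestronglyMeasurable _ (Eventually.of_forall hΦb)
    have e1 : ∫ x : Fin (m + 1 + 1) → ℝ, g (x 0) * ∏ i : Fin (m + 1), W (x i.castSucc) (x i.succ)
        ∂(Measure.pi fun _ => nu) = ∫ q, Φ q ∂(nu.prod (Measure.pi fun _ : Fin (m + 1) => nu)) := by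
      rw [← mp.integral_comp' Φ]
      refine integral_congr_ae (Eventually.of_forall fun x => ?_)
      simp only [hΦ]
      rw [Fin.prod_univ_succ]
      simp [MeasurableEquiv.piFinSuccAbove, Fin.insertNthEquiv, Fin.removeNth, Fin.tail]
    rw [e1, integral_prod_symm _ hΦi]
    refine integral_congr_ae (Eventually.of_forall fun u => ?_)
    simp only [hΦ, applyT]
    rw [← integral_mul_const]
    refine integral_congr_ae (Eventually.of_forall fun y => ?_)
    simp only
    rw [hs (u 0) y]; ring

lemma homW_path {W : ℝ → ℝ → ℝ} (hG : IsGraphon W) (m : ℕ) :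
    homDensityW W (pathG m) = ∫ x, (applyT W)^[m] (fun _ => 1) x ∂nu := by
  obtain ⟨hW, h0, hs, M, hM⟩ := hG
  rw [← int_path hW h0 hs hM m _ measurable_const 1 (by simp)]
  unfold homDensityW
  have : (volume : Measure (Fin (m + 1) → ℝ)).restrict (Set.univ.pi fun _ => I01) =
      Measure.pi fun _ => nu := by
    rw [volume_pi, Measure.restrict_pi_pi]
  rw [this]
  refine integral_congr_ae (Eventually.of_forall fun x => ?_)
  simp only
  rw [edgeProd_path m _ fun i j => hs _ _, one_mul]

end paths
end Aux
end Percolation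

namespace Percolation
namespace Aux
set_option linter.unusedSectionVars false
set_option linter.unusedVariables false

section final

instance bern_fin (p : ℝ) : IsFiniteMeasure (bern p) := ⟨by simp [bern]⟩

lemma pi_bern {ι : Type*} [Fintype ι] [DecidableEq ι] {q : ι → ℝ} (h0 : ∀ e, 0 ≤ q e)
    (h1 : ∀ e, q e ≤ 1) (S : (ι → Bool) → Prop) :
    Measure.pi (fun e => bern (q e)) {ω | S ω} = ENNReal.ofReal (Pr q S) := by
  classical
  have hs : ∀ ω : ι → Bool, Measure.pi (fun e => bern (q e)) {ω} = ENNReal.ofReal (wt q ω) := by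
    intro ω
    rw [Measure.pi_singleton]
    unfold wt
    rw [ENNReal.ofReal_prod_of_nonneg]
    · refine Finset.prod_congr rfl fun e _ => ?_
      cases h : ω e <;> simp [bern]
    · intro e _
      split_ifs
      · exact h0 e
      · linarith [h1 e]
  have e1 : {ω | S ω} = ((Finset.univ.filter fun ω => S ω : Finset (ι → Bool)) : Set (ι → Bool)) := by
    ext; simp
  rw [e1, ← sum_measure_singleton]
  simp_rw [hs]
  rw [← ENNReal.ofReal_sum_of_nonneg fun ω _ => wt_nonneg h0 h1 ω]
  congr 1
  rw [Pr_eq, Ex, Finset.sum_filter]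
  exact Finset.sum_congr rfl fun ω _ => by split_ifs <;> simp

lemma core (β : ∀ n : ℕ, Fin n → Fin n → ℝ) (βmax : ℝ)
    (hsym : ∀ n i j, β n i j = β n j i)
    (hnonneg : ∀ n i j, 0 ≤ β n i j)
    (hbound : ∀ n i j, β n i j ≤ βmax)
    (W : ℝ → ℝ → ℝ) (hW : IsGraphon W) (hconv : ConvergesTo β W)
    (c : ℝ) (hc : 0 < c) (hsup : 1 < c * opNorm W)
    (α : ℝ) (hα0 : 0 ≤ α) (hα : α < (c * opNorm W - 1) / (c * βmax)) (η : ℝ) (hη : 0 < η) :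
    ∀ᶠ n : ℕ in atTop, ENNReal.ofReal (1 - η) ≤
      percMeasure (β n) (c / n) {ω | α * n ≤ (C1 (graphOf ω) : ℝ)} := by
  have hT : 0 < opNorm W := by
    by_contra h
    have := mul_nonpos_of_nonneg_of_nonpos hc.le (not_lt.1 h)
    linarith
  have hev : ∀ l : ℝ, 0 < l → l < opNorm W → ∀ᶠ n : ℕ in atTop, 0 < βmax ∧ ∃ v : Fin n → ℝ,
      (∀ i, 0 ≤ v i) ∧ (∀ i, v i ≤ βmax / l) ∧ (∑ i, v i ^ 2 = n) ∧
      ∀ i, l * n * v i ≤ ∑ j, β n i j * v j := by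
    intro l hl hlW
    obtain ⟨m, hm⟩ := path_big hW hl hlW
    have ht := hconv (m + 1) (pathG m)
    rw [homW_path hW] at ht
    filter_upwards [ht.eventually (lt_mem_nhds hm)] with n hn
    rw [homG_path _ (hsym n)] at hn
    exact exists_vec (hsym n) (hnonneg n) (hbound n) hl hn
  obtain ⟨n0, hB, _⟩ := (hev (opNorm W / 2) (by linarith) (by linarith)).exists
  have hα2 : βmax * α + 1 / c < opNorm W := by
    rw [lt_div_iff₀ (by positivity)] at hα
    rw [← mul_lt_mul_iff_right₀ hc]
    have : c * (βmax * α + 1 / c) = α * (c * βmax) + 1 := by field_simp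
    rw [this]; linarith
  obtain ⟨l, hl1, hl2⟩ := exists_between hα2
  have hBα : 0 ≤ βmax * α := by positivity
  have hcinv : 0 < 1 / c := by positivity
  have hl0 : 0 < l := by linarith
  have hd : 1 / c < l - βmax * α := by linarith
  have hd0 : 0 < l - βmax * α := by linarith
  have hd2 : 1 / (l - βmax * α) < c := by
    rw [div_lt_iff₀ hd0]
    rw [div_lt_iff₀ hc] at hd
    linarith
  obtain ⟨c1, hc1, hc1c⟩ := exists_between hd2
  have hc10 : 0 < c1 := lt_trans (by positivity) hc1
  have hθ : 1 < c1 * (l - βmax * α) := by rwa [div_lt_iff₀ hd0] at hc1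
  obtain ⟨N, hN⟩ := finite_main (b := c1 * βmax) (M := βmax / l) (μ := c1 * l)
    (θ := c1 * (l - βmax * α) - 1) (τ := (c - c1) / c1) (α := α) (by positivity) (by positivity)
    (by nlinarith [mul_nonneg hc10.le hBα]) (by linarith)
    (div_pos (by linarith) hc10) (le_of_eq (by ring)) η hη
  obtain ⟨N', hN'⟩ := exists_nat_gt (c * βmax)
  filter_upwards [hev l hl0 hl2, eventually_ge_atTop N, eventually_ge_atTop N'] with n hn hnN hnN'
  obtain ⟨_, v, hv0, hvM, hv2, hv⟩ := hn
  have hncB : c * βmax < n := hN'.trans_le (by exact_mod_cast hnN')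
  have hn0 : (0:ℝ) < n := lt_trans (by positivity) hncB
  have hval : ∀ i j, sym2Val (β n) s(i, j) = β n i j := by
    intro i j
    simp [sym2Val, hsym n j i]
  have hv1 : ∀ e, 0 ≤ sym2Val (β n) e ∧ sym2Val (β n) e ≤ βmax := by
    intro e
    induction e using Sym2.ind with
    | _ i j => rw [hval]; exact ⟨hnonneg n i j, hbound n i j⟩
  set p : Sym2 (Fin n) → ℝ := fun e => c / n * sym2Val (β n) e with hp
  have hp0 : ∀ e, 0 ≤ p e := fun e => mul_nonneg (by positivity) (hv1 e).1
  have hp1 : ∀ e, p e < 1 := by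
    intro e
    refine (mul_le_mul_of_nonneg_left (hv1 e).2 (by positivity : 0 ≤ c / n)).trans_lt ?_
    rw [div_mul_eq_mul_div, div_lt_one hn0]; exact hncB
  set p1 : Sym2 (Fin n) → ℝ := fun e => c1 / n * sym2Val (β n) e with hp1d
  have hp10 : ∀ e, 0 ≤ p1 e := fun e => mul_nonneg (by positivity) (hv1 e).1
  have hp1p : ∀ e, p1 e ≤ p e := fun e =>
    mul_le_mul_of_nonneg_right (by gcongr) (hv1 e).1
  have hp11 : ∀ e, p1 e < 1 := fun e => (hp1p e).trans_lt (hp1 e)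
  have hτ : ∀ e, (c - c1) / c1 * p1 e = p e - p1 e := by
    intro e; simp only [hp, hp1d]; field_simp
  set p2 : Sym2 (Fin n) → ℝ := fun e => (p e - p1 e) / (1 - p1 e) with hp2
  have h := hN n hnN p p1 p2 v ⟨hp10, fun e => (hp11 e).le, ?_⟩ ?_ ?_ ?_ ?_ hv0 hvM ?_ hv2
  · have hperc : percMeasure (β n) (c / n) {ω | α * n ≤ (C1 (graphOf ω) : ℝ)} =
        ENNReal.ofReal (Pr p fun ω => α * n ≤ (C1 (graphOf ω) : ℝ)) := by
      rw [← pi_bern hp0 (fun e => (hp1 e).le)]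
      unfold percMeasure
      congr 2
      ext1 e
      rw [min_eq_left (hp1 e).le]
    rw [hperc]
    apply ENNReal.ofReal_le_ofReal
    have := Pr_compl p (fun ω => (C1 (graphOf ω) : ℝ) < α * n)
    simp only [not_lt] at this
    rw [this]; linarith
  · intro i j
    simp only [hp1d, hval]
    rw [div_mul_eq_mul_div]
    have := hbound n i j
    gcongr
  · intro e
    exact div_nonneg (by linarith [hp1p e]) (by linarith [hp11 e])
  · intro e
    rw [hp2, div_le_one (by linarith [hp11 e])]; linarith [hp1 e]
  · intro e
    rw [hτ, hp2, le_div_iff₀ (by linarith [hp11 e])]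
    have := mul_nonneg (sub_nonneg.2 (hp1p e)) (hp10 e)
    linarith
  · intro e
    have : 1 - p1 e ≠ 0 := by linarith [hp11 e]
    simp only [hp2]
    field_simp
    ring
  · intro i
    have := mul_le_mul_of_nonneg_left (hv i) (by positivity : 0 ≤ c1 / n)
    rw [Finset.mul_sum] at this
    calc c1 * l * v i = c1 / n * (l * n * v i) := by field_simp
      _ ≤ _ := this
      _ = _ := Finset.sum_congr rfl fun j _ => by simp only [hp1d, hval]; ring

end final
end Aux
end Percolation

open Percolation MeasureTheory Filter Topology in
/-- If `(G_n)` converges to a graphon `W` and `c ‖T_W‖ > 1`, then for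
every constant `α < (c ‖T_W‖ - 1)/(c βmax)`, whp the largest component of `G_n(c/n)` has
at least `α n` vertices (in particular it has `Θ(n)` vertices whp). -/
theorem supercritical_largest_component_linear
    (β : ∀ n : ℕ, Fin n → Fin n → ℝ) (βmax : ℝ)
    (hsym : ∀ n i j, β n i j = β n j i)
    (hnonneg : ∀ n i j, 0 ≤ β n i j)
    (hdiag : ∀ n i, β n i i = 0)
    (hbound : ∀ n i j, β n i j ≤ βmax)
    (W : ℝ → ℝ → ℝ) (hW : IsGraphon W) (hconv : ConvergesTo β W)
    (c : ℝ) (hc : 0 < c) (hsup : 1 < c * opNorm W) :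
    ∀ α : ℝ, α < (c * opNorm W - 1) / (c * βmax) →
      Tendsto
        (fun n : ℕ => percMeasure (β n) (c / n) {ω | α * n ≤ (C1 (graphOf ω) : ℝ)})
        atTop (nhds 1) := by
  intro α hα
  by_cases hα0 : α ≤ 0
  · have h1 : ∀ n : ℕ, percMeasure (β n) (c / n) {ω | α * n ≤ (C1 (graphOf ω) : ℝ)} = 1 := by
      intro n
      have h0 : ∀ e, 0 ≤ min (c / n * sym2Val (β n) e) 1 := by
        intro e
        refine le_min (mul_nonneg (by positivity) ?_) zero_le_one
        induction e using Sym2.ind with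
        | _ i j =>
          have := hnonneg n i j
          have := hnonneg n j i
          simp only [sym2Val, Sym2.lift_mk]; positivity
      have e := Aux.pi_bern h0 (fun e => min_le_right _ _)
        (fun ω => α * n ≤ (C1 (graphOf ω) : ℝ))
      unfold percMeasure
      rw [e]
      have e2 : Aux.Pr (fun e => min (c / n * sym2Val (β n) e) 1)
          (fun ω => α * n ≤ (C1 (graphOf ω) : ℝ)) = 1 := by
        have ht : ∀ ω : Sym2 (Fin n) → Bool, α * n ≤ (C1 (graphOf ω) : ℝ) := fun ω =>
          (mul_nonpos_of_nonpos_of_nonneg hα0 (Nat.cast_nonneg _)).trans (Nat.cast_nonneg _)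
        classical
        rw [Aux.Pr_eq]
        simp only [ht, if_true]
        exact Aux.Ex_const _ 1
      rw [e2]; simp
    simp_rw [h1]
    exact tendsto_const_nhds
  · have hα0 := (not_le.1 hα0).le
    refine tendsto_order.2 ⟨fun a ha => ?_, fun a ha => ?_⟩
    · obtain ⟨x, hx1, hx2⟩ := ENNReal.lt_iff_exists_real_btwn.1 ha
      obtain ⟨hx3, hx4⟩ := hx2
      have hx5 : x < 1 := by simpa using hx4
      filter_upwards [Aux.core β βmax hsym hnonneg hbound W hW hconv c hc hsup α hα0 hα (1 - x)
        (by linarith)] with n hn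
      rw [sub_sub_cancel] at hn
      exact hx3.trans_le hn
    · refine Eventually.of_forall fun n => lt_of_le_of_lt ?_ ha
      have h0 : ∀ e, 0 ≤ min (c / n * sym2Val (β n) e) 1 := by
        intro e
        refine le_min (mul_nonneg (by positivity) ?_) zero_le_one
        induction e using Sym2.ind with
        | _ i j =>
          have := hnonneg n i j
          have := hnonneg n j i
          simp only [sym2Val, Sym2.lift_mk]; positivity
      have e := Aux.pi_bern h0 (fun e => min_le_right _ _)
        (fun ω => α * n ≤ (C1 (graphOf ω) : ℝ))
      unfold percMeasure
      rw [e]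
      exact ENNReal.ofReal_le_one.2 (Aux.Pr_le_one h0 (fun e => min_le_right _ _) _)
end
end
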